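/- There exist constants α > 0 and C < ∞ such that for all n = 2^{j₀}, m = 2^{−i₀}n as above, and all k with n/m ≤ k ≤ 2n/m, if j is the index with the x-coordinates of H_k contained in I_j, then P(Q_n ∩ H_k ≠ ∅) ≤ C·2^{(1−α)j}·m²·n^{−2}. -/

import Mathlib

/-!
Critical site percolation on the triangular lattice realized on `ℤ²`.
A configuration assigns to each site `true` (open) or `false` (closed),
and `P` is the product Bernoulli(1/2) measure, axiomatized by
`IsBernoulliHalf` below (finite cylinder events have product probability).
-/

open MeasureTheory
open scoped ENNReal

/-- Sites of the lattice: vertices of `ℤ²`. -/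
abbrev Site : Type := ℤ × ℤ

/-- A percolation configuration: `true` = open, `false` = closed. -/
abbrev Config : Type := Site → Bool

/-- Adjacency for the triangular lattice realized on `ℤ²`:
the neighbors of `(x,y)` are `(x±1,y)`, `(x,y±1)`, `(x+1,y-1)`, `(x-1,y+1)`. -/
def Adj (a b : Site) : Prop :=
  (b.1 - a.1, b.2 - a.2) ∈
    ({(1, 0), (-1, 0), (0, 1), (0, -1), (1, -1), (-1, 1)} : Set (ℤ × ℤ))

/-- A (nonempty, self-avoiding) lattice path: a list of distinct sites in which
consecutive sites are neighbors. -/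
def IsPath (p : List Site) : Prop := p ≠ [] ∧ p.Nodup ∧ p.Chain' Adj

/-- A path all of whose vertices lie in the set `S`. -/
def PathIn (S : Set Site) (p : List Site) : Prop := IsPath p ∧ ∀ v ∈ p, v ∈ S

/-- All sites of `p` are open in `ω`. -/
def IsOpenOn (ω : Config) (p : List Site) : Prop := ∀ v ∈ p, ω v = true

/-- All sites of `p` are closed in `ω`. -/
def IsClosedOn (ω : Config) (p : List Site) : Prop := ∀ v ∈ p, ω v = false

/-- The first vertex of `p` lies in `A`. -/
def FirstIn (A : Set Site) (p : List Site) : Prop := ∃ a ∈ A, p.head? = some a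

/-- The last vertex of `p` lies in `A`. -/
def LastIn (A : Set Site) (p : List Site) : Prop := ∃ a ∈ A, p.getLast? = some a

/-- `μ` is the product Bernoulli(1/2) measure on configurations: a probability
measure for which every finite cylinder event has the product probability. -/
def IsBernoulliHalf (μ : Measure Config) : Prop :=
  IsProbabilityMeasure μ ∧
    ∀ (S : Finset Site) (f : Site → Bool),
      μ {ω | ∀ v ∈ S, ω v = f v} = (1 / 2 : ℝ≥0∞) ^ S.card

/-- The lattice rectangle `[x₀,x₁] × [y₀,y₁]`. -/
def rect (x₀ x₁ y₀ y₁ : ℤ) : Set Site :=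
  {v | x₀ ≤ v.1 ∧ v.1 ≤ x₁ ∧ y₀ ≤ v.2 ∧ v.2 ≤ y₁}

/-- The left side of a rectangle. -/
def rectLeft (x₀ x₁ y₀ y₁ : ℤ) : Set Site := {v ∈ rect x₀ x₁ y₀ y₁ | v.1 = x₀}

/-- The right side of a rectangle. -/
def rectRight (x₀ x₁ y₀ y₁ : ℤ) : Set Site := {v ∈ rect x₀ x₁ y₀ y₁ | v.1 = x₁}

/-- The top side of a rectangle. -/
def rectTop (x₀ x₁ y₀ y₁ : ℤ) : Set Site := {v ∈ rect x₀ x₁ y₀ y₁ | v.2 = y₁}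

/-- The bottom side of a rectangle. -/
def rectBot (x₀ x₁ y₀ y₁ : ℤ) : Set Site := {v ∈ rect x₀ x₁ y₀ y₁ | v.2 = y₀}

/-- A horizontal open crossing of the rectangle `[x₀,x₁] × [y₀,y₁]`:
an open path in the rectangle from its left side to its right side. -/
def HorizCrossing (x₀ x₁ y₀ y₁ : ℤ) (ω : Config) (p : List Site) : Prop :=
  PathIn (rect x₀ x₁ y₀ y₁) p ∧ IsOpenOn ω p ∧
    FirstIn (rectLeft x₀ x₁ y₀ y₁) p ∧ LastIn (rectRight x₀ x₁ y₀ y₁) p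

/-- `v` is a pivotal site for the box `B(n) = [-n,n]²`: some horizontal open
crossing of `B(n)` contains `v`, and there are two disjoint closed paths in
`B(n)` started from `v` (i.e. starting at a neighbor of `v`), one to the top
side and one to the bottom side of `B(n)`. -/
def Pivotal (n : ℤ) (ω : Config) (v : Site) : Prop :=
  (∃ p, HorizCrossing (-n) n (-n) n ω p ∧ v ∈ p) ∧
    ∃ q₁ q₂ : List Site,
      PathIn (rect (-n) n (-n) n) q₁ ∧ IsClosedOn ω q₁ ∧
        FirstIn {w | Adj v w} q₁ ∧ LastIn (rectTop (-n) n (-n) n) q₁ ∧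
      PathIn (rect (-n) n (-n) n) q₂ ∧ IsClosedOn ω q₂ ∧
        FirstIn {w | Adj v w} q₂ ∧ LastIn (rectBot (-n) n (-n) n) q₂ ∧
      List.Disjoint q₁ q₂

/-- `Q_n`: the set of pivotal sites for `B(n)`. -/
def Qset (n : ℤ) (ω : Config) : Set Site := {v | Pivotal n ω v}

/-- The block `H_k`: `{(x,y) ∈ B(n) : -n+(k-1)m < x ≤ -n+km, -n ≤ y ≤ -n+m}`. -/
def Hblock (n m : ℤ) (k : ℕ) : Set Site :=
  {v | -n + ((k : ℤ) - 1) * m < v.1 ∧ v.1 ≤ -n + (k : ℤ) * m ∧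
        -n ≤ v.2 ∧ v.2 ≤ -n + m}

/-- The dyadic interval `I_j` (for `n = 2^j₀`, `m = 2^{j₀-i₀}`):
`I_j = (n - 2^{-j}n, n - 2^{-j-1}n]` for `j < i₀` and `I_{i₀} = (n-m, n]`. -/
def Iset (j₀ i₀ j : ℕ) : Set ℤ :=
  if j = i₀ then Set.Ioc ((2 : ℤ) ^ j₀ - 2 ^ (j₀ - i₀)) ((2 : ℤ) ^ j₀)
  else Set.Ioc ((2 : ℤ) ^ j₀ - 2 ^ (j₀ - j)) ((2 : ℤ) ^ j₀ - 2 ^ (j₀ - j - 1))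

/-- `F` depends only on the part of the configuration inside `W`. -/
def Dep {α : Sort*} (W : Set Site) (F : Set Site → α) : Prop :=
  ∀ A B : Set Site, A ∩ W = B ∩ W → F A = F B

theorem Dep.mono {α : Sort*} {W W' : Set Site} {F : Set Site → α} (h : Dep W F) (hW : W ⊆ W') :
    Dep W' F := by
  intro A B hAB
  apply h
  rw [← Set.inter_eq_self_of_subset_right hW, ← Set.inter_assoc, hAB, Set.inter_assoc]

theorem Dep.of_imp {W : Set Site} {p : Set Site → Prop}
    (h : ∀ A B : Set Site, A ∩ W = B ∩ W → p A → p B) : Dep W p :=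
  fun A B hAB => propext ⟨h A B hAB, h B A hAB.symm⟩

theorem Dep.and {W : Set Site} {p q : Set Site → Prop} (hp : Dep W p) (hq : Dep W q) :
    Dep W (fun A => p A ∧ q A) := by
  intro A B h
  simp only [hp A B h, hq A B h]

theorem Dep.not {W : Set Site} {p : Set Site → Prop} (hp : Dep W p) :
    Dep W (fun A => ¬ p A) := by
  intro A B h
  simp only [hp A B h]

/-- Expectation of `F` when every site of `V` belongs to the random set independently with
probability `1 / 2`. -/
noncomputable def ex (V : Finset Site) (F : Set Site → ℝ) : ℝ :=
  (∑ A ∈ V.powerset, F (A : Set Site)) / 2 ^ V.card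

open Classical in
/-- Indicator of a proposition. -/
noncomputable def ind (p : Prop) : ℝ := if p then 1 else 0

theorem ind_of {p : Prop} (h : p) : ind p = 1 := by simp [ind, h]
theorem ind_of_not {p : Prop} (h : ¬ p) : ind p = 0 := by simp [ind, h]

theorem ind_nonneg (p : Prop) : 0 ≤ ind p := by
  unfold ind; split_ifs <;> norm_num

theorem ind_le_one (p : Prop) : ind p ≤ 1 := by
  unfold ind; split_ifs <;> norm_num

theorem ind_and (p q : Prop) : ind (p ∧ q) = ind p * ind q := by
  unfold ind; by_cases hp : p <;> by_cases hq : q <;> simp [hp, hq]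

theorem ind_not (p : Prop) : ind (¬ p) = 1 - ind p := by
  unfold ind; by_cases hp : p <;> simp [hp]

theorem ind_mono {p q : Prop} (h : p → q) : ind p ≤ ind q := by
  unfold ind
  by_cases hp : p
  · simp [hp, h hp]
  · by_cases hq : q <;> simp [hp, hq]

/-- Probability of the event `p`. -/
noncomputable def pr (V : Finset Site) (p : Set Site → Prop) : ℝ := ex V (fun A => ind (p A))

theorem ex_congr {V : Finset Site} {F G : Set Site → ℝ}
    (h : ∀ A : Set Site, A ⊆ V → F A = G A) : ex V F = ex V G := by
  unfold ex
  congr 1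
  exact Finset.sum_congr rfl fun A hA => h A (by exact_mod_cast Finset.mem_powerset.1 hA)

theorem ex_mono {V : Finset Site} {F G : Set Site → ℝ}
    (h : ∀ A : Set Site, A ⊆ V → F A ≤ G A) : ex V F ≤ ex V G := by
  unfold ex
  gcongr with A hA
  exact h A (by exact_mod_cast Finset.mem_powerset.1 hA)

theorem ex_add (V : Finset Site) (F G : Set Site → ℝ) :
    ex V (fun A => F A + G A) = ex V F + ex V G := by
  unfold ex; rw [Finset.sum_add_distrib, add_div]

theorem ex_sub (V : Finset Site) (F G : Set Site → ℝ) :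
    ex V (fun A => F A - G A) = ex V F - ex V G := by
  unfold ex; rw [Finset.sum_sub_distrib, sub_div]

theorem ex_const_mul (V : Finset Site) (c : ℝ) (F : Set Site → ℝ) :
    ex V (fun A => c * F A) = c * ex V F := by
  unfold ex; rw [← Finset.mul_sum, mul_div_assoc]

theorem ex_mul_const (V : Finset Site) (F : Set Site → ℝ) (c : ℝ) :
    ex V (fun A => F A * c) = ex V F * c := by
  simp only [mul_comm _ c, ex_const_mul]

theorem ex_const (V : Finset Site) (c : ℝ) : ex V (fun _ => c) = c := by
  unfold ex; simp

theorem ex_sum {ι : Type*} (V : Finset Site) (s : Finset ι) (F : ι → Set Site → ℝ) :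
    ex V (fun A => ∑ i ∈ s, F i A) = ∑ i ∈ s, ex V (F i) := by
  unfold ex; rw [Finset.sum_comm, Finset.sum_div]

theorem ex_empty (F : Set Site → ℝ) : ex ∅ F = F ∅ := by simp [ex]

theorem ex_insert {a : Site} {V : Finset Site} (h : a ∉ V) (F : Set Site → ℝ) :
    ex (insert a V) F = (ex V F + ex V (fun A => F (insert a A))) / 2 := by
  unfold ex
  rw [Finset.sum_powerset_insert h, Finset.card_insert_of_notMem h, pow_succ]
  simp only [Finset.coe_insert]
  field_simp

theorem ex_union {V W : Finset Site} (h : Disjoint V W) (F : Set Site → ℝ) :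
    ex (V ∪ W) F = ex V (fun A => ex W (fun B => F (A ∪ B))) := by
  induction W using Finset.induction generalizing F with
  | empty => simp [ex_empty]
  | insert a W ha ih =>
    have h1 : Disjoint V W := h.mono_right (Finset.subset_insert a W)
    have h2 : a ∉ V ∪ W := by
      have := Finset.disjoint_right.1 h (Finset.mem_insert_self a W)
      simp [ha, this]
    rw [Finset.union_insert, ex_insert h2, ih h1, ih h1, ← ex_add]
    simp only [ex_insert ha, div_eq_mul_inv]
    rw [← ex_mul_const]
    simp only [Set.union_insert]

theorem ex_image (V : Finset Site) (e : Site ≃ Site) (F : Set Site → ℝ) :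
    ex (V.map e.toEmbedding) F = ex V (fun A => F (e '' A)) := by
  induction V using Finset.induction generalizing F with
  | empty => simp [ex_empty]
  | insert a V ha ih =>
    rw [Finset.map_insert, ex_insert (by simpa using ha), ex_insert ha, ih, ih]
    simp [Set.image_insert_eq]

theorem ex_sdiff (V : Finset Site) (F : Set Site → ℝ) :
    ex V (fun A => F ((V : Set Site) \ A)) = ex V F := by
  unfold ex
  congr 1
  refine Finset.sum_bij' (fun A _ => V \ A) (fun A _ => V \ A) ?_ ?_ ?_ ?_ ?_
  · intro A hA; simp
  · intro A hA; simp
  · intro A hA; simpa using Finset.mem_powerset.1 hA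
  · intro A hA; simpa using Finset.mem_powerset.1 hA
  · intro A hA; simp

theorem ex_compl {V : Finset Site} {F : Set Site → ℝ} (hF : Dep (V : Set Site) F) :
    ex V (fun A => F Aᶜ) = ex V F := by
  rw [← ex_sdiff V F]
  refine ex_congr fun A _ => hF _ _ ?_
  ext x; simp [and_comm]

theorem ex_of_subset {V V' : Finset Site} (h : V ⊆ V') {F : Set Site → ℝ}
    (hF : Dep (V : Set Site) F) : ex V' F = ex V F := by
  rw [← Finset.union_sdiff_of_subset h, ex_union Finset.disjoint_sdiff]
  refine ex_congr fun A _ => ?_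
  rw [← ex_const (V' \ V) (F A)]
  refine ex_congr fun B hB => hF _ _ ?_
  ext x
  simp only [Set.mem_inter_iff, Set.mem_union]
  have := @hB x
  simp only [Finset.coe_sdiff, Set.mem_sdiff] at this
  tauto

theorem ex_mul_of_indep (V : Finset Site) {W₁ W₂ : Set Site} (h : Disjoint W₁ W₂)
    {F G : Set Site → ℝ} (hF : Dep W₁ F) (hG : Dep W₂ G) :
    ex V (fun A => F A * G A) = ex V F * ex V G := by
  classical
  have h1 : Disjoint (V.filter (· ∈ W₁)) (V.filter (· ∉ W₁)) := Finset.disjoint_filter_filter_not _ _ _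
  have h2 : V.filter (· ∈ W₁) ∪ V.filter (· ∉ W₁) = V := Finset.filter_union_filter_not_eq _ _
  have key : ∀ A B : Set Site, A ⊆ (V.filter (· ∈ W₁) : Finset Site) →
      B ⊆ (V.filter (· ∉ W₁) : Finset Site) → F (A ∪ B) = F A ∧ G (A ∪ B) = G B := by
    intro A B hA hB
    constructor
    · apply hF
      ext x
      have := @hB x
      simp only [Finset.coe_filter, Set.mem_ofPred_eq] at this
      simp only [Set.mem_inter_iff, Set.mem_union]
      tauto
    · apply hG
      ext x
      have := @hA x
      have h3 := fun (a : x ∈ W₁) (b : x ∈ W₂) => Set.disjoint_left.1 h a b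
      simp only [Finset.coe_filter, Set.mem_ofPred_eq] at this
      simp only [Set.mem_inter_iff, Set.mem_union]
      tauto
  have e1 : ex V F = ex (V.filter (· ∈ W₁)) F := by
    conv_lhs => rw [← h2, ex_union h1]
    refine ex_congr fun A hA => ?_
    rw [← ex_const (V.filter (· ∉ W₁)) (F A)]
    exact ex_congr fun B hB => (key A B hA hB).1
  have e2 : ex V G = ex (V.filter (· ∉ W₁)) G := by
    conv_lhs => rw [← h2, ex_union h1]
    conv_rhs => rw [← ex_const (V.filter (· ∈ W₁)) (ex (V.filter (· ∉ W₁)) G)]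
    exact ex_congr fun A hA => ex_congr fun B hB => (key A B hA hB).2
  rw [e1, e2]
  conv_lhs => rw [← h2, ex_union h1]
  rw [← ex_mul_const]
  refine ex_congr fun A hA => ?_
  rw [← ex_const_mul]
  refine ex_congr fun B hB => ?_
  rw [(key A B hA hB).1, (key A B hA hB).2]

theorem pr_nonneg (V : Finset Site) (p : Set Site → Prop) : 0 ≤ pr V p := by
  rw [← ex_const V 0]; exact ex_mono fun A _ => ind_nonneg _

theorem pr_le_one (V : Finset Site) (p : Set Site → Prop) : pr V p ≤ 1 := by
  rw [← ex_const V 1]; exact ex_mono fun A _ => ind_le_one _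

theorem pr_mono {V : Finset Site} {p q : Set Site → Prop} (h : ∀ A, p A → q A) :
    pr V p ≤ pr V q :=
  ex_mono fun A _ => ind_mono (h A)

theorem pr_congr {V : Finset Site} {p q : Set Site → Prop} (h : ∀ A, p A ↔ q A) :
    pr V p = pr V q := by
  simp only [pr, h]

theorem pr_not (V : Finset Site) (p : Set Site → Prop) : pr V (fun A => ¬ p A) = 1 - pr V p := by
  simp only [pr, ind_not, ex_sub, ex_const]

theorem pr_exists_le {ι : Type*} (V : Finset Site) (s : Finset ι) (p : ι → Set Site → Prop) :
    pr V (fun A => ∃ i ∈ s, p i A) ≤ ∑ i ∈ s, pr V (p i) := by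
  simp only [pr]
  rw [← ex_sum]
  refine ex_mono fun A _ => ?_
  by_cases h : ∃ i ∈ s, p i A
  · rw [ind_of h]
    obtain ⟨i, hi, hp⟩ := h
    rw [← ind_of hp]
    exact Finset.single_le_sum (f := fun i => ind (p i A)) (fun i _ => ind_nonneg _) hi
  · rw [ind_of_not h]; exact Finset.sum_nonneg fun i _ => ind_nonneg _

theorem pr_or_le (V : Finset Site) (p q : Set Site → Prop) :
    pr V (fun A => p A ∨ q A) ≤ pr V p + pr V q := by
  simp only [pr]
  rw [← ex_add]
  refine ex_mono fun A _ => ?_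
  by_cases h : p A ∨ q A
  · rcases h with h | h
    · rw [ind_of (Or.inl h), ind_of h]; linarith [ind_nonneg (q A)]
    · rw [ind_of (Or.inr h), ind_of h]; linarith [ind_nonneg (p A)]
  · rw [ind_of_not h]; exact add_nonneg (ind_nonneg _) (ind_nonneg _)

theorem sum_pr_le {ι : Type*} (V : Finset Site) (s : Finset ι) (p : ι → Set Site → Prop)
    (q : Set Site → Prop) (h : ∀ A, ∀ i ∈ s, p i A → q A)
    (hd : ∀ A, ∀ i ∈ s, ∀ j ∈ s, p i A → p j A → i = j) :
    ∑ i ∈ s, pr V (p i) ≤ pr V q := by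
  simp only [pr]
  rw [← ex_sum]
  refine ex_mono fun A _ => ?_
  by_cases hq : ∃ i ∈ s, p i A
  · obtain ⟨i, hi, hp⟩ := hq
    rw [Finset.sum_eq_single_of_mem i hi, ind_of hp, ind_of (h A i hi hp)]
    intro j hj hji
    exact ind_of_not fun hpj => hji (hd A j hj i hi hpj hp)
  · push Not at hq
    rw [Finset.sum_eq_zero fun i hi => ind_of_not (hq i hi)]
    exact ind_nonneg _

theorem Dep.ind {W : Set Site} {p : Set Site → Prop} (h : Dep W p) : Dep W (fun A => ind (p A)) :=
  fun A B hAB => by simp only [h A B hAB]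

theorem pr_and_of_indep (V : Finset Site) {W₁ W₂ : Set Site} (h : Disjoint W₁ W₂)
    {p q : Set Site → Prop} (hp : Dep W₁ p) (hq : Dep W₂ q) :
    pr V (fun A => p A ∧ q A) = pr V p * pr V q := by
  simp only [pr, ind_and]
  exact ex_mul_of_indep V h hp.ind hq.ind

theorem pr_of_subset {V V' : Finset Site} (h : V ⊆ V') {p : Set Site → Prop}
    (hp : Dep (V : Set Site) p) : pr V' p = pr V p :=
  ex_of_subset h hp.ind

theorem pr_image (V : Finset Site) (e : Site ≃ Site) (p : Set Site → Prop) :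
    pr (V.map e.toEmbedding) p = pr V (fun A => p (e '' A)) :=
  ex_image V e _

theorem pr_compl {V : Finset Site} {p : Set Site → Prop} (hp : Dep (V : Set Site) p) :
    pr V (fun A => p Aᶜ) = pr V p :=
  ex_compl hp.ind

/-- Events are transported by a bijection of the sites. -/
theorem pr_equiv {V V' : Finset Site} (e : Site ≃ Site) {W : Set Site} {p q : Set Site → Prop}
    (hV : W ⊆ V) (hV' : e '' W ⊆ V') (hq : Dep (e '' W) q)
    (hpq : ∀ A, p A ↔ q (e '' A)) : pr V p = pr V' q := by
  classical
  rw [pr_congr hpq, ← pr_image]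
  set U := V'.filter (· ∈ e '' W) with hU
  have hUW : e '' W ⊆ U := by
    intro x hx
    simp only [hU, Finset.coe_filter, Set.mem_ofPred_eq]
    exact ⟨hV' hx, hx⟩
  have hqU : Dep (U : Set Site) q := hq.mono hUW
  rw [pr_of_subset (V := U) (V' := V') (Finset.filter_subset _ _) hqU, pr_of_subset _ hqU]
  intro x hx
  simp only [hU, Finset.mem_filter] at hx
  obtain ⟨y, hy, rfl⟩ := hx.2
  simpa using hV hy

/-- An antitone event may only lose probability if more sites are randomized. -/
theorem pr_antitone_subset {V V' : Finset Site} (h : V ⊆ V') {p : Set Site → Prop}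
    (hp : ∀ A B : Set Site, A ⊆ B → p B → p A) : pr V' p ≤ pr V p := by
  rw [← Finset.union_sdiff_of_subset h]
  unfold pr
  rw [ex_union Finset.disjoint_sdiff]
  refine ex_mono fun A _ => ?_
  rw [← ex_const (V' \ V) (ind (p A))]
  exact ex_mono fun B _ => ind_mono (hp _ _ Set.subset_union_left)

/-- Harris' inequality for decreasing events. -/
theorem pr_mul_le_of_antitone (V : Finset Site) {p q : Set Site → Prop}
    (hp : ∀ A B : Set Site, A ⊆ B → p B → p A) (hq : ∀ A B : Set Site, A ⊆ B → q B → q A) :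
    pr V p * pr V q ≤ pr V (fun A => p A ∧ q A) := by
  classical
  -- the families of finite sets, without the restriction to `V`, are lower sets
  have key : ∀ r : Set Site → Prop,
      pr V r = ((V.powerset.filter fun A : Finset Site => r (A : Set Site)).card : ℝ) / 2 ^ V.card := by
    intro r
    unfold pr ex ind
    rw [Finset.card_filter]
    push_cast
    congr 1
  have low : ∀ r : Set Site → Prop, (∀ A B : Set Site, A ⊆ B → r B → r A) →
      IsLowerSet ((V.powerset.filter fun A : Finset Site => r (A : Set Site) : Finset (Finset Site)) :
        Set (Finset Site)) := by
    intro r hr A B hBA hA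
    simp only [Finset.coe_filter, Finset.mem_powerset, Set.mem_ofPred_eq] at hA ⊢
    exact ⟨hBA.trans hA.1, hr _ _ (by exact_mod_cast hBA) hA.2⟩
  have := (low p hp).le_card_inter_finset' (low q hq) (s := V)
    (fun t ht => Finset.mem_powerset.1 (Finset.mem_filter.1 ht).1)
    (fun t ht => Finset.mem_powerset.1 (Finset.mem_filter.1 ht).1)
  rw [← Finset.filter_and] at this
  rw [key p, key q, key]
  rw [div_mul_div_comm, div_le_div_iff₀ (by positivity) (by positivity)]
  have h' : (((V.powerset.filter fun A : Finset Site => p (A : Set Site)).card : ℝ) *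
      ((V.powerset.filter fun A : Finset Site => q (A : Set Site)).card : ℝ)) ≤
      2 ^ V.card * ((V.powerset.filter fun A : Finset Site => p (A : Set Site) ∧ q (A : Set Site)).card : ℝ) := by
    exact_mod_cast this
  calc _ ≤ _ := mul_le_mul_of_nonneg_right h' (by positivity : (0 : ℝ) ≤ 2 ^ V.card)
    _ = _ := by ring_nf; congr!

/-- A cylinder event has, under the Bernoulli measure, the probability given by counting. -/
theorem IsBernoulliHalf.measure_le {μ : Measure Config} (hμ : IsBernoulliHalf μ) {V : Finset Site}
    {p : Set Site → Prop} (hp : Dep (V : Set Site) p) :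
    μ {ω | p {v | ω v = false}} ≤ ENNReal.ofReal (pr V p) := by
  classical
  have hsub : {ω : Config | p {v | ω v = false}} ⊆
      ⋃ A ∈ V.powerset.filter (fun A : Finset Site => p (A : Set Site)),
        {ω : Config | ∀ v ∈ V, ω v = decide (v ∉ A)} := by
    intro ω hω
    simp only [Set.mem_iUnion, Finset.mem_filter, Finset.mem_powerset, Set.mem_ofPred_eq]
    refine ⟨V.filter (fun v => ω v = false), ⟨Finset.filter_subset _ _, ?_⟩, ?_⟩
    · rw [hp _ {v | ω v = false}]
      · exact hω
      · ext x; simp; tauto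
    · intro v hv
      simp [hv]
  refine (measure_mono hsub).trans ((measure_biUnion_finset_le _ _).trans ?_)
  rw [Finset.sum_congr rfl fun A _ => hμ.2 V (fun v => decide (v ∉ A))]
  rw [Finset.sum_const, nsmul_eq_mul]
  unfold pr ex ind
  rw [ENNReal.ofReal_div_of_pos (by positivity)]
  have : (∑ A ∈ V.powerset, if p (A : Set Site) then (1 : ℝ) else 0) =
      ((V.powerset.filter (fun A : Finset Site => p (A : Set Site))).card : ℝ) := by
    rw [Finset.card_filter]; push_cast; rfl
  rw [div_eq_mul_inv]
  apply le_of_eq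
  congr 1
  · rw [← ENNReal.ofReal_natCast, ← this]
  · rw [one_mul, ← ENNReal.inv_pow, ENNReal.ofReal_pow (by norm_num)]
    simp

theorem adj_iff {a b : Site} : Adj a b ↔
    (b.1 = a.1 + 1 ∧ b.2 = a.2) ∨ (b.1 = a.1 - 1 ∧ b.2 = a.2) ∨
    (b.1 = a.1 ∧ b.2 = a.2 + 1) ∨ (b.1 = a.1 ∧ b.2 = a.2 - 1) ∨
    (b.1 = a.1 + 1 ∧ b.2 = a.2 - 1) ∨ (b.1 = a.1 - 1 ∧ b.2 = a.2 + 1) := by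
  simp only [Adj, Set.mem_insert_iff, Set.mem_singleton_iff, Prod.mk.injEq]
  omega

theorem Adj.symm {a b : Site} (h : Adj a b) : Adj b a := by
  rw [adj_iff] at h ⊢; omega

/-- `x` and `y` are connected by a lattice path inside `X`. -/
def Conn (X : Set Site) (x y : Site) : Prop :=
  x ∈ X ∧ Relation.ReflTransGen (fun a b => Adj a b ∧ b ∈ X) x y

namespace Conn

variable {X X' : Set Site} {x y z : Site}

theorem refl (h : x ∈ X) : Conn X x x := ⟨h, .refl⟩

theorem left_mem (h : Conn X x y) : x ∈ X := h.1

theorem right_mem (h : Conn X x y) : y ∈ X := by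
  obtain ⟨h1, h2⟩ := h
  induction h2 with
  | refl => exact h1
  | tail _ h _ => exact h.2

theorem trans (h : Conn X x y) (h' : Conn X y z) : Conn X x z := ⟨h.1, h.2.trans h'.2⟩

theorem tail (h : Conn X x y) (hyz : Adj y z) (hz : z ∈ X) : Conn X x z :=
  ⟨h.1, h.2.tail ⟨hyz, hz⟩⟩

theorem of_adj (hx : x ∈ X) (hxy : Adj x y) (hy : y ∈ X) : Conn X x y := (refl hx).tail hxy hy

theorem symm (h : Conn X x y) : Conn X y x := by
  obtain ⟨h1, h2⟩ := h
  induction h2 with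
  | refl => exact refl h1
  | tail h3 h4 ih => exact (of_adj h4.2 h4.1.symm (Conn.right_mem ⟨h1, h3⟩)).trans ih

theorem mono (h : Conn X x y) (hX : X ⊆ X') : Conn X' x y :=
  ⟨hX h.1, Relation.ReflTransGen.mono (fun _ _ hab => ⟨hab.1, hX hab.2⟩) _ _ h.2⟩

@[elab_as_elim]
theorem induction {P : Site → Prop} (h : Conn X x y) (h0 : P x)
    (hs : ∀ a b, Conn X x a → Adj a b → b ∈ X → P a → P b) : P y := by
  obtain ⟨h1, h2⟩ := h
  induction h2 with
  | refl => exact h0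
  | tail h3 h4 ih => exact hs _ _ ⟨h1, h3⟩ h4.1 h4.2 ih

/-- The connecting path only visits sites which are themselves connected to `x`. -/
theorem self_cluster (h : Conn X x y) : Conn {z | Conn X x z} x y :=
  h.induction (refl (refl h.1)) fun _ _ ha hab hb ih => ih.tail hab (ha.tail hab hb)

theorem exists_first (h : Conn X x y) {S : Set Site} (hx : x ∉ S) (hy : y ∈ S) :
    ∃ u w, Conn (X \ S) x u ∧ Adj u w ∧ w ∈ S ∧ w ∈ X := by
  have : y ∈ S → ∃ u w, Conn (X \ S) x u ∧ Adj u w ∧ w ∈ S ∧ w ∈ X := by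
    by_contra! hcon
    have h2 : Conn (X \ S) x y := by
      refine h.induction (refl ⟨h.1, hx⟩) fun a b _ hab hb ih => ?_
      refine ih.tail hab ⟨hb, fun hbS => ?_⟩
      exact hcon.2 a b ih hab hbS hb
    exact h2.right_mem.2 hy
  exact this hy

theorem image (h : Conn X x y) (e : Site → Site) (he : ∀ a b, Adj a b → Adj (e a) (e b)) :
    Conn (e '' X) (e x) (e y) :=
  h.induction (refl ⟨x, h.1, rfl⟩) fun a b _ hab hb ih => ih.tail (he a b hab) ⟨b, hb, rfl⟩

variable {φ : Site → ℤ}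

theorem exists_le_level (h : Conn X x y) (hφ : ∀ u v, Adj u v → φ v ≤ φ u + 1) {b : ℤ}
    (hx : φ x ≤ b) (hy : b ≤ φ y) : ∃ y', φ y' = b ∧ Conn (X ∩ {u | φ u ≤ b}) x y' := by
  rcases hx.eq_or_lt with hx | hx
  · exact ⟨x, hx, refl ⟨h.1, hx.le⟩⟩
  · obtain ⟨u, w, h1, h2, h3, h4⟩ := h.exists_first (S := {u | b ≤ φ u})
      (by simpa using hx) (by simpa using hy)
    have h5 := h1.right_mem.2
    have h6 := hφ u w h2
    simp only [Set.mem_ofPred_eq, not_le] at h5 h3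
    refine ⟨w, by omega, Conn.tail (h1.mono ?_) h2 ⟨h4, by simp; omega⟩⟩
    intro v hv
    have := hv.2
    simp only [Set.mem_ofPred_eq, not_le] at this
    exact ⟨hv.1, this.le⟩

/-- A path along which `φ` increases from at most `a` to at least `b` has a sub-path from level `a`
to level `b` which stays between these levels. -/
theorem exists_level (h : Conn X x y) (hφ : ∀ u v, Adj u v → φ v ≤ φ u + 1) {a b : ℤ}
    (hx : φ x ≤ a) (hab : a ≤ b) (hy : b ≤ φ y) :
    ∃ x' y', φ x' = a ∧ φ y' = b ∧ Conn (X ∩ {u | a ≤ φ u ∧ φ u ≤ b}) x' y' ∧ Conn X x x' := by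
  obtain ⟨y', hy', h1⟩ := h.exists_le_level hφ (hx.trans hab) hy
  obtain ⟨x', hx', h2⟩ := h1.symm.exists_le_level (φ := fun u => - φ u) (b := -a)
    (fun u v huv => by have := hφ v u huv.symm; omega) (by omega) (by omega)
  refine ⟨x', y', by omega, hy', h2.symm.mono ?_, ?_⟩
  · intro v hv
    have h3 := hv.2
    have h4 := hv.1.2
    simp only [Set.mem_ofPred_eq] at h3 h4
    exact ⟨hv.1.1, by omega, h4⟩
  · exact (h1.mono Set.inter_subset_left).trans
      (h2.mono (Set.inter_subset_left.trans Set.inter_subset_left))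

end Conn

theorem conn_of_isChain {X : Set Site} {p : List Site} (hp : p.IsChain Adj) (hX : ∀ v ∈ p, v ∈ X)
    {a v : Site} (ha : p.head? = some a) (hv : v ∈ p) : Conn X a v := by
  induction p generalizing a with
  | nil => simp at hv
  | cons b l ih =>
    simp only [List.head?_cons, Option.some.injEq] at ha
    subst ha
    have hbX := hX b (by simp)
    rcases List.mem_cons.1 hv with rfl | hv
    · exact .refl hbX
    · cases l with
      | nil => simp at hv
      | cons c l =>
        rw [List.isChain_cons_cons] at hp
        have := ih hp.2 (fun v hv => hX v (by simp [hv])) (a := c) rfl hv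
        exact (Conn.of_adj hbX hp.1 this.1).trans this

/-! ### A planarity argument: signed crossing numbers -/

/-- Signed number of crossings, by the step from `e` to `e'`, of the ray below `v` which separates
the column of `v` from the next one. -/
def stepCross (v e e' : Site) : ℤ :=
  if e.1 = v.1 ∧ e'.1 = v.1 + 1 ∧ e.2 < v.2 then 1
  else if e'.1 = v.1 ∧ e.1 = v.1 + 1 ∧ e'.2 < v.2 then -1 else 0

theorem step_cases {e e' : Site} (h : Adj e e') (v : Site) :
    (e'.1 = e.1 ∧ stepCross v e e' = 0) ∨
    (e'.1 = e.1 + 1 ∧ stepCross v e e' = if e.1 = v.1 ∧ e.2 < v.2 then 1 else 0) ∨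
    (e.1 = e'.1 + 1 ∧ stepCross v e e' = - if e'.1 = v.1 ∧ e'.2 < v.2 then 1 else 0) := by
  have : e'.1 = e.1 ∨ e'.1 = e.1 + 1 ∨ e.1 = e'.1 + 1 := by rw [adj_iff] at h; omega
  unfold stepCross
  rcases this with h | h | h
  · left
    rw [if_neg (by omega), if_neg (by omega)]
    exact ⟨h, rfl⟩
  · right; left
    refine ⟨h, ?_⟩
    split_ifs <;> omega
  · right; right
    refine ⟨h, ?_⟩
    split_ifs <;> omega

theorem stepCross_horizontal {v v' e e' : Site} (hx : v'.1 = v.1 + 1)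
    (hy : v'.2 = v.2 ∨ v'.2 = v.2 - 1) (hadj : Adj e e')
    (n1 : ¬ (e.1 = v.1 ∧ e.2 = v.2)) (n2 : ¬ (e'.1 = v.1 ∧ e'.2 = v.2))
    (n3 : ¬ (e.1 = v'.1 ∧ e.2 = v'.2)) (n4 : ¬ (e'.1 = v'.1 ∧ e'.2 = v'.2)) :
    stepCross v e e' - stepCross v' e e' =
      (if e'.1 = v'.1 ∧ e'.2 < v'.2 then 1 else 0) -
      (if e.1 = v'.1 ∧ e.2 < v'.2 then 1 else 0) := by
  have h2 := adj_iff.1 hadj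
  rcases step_cases hadj v with h | h | h <;> rcases step_cases hadj v' with h' | h' | h' <;>
    first
      | (exfalso; omega)
      | (rw [h.2, h'.2]; clear h' hadj; replace h := h.1; split_ifs <;> omega)

theorem stepCross_vertical {v v' e e' : Site} (hx : v'.1 = v.1) (hy : v'.2 = v.2 + 1)
    (hadj : Adj e e') (n1 : ¬ (e.1 = v.1 ∧ e.2 = v.2)) (n2 : ¬ (e'.1 = v.1 ∧ e'.2 = v.2)) :
    stepCross v e e' = stepCross v' e e' := by
  rcases step_cases hadj v with h | h | h <;> rcases step_cases hadj v' with h' | h' | h' <;>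
    first
      | (exfalso; omega)
      | (rw [h.2, h'.2]; try (split_ifs <;> omega))

theorem Conn.exists_crossing_number {Y : Set Site} {a b : Site} (h : Conn Y a b)
    (hl : ∀ x ≤ a.1, (x, a.2) ∈ Y) :
    ∃ N : Site → ℤ,
      (∀ v v', v ∉ Y → v' ∉ Y → v'.1 = v.1 + 1 → (v'.2 = v.2 ∨ v'.2 = v.2 - 1) →
        N v - N v' = if b.1 = v'.1 ∧ b.2 < v'.2 then 1 else 0) ∧
      (∀ v v', v ∉ Y → v' ∉ Y → v'.1 = v.1 → v'.2 = v.2 + 1 → N v = N v') ∧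
      (∀ v, (∀ y ∈ Y, y.1 = v.1 → v.2 < y.2) → N v = 0) ∧
      (∀ w, (∀ y ∈ Y, y.1 = w.1 → y.2 < w.2) → N w = if b.1 ≤ w.1 then 0 else 1) := by
  refine h.induction ?_ ?_
  · refine ⟨fun v => if v.1 < a.1 ∧ a.2 < v.2 then 1 else 0, ?_, ?_, ?_, ?_⟩
    · rintro ⟨v1, v2⟩ ⟨w1, w2⟩ hv hw h1 h2
      have e1 : v1 ≤ a.1 → v2 ≠ a.2 := fun hle he => hv (by simpa [he] using hl v1 hle)
      have e2 : w1 ≤ a.1 → w2 ≠ a.2 := fun hle he => hw (by simpa [he] using hl w1 hle)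
      simp only at h1 h2 ⊢
      split_ifs <;> omega
    · rintro ⟨v1, v2⟩ ⟨w1, w2⟩ hv hw h1 h2
      have e1 : v1 ≤ a.1 → v2 ≠ a.2 := fun hle he => hv (by simpa [he] using hl v1 hle)
      simp only at h1 h2 ⊢
      split_ifs <;> omega
    · intro v hv
      refine if_neg ?_
      rintro ⟨h1, h2⟩
      have := hv _ (hl v.1 h1.le) rfl
      simp only at this
      omega
    · intro w hw
      simp only
      by_cases h1 : a.1 ≤ w.1
      · rw [if_neg (by omega), if_pos h1]
      · have := hw _ (hl w.1 (by omega)) rfl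
        simp only at this
        rw [if_pos (by omega), if_neg h1]
  · rintro e e' he hadj he' ⟨N, h1, h2, h3, h4⟩
    have heY := he.right_mem
    refine ⟨fun v => N v + stepCross v e e', ?_, ?_, ?_, ?_⟩
    · intro v v' hv hv' hx hy
      have := h1 v v' hv hv' hx hy
      have n1 : ¬ (e.1 = v.1 ∧ e.2 = v.2) := fun hh => hv (by rwa [← Prod.ext hh.1 hh.2])
      have n2 : ¬ (e'.1 = v.1 ∧ e'.2 = v.2) := fun hh => hv (by rwa [← Prod.ext hh.1 hh.2])
      have n3 : ¬ (e.1 = v'.1 ∧ e.2 = v'.2) := fun hh => hv' (by rwa [← Prod.ext hh.1 hh.2])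
      have n4 : ¬ (e'.1 = v'.1 ∧ e'.2 = v'.2) := fun hh => hv' (by rwa [← Prod.ext hh.1 hh.2])
      suffices stepCross v e e' - stepCross v' e e' =
          (if e'.1 = v'.1 ∧ e'.2 < v'.2 then 1 else 0) -
          (if e.1 = v'.1 ∧ e.2 < v'.2 then 1 else 0) by
        simp only; linarith
      exact stepCross_horizontal hx hy hadj n1 n2 n3 n4
    · intro v v' hv hv' hx hy
      have := h2 v v' hv hv' hx hy
      have n1 : ¬ (e.1 = v.1 ∧ e.2 = v.2) := fun hh => hv (by rwa [← Prod.ext hh.1 hh.2])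
      have n2 : ¬ (e'.1 = v.1 ∧ e'.2 = v.2) := fun hh => hv (by rwa [← Prod.ext hh.1 hh.2])
      suffices stepCross v e e' = stepCross v' e e' by simp only; linarith
      exact stepCross_vertical hx hy hadj n1 n2
    · intro v hv
      have := hv e heY
      have := hv e' he'
      simp only [h3 v hv, zero_add]
      unfold stepCross
      rw [if_neg (by omega), if_neg (by omega)]
    · intro w hw
      have := hw e heY
      have := hw e' he'
      simp only [h4 w hw]
      rcases step_cases hadj w with h | h | h <;> rw [h.2] <;> split_ifs <;> omega

/-- A bi-infinite curve `Y` going from left to right separates what is above from what is below. -/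
theorem not_conn_of_curve {Y Z : Set Site} (hYZ : Disjoint Y Z) {a b v w : Site}
    (hY : Conn Y a b) (hZ : Conn Z v w) (hl : ∀ x ≤ a.1, (x, a.2) ∈ Y)
    (hr : ∀ x, b.1 ≤ x → (x, b.2) ∈ Y) (hv : ∀ y ∈ Y, y.1 = v.1 → v.2 < y.2)
    (hw : ∀ y ∈ Y, y.1 = w.1 → y.2 < w.2) : False := by
  obtain ⟨N, h1, h2, h3, h4⟩ := hY.exists_crossing_number hl
  have hn : ∀ z ∈ Z, z ∉ Y := fun z hz hy => Set.disjoint_left.1 hYZ hy hz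
  have hor : ∀ z z', z ∉ Y → z' ∉ Y → z'.1 = z.1 + 1 → (z'.2 = z.2 ∨ z'.2 = z.2 - 1) →
      N z + (if b.1 ≤ z.1 ∧ b.2 < z.2 then 1 else 0) =
      N z' + (if b.1 ≤ z'.1 ∧ b.2 < z'.2 then 1 else 0) := by
    rintro ⟨z1, z2⟩ ⟨z1', z2'⟩ hz hz' hx hy
    have e0 := h1 _ _ hz hz' hx hy
    have e1 : b.1 ≤ z1 → z2 ≠ b.2 := fun hle he => hz (by simpa [he] using hr z1 hle)
    have e2 : b.1 ≤ z1' → z2' ≠ b.2 := fun hle he => hz' (by simpa [he] using hr z1' hle)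
    simp only at hx hy e0 ⊢
    split_ifs at e0 ⊢ <;> omega
  have ver : ∀ z z', z ∉ Y → z' ∉ Y → z'.1 = z.1 → z'.2 = z.2 + 1 →
      N z + (if b.1 ≤ z.1 ∧ b.2 < z.2 then 1 else 0) =
      N z' + (if b.1 ≤ z'.1 ∧ b.2 < z'.2 then 1 else 0) := by
    rintro ⟨z1, z2⟩ ⟨z1', z2'⟩ hz hz' hx hy
    have e0 := h2 _ _ hz hz' hx hy
    have e1 : b.1 ≤ z1 → z2 ≠ b.2 := fun hle he => hz (by simpa [he] using hr z1 hle)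
    simp only at hx hy e0 ⊢
    split_ifs <;> omega
  have hM : N w + (if b.1 ≤ w.1 ∧ b.2 < w.2 then 1 else 0) =
      N v + (if b.1 ≤ v.1 ∧ b.2 < v.2 then 1 else 0) := by
    refine hZ.induction (P := fun w => N w + (if b.1 ≤ w.1 ∧ b.2 < w.2 then 1 else 0) =
      N v + (if b.1 ≤ v.1 ∧ b.2 < v.2 then 1 else 0)) rfl ?_
    intro z z' hz hadj hz' ih
    rw [← ih]
    have m1 := hn _ hz.right_mem
    have m2 := hn _ hz'
    rcases adj_iff.1 hadj with h | h | h | h | h | h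
    · exact (hor z z' m1 m2 h.1 (by omega)).symm
    · exact hor z' z m2 m1 (by omega) (by omega)
    · exact (ver z z' m1 m2 h.1 h.2).symm
    · exact ver z' z m2 m1 (by omega) (by omega)
    · exact (hor z z' m1 m2 h.1 (by omega)).symm
    · exact hor z' z m2 m1 (by omega) (by omega)
  rw [h3 v hv, h4 w hw] at hM
  have t1 : b.1 ≤ v.1 → v.2 < b.2 := fun h => hv (v.1, b.2) (hr v.1 h) rfl
  have t2 : b.1 ≤ w.1 → b.2 < w.2 := fun h => hw (w.1, b.2) (hr w.1 h) rfl
  split_ifs at hM <;> omega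

/-! ### Crossing events -/

/-- There is a path in `A ∩ R` from `S` to `T`. -/
def Cross (A R S T : Set Site) : Prop := ∃ u ∈ S, ∃ v ∈ T, Conn (A ∩ R) u v

theorem Cross.mono {A A' R R' S S' T T' : Set Site} (h : Cross A R S T) (hA : A ⊆ A')
    (hR : R ⊆ R') (hS : S ⊆ S') (hT : T ⊆ T') : Cross A' R' S' T' := by
  obtain ⟨u, hu, v, hv, h⟩ := h
  exact ⟨u, hS hu, v, hT hv, h.mono (Set.inter_subset_inter hA hR)⟩

theorem Cross.symm {A R S T : Set Site} (h : Cross A R S T) : Cross A R T S := by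
  obtain ⟨u, hu, v, hv, h⟩ := h
  exact ⟨v, hv, u, hu, h.symm⟩

theorem Cross.mono_left {A A' R S T : Set Site} (h : Cross A R S T) (hA : A ⊆ A') :
    Cross A' R S T := h.mono hA subset_rfl subset_rfl subset_rfl

theorem dep_cross (R S T : Set Site) : Dep R (fun A => Cross A R S T) := by
  intro A B h
  simp only [Cross, h]

theorem Cross.image {A R S T R' S' T' : Set Site} (h : Cross A R S T) (e : Site → Site)
    (he : ∀ a b, Adj a b → Adj (e a) (e b)) (hR : ∀ x ∈ R, e x ∈ R')
    (hS : ∀ x ∈ S, x ∈ R → e x ∈ S') (hT : ∀ x ∈ T, x ∈ R → e x ∈ T') :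
    Cross (e '' A) R' S' T' := by
  obtain ⟨u, hu, v, hv, h⟩ := h
  refine ⟨e u, hS u hu h.left_mem.2, e v, hT v hv h.right_mem.2, (h.image e he).mono ?_⟩
  rintro _ ⟨x, hx, rfl⟩
  exact ⟨⟨x, hx.1, rfl⟩, hR x hx.2⟩

/-- `p` has probability at least `c`, whatever the finite set of random sites. -/
def LB (p : Set Site → Prop) (c : ℝ) : Prop := ∀ V : Finset Site, c ≤ pr V p

theorem LB.mono {p q : Set Site → Prop} {c : ℝ} (h : LB p c) (hpq : ∀ A, p A → q A) : LB q c :=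
  fun V => (h V).trans (pr_mono hpq)

theorem LB.and {p q : Set Site → Prop} {c d : ℝ} (h : LB p c) (h' : LB q d) (hd : 0 ≤ d)
    (hp : ∀ A B : Set Site, A ⊆ B → p B → p A) (hq : ∀ A B : Set Site, A ⊆ B → q B → q A) :
    LB (fun A => p A ∧ q A) (c * d) :=
  fun V => (mul_le_mul (h V) (h' V) hd (pr_nonneg _ _)).trans (pr_mul_le_of_antitone V hp hq)

theorem LB.comp_image {p : Set Site → Prop} {c : ℝ} (h : LB p c) (e : Site ≃ Site) :
    LB (fun A => p (e '' A)) c := by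
  intro V
  rw [← pr_image]
  exact h _

theorem LB.of_large {p : Set Site → Prop} {c : ℝ} (W : Finset Site)
    (hp : ∀ A B : Set Site, A ⊆ B → p B → p A) (h : ∀ V, W ⊆ V → c ≤ pr V p) : LB p c := by
  classical
  exact fun V => (h (V ∪ W) Finset.subset_union_right).trans
    (pr_antitone_subset Finset.subset_union_left hp)

theorem LB.not_cross_image {R S T R' S' T' : Set Site} {c : ℝ}
    (h : LB (fun A => ¬ Cross A R' S' T') c) (e : Site ≃ Site)
    (he : ∀ a b, Adj a b → Adj (e a) (e b)) (hR : ∀ x ∈ R, e x ∈ R')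
    (hS : ∀ x ∈ S, x ∈ R → e x ∈ S') (hT : ∀ x ∈ T, x ∈ R → e x ∈ T') :
    LB (fun A => ¬ Cross A R S T) c :=
  (h.comp_image e).mono fun _ hA hc => hA (hc.image e he hR hS hT)

theorem not_cross_antitone (R S T : Set Site) :
    ∀ A B : Set Site, A ⊆ B → ¬ Cross B R S T → ¬ Cross A R S T :=
  fun _ _ hAB hB hA => hB (hA.mono_left hAB)

/-- Crossing of a rectangle from left to right. -/
def CrossLR (A : Set Site) (x₀ x₁ y₀ y₁ : ℤ) : Prop :=
  Cross A (rect x₀ x₁ y₀ y₁) {v | v.1 = x₀} {v | v.1 = x₁}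

/-- Crossing of a rectangle from bottom to top. -/
def CrossBT (A : Set Site) (x₀ x₁ y₀ y₁ : ℤ) : Prop :=
  Cross A (rect x₀ x₁ y₀ y₁) {v | v.2 = y₀} {v | v.2 = y₁}

theorem not_crossLR_and_crossBT {A : Set Site} {x₀ x₁ y₀ y₁ : ℤ} (h : CrossLR A x₀ x₁ y₀ y₁)
    (h' : CrossBT Aᶜ x₀ x₁ y₀ y₁) : False := by
  obtain ⟨a, ha, b, hb, hab⟩ := h
  obtain ⟨v, hv, w, hw, hvw⟩ := h'
  have a1 := hab.left_mem
  have b1 := hab.right_mem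
  have v1 := hvw.left_mem
  have w1 := hvw.right_mem
  simp only [rect, Set.mem_inter_iff, Set.mem_ofPred_eq, Set.mem_compl_iff] at ha hb hv hw a1 b1 v1 w1
  refine not_conn_of_curve
    (Y := A ∩ rect x₀ x₁ y₀ y₁ ∪ {u | u.2 = a.2 ∧ u.1 ≤ x₀ ∧ u ∉ Aᶜ ∩ rect x₀ x₁ y₀ y₁} ∪
      {u | u.2 = b.2 ∧ x₁ ≤ u.1 ∧ u ∉ Aᶜ ∩ rect x₀ x₁ y₀ y₁}) ?_
    (hab.mono (Set.subset_union_left.trans Set.subset_union_left)) hvw ?_ ?_ ?_ ?_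
  · rw [Set.disjoint_left]
    rintro u ((⟨h1, -⟩ | h) | h) hu
    · exact hu.1 h1
    · exact h.2.2 hu
    · exact h.2.2 hu
  · intro x hx
    rcases hx.eq_or_lt with rfl | hx
    · exact Or.inl (Or.inl hab.left_mem)
    · refine Or.inl (Or.inr ⟨rfl, by simp; omega, fun hu => ?_⟩)
      simp only [rect, Set.mem_inter_iff, Set.mem_ofPred_eq] at hu
      omega
  · intro x hx
    rcases hx.eq_or_lt with rfl | hx
    · exact Or.inl (Or.inl hab.right_mem)
    · refine Or.inr ⟨rfl, by simp; omega, fun hu => ?_⟩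
      simp only [rect, Set.mem_inter_iff, Set.mem_ofPred_eq] at hu
      omega
  · have key : ∀ y ∈ A ∩ rect x₀ x₁ y₀ y₁, y.1 = v.1 → v.2 < y.2 := by
      intro y hy hyv
      have h1 : y.2 ≠ v.2 := fun h2 => v1.1 ((Prod.ext hyv h2 : y = v) ▸ hy.1)
      have := hy.2
      simp only [rect, Set.mem_ofPred_eq] at this
      omega
    rintro y ((h | h) | h) hyv
    · exact key y h hyv
    · refine key y ?_ hyv
      have hy : y = a := Prod.ext (by have := h.2.1; omega) h.1
      exact hy ▸ hab.left_mem
    · refine key y ?_ hyv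
      have hy : y = b := Prod.ext (by have := h.2.1; omega) h.1
      exact hy ▸ hab.right_mem
  · have key : ∀ y ∈ A ∩ rect x₀ x₁ y₀ y₁, y.1 = w.1 → y.2 < w.2 := by
      intro y hy hyv
      have h1 : y.2 ≠ w.2 := fun h2 => w1.1 ((Prod.ext hyv h2 : y = w) ▸ hy.1)
      have := hy.2
      simp only [rect, Set.mem_ofPred_eq] at this
      omega
    rintro y ((h | h) | h) hyv
    · exact key y h hyv
    · refine key y ?_ hyv
      have hy : y = a := Prod.ext (by have := h.2.1; omega) h.1
      exact hy ▸ hab.left_mem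
    · refine key y ?_ hyv
      have hy : y = b := Prod.ext (by have := h.2.1; omega) h.1
      exact hy ▸ hab.right_mem

/-- A rectangle as a finite set. -/
noncomputable def rectF (x₀ x₁ y₀ y₁ : ℤ) : Finset Site := Finset.Icc x₀ x₁ ×ˢ Finset.Icc y₀ y₁

theorem mem_rectF {x₀ x₁ y₀ y₁ : ℤ} {v : Site} : v ∈ rectF x₀ x₁ y₀ y₁ ↔ v ∈ rect x₀ x₁ y₀ y₁ := by
  simp [rectF, rect, and_assoc]

theorem coe_rectF (x₀ x₁ y₀ y₁ : ℤ) : (rectF x₀ x₁ y₀ y₁ : Set Site) = rect x₀ x₁ y₀ y₁ := by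
  ext v; simp [mem_rectF]

/-- Transposition of the lattice. -/
def transposeE : Site ≃ Site := Equiv.prodComm ℤ ℤ

theorem adj_transpose (a b : Site) (h : Adj a b) : Adj (transposeE a) (transposeE b) := by
  rw [adj_iff] at h ⊢
  simp only [transposeE, Equiv.prodComm_apply, Prod.fst_swap, Prod.snd_swap]
  omega

/-- Translation of the lattice. -/
def shiftE (t : Site) : Site ≃ Site := Equiv.addRight t

theorem adj_shift (t : Site) (a b : Site) (h : Adj a b) : Adj (shiftE t a) (shiftE t b) := by
  rw [adj_iff] at h ⊢
  simp only [shiftE, Equiv.coe_addRight, Prod.fst_add, Prod.snd_add]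
  omega

theorem not_crossLR_square {x₀ y₀ w : ℤ} :
    LB (fun A => ¬ CrossLR A x₀ (x₀ + w) y₀ (y₀ + w)) (1 / 2) := by
  -- it suffices to treat the square whose lower left corner is the origin
  suffices h : LB (fun A => ¬ CrossLR A 0 w 0 w) (1 / 2) by
    refine LB.not_cross_image h (shiftE (-x₀, -y₀)) (adj_shift _) ?_ ?_ ?_ <;> intro u <;>
      simp only [shiftE, Equiv.coe_addRight, rect, Set.mem_ofPred_eq, Prod.fst_add, Prod.snd_add] <;>
      omega
  refine LB.of_large (rectF 0 w 0 w) (not_cross_antitone _ _ _) fun V hV => ?_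
  have dep1 : Dep (V : Set Site) (fun A => CrossBT A 0 w 0 w) :=
    (dep_cross _ _ _).mono (by rw [← coe_rectF]; exact_mod_cast hV)
  have e1 : pr V (fun A => CrossBT Aᶜ 0 w 0 w) = pr V (fun A => CrossBT A 0 w 0 w) := pr_compl dep1
  have e2 : pr V (fun A => CrossLR A 0 w 0 w) = pr V (fun A => CrossBT A 0 w 0 w) := by
    have him : transposeE '' rect 0 w 0 w = rect 0 w 0 w := by
      ext ⟨x, y⟩
      simp only [transposeE, rect, Set.mem_image, Set.mem_ofPred_eq, Equiv.prodComm_apply]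
      constructor
      · rintro ⟨u, hu, h⟩
        have h1 := congrArg Prod.fst h
        have h2 := congrArg Prod.snd h
        simp only [Prod.fst_swap, Prod.snd_swap] at h1 h2
        omega
      · intro h
        exact ⟨(y, x), by simp; omega, rfl⟩
    have hrV : rect 0 w 0 w ⊆ V := by rw [← coe_rectF]; exact_mod_cast hV
    refine pr_equiv transposeE (W := rect 0 w 0 w) hrV (him.symm ▸ hrV)
      (him.symm ▸ dep_cross _ _ _) fun A => ⟨fun h => ?_, fun h => ?_⟩
    · refine h.image transposeE adj_transpose ?_ ?_ ?_ <;> intro u <;>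
        simp only [transposeE, rect, Set.mem_ofPred_eq, Equiv.prodComm_apply, Prod.fst_swap,
          Prod.snd_swap] <;> omega
    · have h2 : Cross (transposeE '' (transposeE '' A)) (rect 0 w 0 w) {v | v.1 = 0} {v | v.1 = w} := by
        refine h.image transposeE adj_transpose ?_ ?_ ?_ <;> intro u <;>
        simp only [transposeE, rect, Set.mem_ofPred_eq, Equiv.prodComm_apply, Prod.fst_swap,
          Prod.snd_swap] <;> omega
      have h3 : transposeE '' (transposeE '' A) = A := by
        rw [← Set.image_comp]
        have : (transposeE ∘ transposeE : Site → Site) = id := by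
          funext u; simp [transposeE]
        rw [this, Set.image_id]
      rwa [h3] at h2
  have e3 : pr V (fun A => CrossBT Aᶜ 0 w 0 w) ≤ pr V (fun A => ¬ CrossLR A 0 w 0 w) :=
    pr_mono fun A h h' => not_crossLR_and_crossBT h' h
  rw [pr_not] at e3 ⊢
  linarith

theorem not_crossBT_square {x₀ y₀ w : ℤ} :
    LB (fun A => ¬ CrossBT A x₀ (x₀ + w) y₀ (y₀ + w)) (1 / 2) := by
  refine LB.not_cross_image (not_crossLR_square (x₀ := y₀) (y₀ := x₀) (w := w)) transposeE
    adj_transpose ?_ ?_ ?_ <;> intro u <;>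
    simp only [transposeE, rect, Set.mem_ofPred_eq, Equiv.prodComm_apply, Prod.fst_swap,
      Prod.snd_swap] <;> omega

/-- Exploration argument: `X i` is the event that the explored region is `i`, and `G i` is an
event of probability at least `1 / 2` depending only on the unexplored region. -/
theorem pr_le_two_mul_of_explore {ι : Type*} (V : Finset Site) (s : Finset ι)
    {X G : ι → Set Site → Prop} {p q : Set Site → Prop} {W₁ W₂ : ι → Set Site}
    (hW : ∀ i ∈ s, Disjoint (W₁ i) (W₂ i)) (hX : ∀ i ∈ s, Dep (W₁ i) (X i))
    (hG : ∀ i ∈ s, Dep (W₂ i) (G i)) (hhalf : ∀ i ∈ s, (∃ A, X i A) → 1 / 2 ≤ pr V (G i))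
    (hp : ∀ A : Set Site, A ⊆ V → p A → ∃ i ∈ s, X i A) (hq : ∀ A, ∀ i ∈ s, X i A → G i A → q A)
    (hex : ∀ A, ∀ i ∈ s, ∀ j ∈ s, X i A → G i A → X j A → G j A → i = j) :
    pr V p ≤ 2 * pr V q := by
  have h1 : pr V p ≤ pr V (fun A => ∃ i ∈ s, X i A) :=
    ex_mono fun A hA => ind_mono (hp A hA)
  have h2 := pr_exists_le V s X
  have h3 : ∑ i ∈ s, pr V (fun A => X i A ∧ G i A) ≤ pr V q :=
    sum_pr_le V s _ q (fun A i hi h => hq A i hi h.1 h.2)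
      (fun A i hi j hj h h' => hex A i hi j hj h.1 h.2 h'.1 h'.2)
  have h4 : ∑ i ∈ s, pr V (X i) ≤ 2 * ∑ i ∈ s, pr V (fun A => X i A ∧ G i A) := by
    rw [Finset.mul_sum]
    refine Finset.sum_le_sum fun i hi => ?_
    rw [pr_and_of_indep V (hW i hi) (hX i hi) (hG i hi)]
    by_cases h : ∃ A, X i A
    · nlinarith [hhalf i hi h, pr_nonneg V (X i)]
    · push Not at h
      have : pr V (X i) = 0 := by
        unfold pr
        rw [← ex_const V 0]
        exact ex_congr fun A _ => ind_of_not (h A)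
      rw [this]; simp
  linarith

/-! ### A Russo–Seymour–Welsh estimate: crossings of a chevron -/

/-- The reflection of the triangular lattice fixing the row `y = 0`. -/
def mirE : Site ≃ Site :=
  Function.Involutive.toPerm (fun v => (v.1 + v.2, -v.2)) (fun v => by simp)

@[simp] theorem mirE_fst (v : Site) : (mirE v).1 = v.1 + v.2 := rfl
@[simp] theorem mirE_snd (v : Site) : (mirE v).2 = -v.2 := rfl
@[simp] theorem mirE_mirE (v : Site) : mirE (mirE v) = v := by
  ext <;> simp

theorem adj_mir (a b : Site) (h : Adj a b) : Adj (mirE a) (mirE b) := by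
  rw [adj_iff] at h ⊢
  simp only [mirE_fst, mirE_snd]
  omega

/-- A horizontal coordinate invariant under the reflection `mirE`. -/
def lam (v : Site) : ℤ := v.1 + min v.2 0

/-- The chevron, a union of two reflected rhombi. -/
def chev (n : ℤ) : Set Site := {v | 0 ≤ lam v ∧ lam v ≤ n ∧ -(n + 1) ≤ v.2 ∧ v.2 ≤ n + 1}

/-- The part of `A` in the upper rhombus which is connected to the left side. -/
def chevCl (n : ℤ) (A : Set Site) : Set Site :=
  {y | ∃ l ∈ rect 0 n 1 (n + 1), l.1 = 0 ∧ Conn (A ∩ rect 0 n 1 (n + 1)) l y}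

/-- The sites one has to examine in order to discover the cluster `C` of the left side. -/
def chevBar (n : ℤ) (C : Set Site) : Set Site :=
  {y | y ∈ rect 0 n 1 (n + 1) ∧ (y ∈ C ∨ y.1 = 0 ∨ ∃ c ∈ C, Adj c y)}

/-- The unexplored part of the chevron. -/
def chevJ (n : ℤ) (C : Set Site) : Set Site :=
  {v | v ∈ chev n ∧ v ∉ chevBar n C ∧ mirE v ∉ chevBar n C}

theorem chevCl_subset (n : ℤ) (A : Set Site) : chevCl n A ⊆ A ∩ rect 0 n 1 (n + 1) := by
  rintro y ⟨l, _, _, h⟩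
  exact h.right_mem

theorem subset_chevBar (n : ℤ) (A : Set Site) : chevCl n A ⊆ chevBar n (chevCl n A) :=
  fun _ hy => ⟨(chevCl_subset n A hy).2, Or.inl hy⟩

theorem conn_chevCl {n : ℤ} {A : Set Site} {y : Site} (hy : y ∈ chevCl n A) :
    ∃ l ∈ rect 0 n 1 (n + 1), l.1 = 0 ∧ Conn (chevCl n A) l y := by
  obtain ⟨l, h1, h2, h3⟩ := hy
  exact ⟨l, h1, h2, h3.self_cluster.mono fun z hz => ⟨l, h1, h2, hz⟩⟩

theorem conn_chevBar {n : ℤ} {A : Set Site} {y : Site} (hy : y ∈ chevBar n (chevCl n A)) :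
    ∃ l ∈ rect 0 n 1 (n + 1), l.1 = 0 ∧ Conn (chevBar n (chevCl n A)) l y := by
  obtain ⟨h1, h | h | ⟨c, hc, h⟩⟩ := id hy
  · obtain ⟨l, h2, h3, h4⟩ := conn_chevCl h
    exact ⟨l, h2, h3, h4.mono (subset_chevBar n A)⟩
  · exact ⟨y, h1, h, .refl hy⟩
  · obtain ⟨l, h2, h3, h4⟩ := conn_chevCl hc
    exact ⟨l, h2, h3, (h4.mono (subset_chevBar n A)).tail h hy⟩

theorem dep_chevCl (n : ℤ) (C : Set Site) : Dep (chevBar n C) (fun A => chevCl n A = C) := by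
  refine Dep.of_imp fun A B hAB hA => ?_
  subst hA
  have hmem : ∀ z ∈ chevBar n (chevCl n A), (z ∈ A ↔ z ∈ B) := by
    intro z hz
    have : z ∈ A ∩ chevBar n (chevCl n A) ↔ z ∈ B ∩ chevBar n (chevCl n A) := by rw [hAB]
    simpa [hz] using this
  ext y
  constructor
  · rintro ⟨l, h1, h2, h3⟩
    have hl : l ∈ chevCl n A :=
      ⟨l, h1, h2, .refl ⟨(hmem l ⟨h1, Or.inr (Or.inl h2)⟩).2 h3.left_mem.1, h1⟩⟩
    refine h3.induction hl ?_
    rintro a b _ hab hb ⟨l', h4, h5, h6⟩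
    refine ⟨l', h4, h5, h6.tail hab ⟨(hmem b ⟨hb.2, Or.inr (Or.inr ⟨a, ⟨l', h4, h5, h6⟩, hab⟩)⟩).2
      hb.1, hb.2⟩⟩
  · intro hy
    obtain ⟨l, h1, h2, h3⟩ := conn_chevCl hy
    refine ⟨l, h1, h2, h3.mono fun z hz => ?_⟩
    exact ⟨(hmem z (subset_chevBar n A hz)).1 (chevCl_subset n A hz).1, (chevCl_subset n A hz).2⟩

/-- A crossing of the unexplored part from the reflected explored part to the upper right side. -/
def chevUp (n : ℤ) (C A : Set Site) : Prop :=
  Cross A (chevJ n C) {u | u = (0, 0) ∨ ∃ c ∈ chevBar n C, Adj (mirE c) u}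
    {w | lam w = n ∧ 0 ≤ w.2}

/-- The mirror image of `chevUp`. -/
def chevDown (n : ℤ) (C A : Set Site) : Prop :=
  Cross A (chevJ n C) {u | u = (0, 0) ∨ ∃ c ∈ chevBar n C, Adj c u} {w | lam w = n ∧ w.2 ≤ 0}

theorem not_chevUp_and_chevDown {n : ℤ} (hn : 1 ≤ n) {A₀ A : Set Site}
    (h : chevUp n (chevCl n A₀) A) (h' : chevDown n (chevCl n A₀) Aᶜ) : False := by
  obtain ⟨u, hu, w, hw, huw⟩ := h
  obtain ⟨u', hu', b, hb, hub⟩ := h'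
  set D := chevBar n (chevCl n A₀) with hD
  set J := chevJ n (chevCl n A₀) with hJ
  simp only [Set.mem_ofPred_eq] at hw hb
  have w1 := huw.right_mem
  have b1 := hub.right_mem
  have hJc : ∀ z ∈ J, 0 ≤ lam z ∧ lam z ≤ n ∧ -(n + 1) ≤ z.2 ∧ z.2 ≤ n + 1 := fun z hz => hz.1
  have hDc : ∀ z ∈ D, 0 ≤ z.1 ∧ z.1 ≤ n ∧ 1 ≤ z.2 ∧ z.2 ≤ n + 1 := fun z hz => hz.1
  have hne : ¬ (b.2 = 0 ∧ w.2 = 0) := by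
    rintro ⟨h1, h2⟩
    refine b1.1 ?_
    have : b = w := Prod.ext (by unfold lam at hw hb; omega) (by omega)
    exact this ▸ w1.1
  -- the left end of the upper curve
  obtain ⟨a, ha1, ha2, hab⟩ : ∃ a : Site, a.1 = 0 ∧ 0 ≤ a.2 ∧ Conn (Aᶜ ∩ J ∪ D) a b := by
    rcases hu' with rfl | ⟨c, hc, hcu⟩
    · exact ⟨(0, 0), rfl, le_rfl, hub.mono Set.subset_union_left⟩
    · obtain ⟨l, h1, h2, h3⟩ := conn_chevBar hc
      have h4 := h1.2.2.1
      refine ⟨l, h2, by omega, ?_⟩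
      exact ((h3.mono Set.subset_union_right).tail hcu (Or.inl hub.left_mem)).trans
        (hub.mono Set.subset_union_left)
  -- the lower left end of the other curve
  obtain ⟨v, hvw, hvJ, hvD⟩ : ∃ v : Site, Conn (A ∩ J ∪ mirE '' D) v w ∧
      (∀ z ∈ Aᶜ ∩ J, z.1 = v.1 → v.2 < z.2) ∧ v.2 ≤ 0 ∧ v.1 = -v.2 ∧ -(n + 1) ≤ v.2 := by
    rcases hu with rfl | ⟨c, hc, hcu⟩
    · refine ⟨(0, 0), huw.mono Set.subset_union_left, ?_, le_rfl, by simp, by simp; omega⟩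
      intro z hz hz1
      have h1 : z.2 ≠ 0 := fun h2 => hz.1 ((Prod.ext hz1 h2 : z = (0, 0)) ▸ huw.left_mem.1)
      have := hJc z hz.2
      unfold lam at this
      simp only at hz1 ⊢
      omega
    · obtain ⟨l, h1, h2, h3⟩ := conn_chevBar hc
      have h4 := hDc l h3.left_mem
      refine ⟨mirE l, ?_, ?_, by simp; omega, by simp; omega, by simp; omega⟩
      · exact (((h3.image mirE adj_mir).mono Set.subset_union_right).tail hcu
          (Or.inl huw.left_mem)).trans (huw.mono Set.subset_union_left)
      · intro z hz hz1
        have h5 : z.2 ≠ (mirE l).2 := fun h2 => by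
          have h6 : z = mirE l := Prod.ext hz1 h2
          refine hz.2.2.2 ?_
          rw [h6, mirE_mirE]
          exact h3.left_mem
        have := hJc z hz.2
        unfold lam at this
        simp only [mirE_fst, mirE_snd] at hz1 h5 ⊢
        omega
  refine not_conn_of_curve
    (Y := Aᶜ ∩ J ∪ D ∪ ({z | z.1 < 0 ∧ z.2 = a.2} ∪ {z | b.1 < z.1 ∧ z.2 = b.2}))
    (Z := A ∩ J ∪ mirE '' D ∪ {(n + 1, w.2)}) (v := v) (w := (n + 1, w.2)) ?_
    (hab.mono Set.subset_union_left)
    ((hvw.mono Set.subset_union_left).tail ?_ (Or.inr rfl)) ?_ ?_ ?_ ?_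
  · rw [Set.disjoint_left]
    unfold lam at hb hw hJc
    rintro z ((hz | hz) | (hz | hz)) ((hz' | ⟨c, hc, rfl⟩) | hz')
    · exact hz.1 hz'.1
    · exact hz.2.2.2 (by rwa [mirE_mirE])
    · have := hJc z hz.2
      rw [Set.mem_singleton_iff] at hz'
      subst hz'
      simp only at this
      omega
    · exact hz'.2.2.1 hz
    · have h1 := hDc _ hz
      have h2 := hDc c hc
      simp only [mirE_fst, mirE_snd] at h1
      omega
    · have := hDc z hz
      rw [Set.mem_singleton_iff] at hz'
      subst hz'
      simp only at this
      omega
    · have := hJc z hz'.2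
      simp only [Set.mem_ofPred_eq] at hz
      omega
    · have h2 := hDc c hc
      simp only [Set.mem_ofPred_eq, mirE_fst, mirE_snd] at hz
      omega
    · rw [Set.mem_singleton_iff] at hz'
      subst hz'
      simp only [Set.mem_ofPred_eq] at hz
      omega
    · have := hJc z hz'.2
      simp only [Set.mem_ofPred_eq] at hz
      omega
    · have h2 := hDc c hc
      simp only [Set.mem_ofPred_eq, mirE_fst, mirE_snd] at hz
      omega
    · rw [Set.mem_singleton_iff] at hz'
      subst hz'
      simp only [Set.mem_ofPred_eq] at hz
      omega
  · rw [adj_iff]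
    unfold lam at hw
    exact Or.inl ⟨by simp only; omega, rfl⟩
  · intro x hx
    rcases hx.eq_or_lt with rfl | hx
    · exact Or.inl hab.left_mem
    · exact Or.inr (Or.inl ⟨by simp only; omega, rfl⟩)
  · intro x hx
    rcases hx.eq_or_lt with rfl | hx
    · exact Or.inl hab.right_mem
    · exact Or.inr (Or.inr ⟨hx, rfl⟩)
  · unfold lam at hb
    rintro z ((hz | hz) | (hz | hz)) hzv
    · exact hvJ z hz hzv
    · have := hDc z hz; omega
    · have h1 := hz.1; omega
    · have h1 := hz.1; have h2 := hz.2; omega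
  · unfold lam at hb hw hJc
    rintro z ((hz | hz) | (hz | hz)) hzv <;> simp only at hzv ⊢
    · have := hJc z hz.2; omega
    · have := hDc z hz; omega
    · have h1 := hz.1; omega
    · have h1 := hz.1; have h2 := hz.2; omega

theorem lam_mir (v : Site) : lam (mirE v) = lam v := by
  unfold lam; simp only [mirE_fst, mirE_snd]; omega

theorem mir_mem_chev {n : ℤ} {v : Site} (h : v ∈ chev n) : mirE v ∈ chev n := by
  simp only [chev, Set.mem_ofPred_eq, lam_mir, mirE_snd] at h ⊢
  omega

theorem mir_mem_chevJ {n : ℤ} {C : Set Site} {v : Site} (h : v ∈ chevJ n C) : mirE v ∈ chevJ n C :=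
  ⟨mir_mem_chev h.1, h.2.2, by rw [mirE_mirE]; exact h.2.1⟩

theorem mir_image_chevJ (n : ℤ) (C : Set Site) : mirE '' chevJ n C = chevJ n C := by
  ext v
  constructor
  · rintro ⟨u, hu, rfl⟩; exact mir_mem_chevJ hu
  · intro h; exact ⟨mirE v, mir_mem_chevJ h, mirE_mirE v⟩

theorem mir_image_image (A : Set Site) : mirE '' (mirE '' A) = A := by
  rw [Set.image_image]
  simp

/-- A finite set containing the chevron. -/
noncomputable def chevF (n : ℤ) : Finset Site := rectF 0 (2 * n + 1) (-(n + 1)) (n + 1)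

theorem chev_subset (n : ℤ) : chev n ⊆ chevF n := by
  intro v hv
  simp only [chevF, coe_rectF, rect, chev, lam, Set.mem_ofPred_eq] at hv ⊢
  omega

theorem half_le_pr_not_chevUp {n : ℤ} (hn : 1 ≤ n) (A₀ : Set Site) {V : Finset Site}
    (hV : chevF n ⊆ V) : 1 / 2 ≤ pr V (fun A => ¬ chevUp n (chevCl n A₀) A) := by
  have hJV : chevJ n (chevCl n A₀) ⊆ V := fun v hv => hV (chev_subset n hv.1)
  have dep : Dep (chevJ n (chevCl n A₀)) (fun A => chevDown n (chevCl n A₀) A) := dep_cross _ _ _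
  have e1 : pr V (fun A => chevUp n (chevCl n A₀) A) =
      pr V (fun A => chevDown n (chevCl n A₀) A) := by
    refine pr_equiv mirE (W := chevJ n (chevCl n A₀)) hJV ((mir_image_chevJ _ _).symm ▸ hJV)
      ((mir_image_chevJ _ _).symm ▸ dep) fun A => ⟨fun h => ?_, fun h => ?_⟩
    · refine h.image mirE adj_mir (fun _ => mir_mem_chevJ) ?_ ?_
      · rintro u (rfl | ⟨c, hc, h⟩) -
        · left; ext <;> simp
        · right
          refine ⟨c, hc, ?_⟩
          simpa using adj_mir _ _ h
      · rintro u ⟨h1, h2⟩ -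
        exact ⟨by rw [lam_mir, h1], by simp [h2]⟩
    · rw [← mir_image_image A]
      refine h.image mirE adj_mir (fun _ => mir_mem_chevJ) ?_ ?_
      · rintro u (rfl | ⟨c, hc, h⟩) -
        · left; ext <;> simp
        · exact Or.inr ⟨c, hc, adj_mir _ _ h⟩
      · rintro u ⟨h1, h2⟩ -
        exact ⟨by rw [lam_mir, h1], by simp [h2]⟩
  have e2 : pr V (fun A => chevDown n (chevCl n A₀) Aᶜ) = pr V (fun A => chevDown n (chevCl n A₀) A) :=
    pr_compl (dep.mono hJV)
  have e3 : pr V (fun A => chevDown n (chevCl n A₀) Aᶜ) ≤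
      pr V (fun A => ¬ chevUp n (chevCl n A₀) A) :=
    pr_mono fun A h h' => not_chevUp_and_chevDown hn h' h
  rw [pr_not] at e3 ⊢
  linarith

/-- Crossing of the chevron to the upper half of its right side. -/
def chevHalf (n : ℤ) (A : Set Site) : Prop :=
  Cross A (chev n) {u | lam u = 0} {w | lam w = n ∧ 0 ≤ w.2}

theorem chevUp_of_chevHalf {n : ℤ} {A : Set Site}
    (hC : ∀ c ∈ chevCl n A, c.1 ≠ n) (h : chevHalf n A) : chevUp n (chevCl n A) A := by
  obtain ⟨s, hs, w, ⟨hw1, hw2⟩, hsw⟩ := h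
  simp only [Set.mem_ofPred_eq] at hs
  have w1 := hsw.right_mem
  have s1 := hsw.left_mem
  set D := chevBar n (chevCl n A) with hD
  have hDc : ∀ z ∈ D, 0 ≤ z.1 ∧ z.1 ≤ n ∧ 1 ≤ z.2 ∧ z.2 ≤ n + 1 := fun z hz => hz.1
  have hcl : ∀ z ∈ D, z ∈ A → z ∈ chevCl n A := by
    rintro z ⟨hz, h | h | ⟨c, ⟨l, h1, h2, h3⟩, h⟩⟩ hzA
    · exact h
    · exact ⟨z, hz, h, .refl ⟨hzA, hz⟩⟩
    · exact ⟨l, h1, h2, h3.tail h ⟨hzA, hz⟩⟩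
  have hwD : w ∉ D := fun h => hC w (hcl w h w1.1) (by unfold lam at hw1; omega)
  have hwM : mirE w ∉ D := fun h => by
    have := hDc _ h
    simp only [mirE_snd] at this
    omega
  have hJ : (A ∩ chev n) \ {z | z ∈ D ∨ mirE z ∈ D} ⊆ A ∩ chevJ n (chevCl n A) := by
    rintro z ⟨h1, h2⟩
    simp only [Set.mem_ofPred_eq, not_or] at h2
    exact ⟨h1.1, h1.2, h2⟩
  by_cases hsD : ∃ q₀, (q₀ ∈ D ∨ mirE q₀ ∈ D) ∧ Conn (A ∩ chev n) w q₀
  · obtain ⟨q₀, hq₀, hwq⟩ := hsD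
    obtain ⟨u, q, h1, h2, h3, h4⟩ := hwq.exists_first (S := {z | z ∈ D ∨ mirE z ∈ D})
      (by simp [hwD, hwM]) hq₀
    refine ⟨u, ?_, w, ⟨hw1, hw2⟩, (h1.mono hJ).symm⟩
    right
    rcases h3 with h3 | h3
    · -- `u` must lie in the row fixed by the reflection
      have hq := hcl q h3 h4.1
      have hu := hJ h1.right_mem
      have huQ : u ∉ rect 0 n 1 (n + 1) := fun huQ =>
        hu.2.2.1 ⟨huQ, Or.inr (Or.inr ⟨q, hq, h2.symm⟩)⟩
      have hu2 : mirE u = u := by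
        have h5 := hDc q h3
        have h6 := hu.2.1
        have h7 := adj_iff.1 h2
        simp only [rect, chev, lam, Set.mem_ofPred_eq] at huQ h6
        ext <;> simp <;> omega
      refine ⟨q, h3, ?_⟩
      rw [← hu2]
      exact adj_mir _ _ h2.symm
    · exact ⟨mirE q, h3, by rw [mirE_mirE]; exact h2.symm⟩
  · push Not at hsD
    have hsD' : s ∉ D ∧ mirE s ∉ D := by
      constructor <;> intro h
      · exact hsD s (Or.inl h) hsw.symm
      · exact hsD s (Or.inr h) hsw.symm
    refine ⟨s, Or.inl ?_, w, ⟨hw1, hw2⟩, ?_⟩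
    · have h1 := s1.2
      simp only [chev, lam, Set.mem_ofPred_eq] at h1 hs
      have h2 : ¬ (s.1 = 0 ∧ 1 ≤ s.2) := fun h => hsD'.1 ⟨⟨by omega, by omega, by omega, by omega⟩,
        Or.inr (Or.inl h.1)⟩
      have h3 : ¬ (s.1 + s.2 = 0 ∧ s.2 ≤ -1) := fun h => hsD'.2
        ⟨⟨by simp; omega, by simp; omega, by simp; omega, by simp; omega⟩, Or.inr (Or.inl h.1)⟩
      have : s.1 = 0 ∧ s.2 = 0 := by omega
      exact Prod.ext this.1 this.2
    · refine (hsw.symm.self_cluster.mono fun z hz => hJ ⟨hz.right_mem, ?_⟩).symm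
      exact fun hzD => hsD z hzD hz

theorem lb_not_chevHalf {n : ℤ} (hn : 1 ≤ n) : LB (fun A => ¬ chevHalf n A) (1 / 4) := by
  classical
  refine LB.of_large (chevF n) (not_cross_antitone _ _ _) fun V hV => ?_
  have h1 : pr V (fun A => ¬ CrossLR A 0 n 1 (n + 1)) ≤ 2 * pr V (fun A => ¬ chevHalf n A) := by
    refine pr_le_two_mul_of_explore V (rectF 0 n 1 (n + 1)).powerset
      (X := fun C A => chevCl n A = ↑C ∧ ∀ c ∈ C, c.1 ≠ n) (G := fun C A => ¬ chevUp n ↑C A)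
      (W₁ := fun C => chevBar n ↑C) (W₂ := fun C => chevJ n ↑C) ?_ ?_ ?_ ?_ ?_ ?_ ?_
    · exact fun C _ => Set.disjoint_left.2 fun z h h' => h'.2.1 h
    · exact fun C _ => (dep_chevCl n ↑C).and fun _ _ _ => rfl
    · exact fun C _ => (dep_cross _ _ _).not
    · rintro C - ⟨A₀, h, -⟩
      have := half_le_pr_not_chevUp hn A₀ hV
      rwa [h] at this
    · intro A _ hA
      have hsub : chevCl n A ⊆ rectF 0 n 1 (n + 1) := by
        rw [coe_rectF]
        exact fun z hz => (chevCl_subset n A hz).2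
      have hfin := (Finset.finite_toSet (rectF 0 n 1 (n + 1))).subset hsub
      refine ⟨hfin.toFinset, ?_, by simp, ?_⟩
      · rw [Finset.mem_powerset]
        intro z hz
        exact hsub (by simpa using hz)
      · rintro c hc hcn
        obtain ⟨l, h1, h2, h3⟩ : c ∈ chevCl n A := by simpa using hc
        exact hA ⟨l, h2, c, hcn, h3⟩
    · rintro A C - ⟨h1, h2⟩ h3 h4
      rw [← h1] at h3
      exact h3 (chevUp_of_chevHalf (fun c hc => h2 c (by rw [h1] at hc; simpa using hc)) h4)
    · rintro A C - C' - ⟨h1, -⟩ - ⟨h2, -⟩ -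
      exact Finset.coe_injective (h1.symm.trans h2)
  have h2 : LB (fun A => ¬ CrossLR A 0 n 1 (n + 1)) (1 / 2) := by
    have := not_crossLR_square (x₀ := 0) (y₀ := 1) (w := n)
    rwa [zero_add, add_comm] at this
  linarith [h2 V]

theorem lb_not_cross_chev {n : ℤ} (hn : 1 ≤ n) :
    LB (fun A => ¬ Cross A (chev n) {u | lam u = 0} {w | lam w = n}) (1 / 16) := by
  have h2 : LB (fun A => ¬ Cross A (chev n) {u | lam u = 0} {w | lam w = n ∧ w.2 ≤ 0}) (1 / 4) := by
    refine LB.not_cross_image (lb_not_chevHalf hn) mirE adj_mir (fun _ => mir_mem_chev) ?_ ?_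
    · intro u hu _
      exact (lam_mir u).trans hu
    · rintro u ⟨hu, hu'⟩ _
      exact ⟨(lam_mir u).trans hu, by simpa using hu'⟩
  have h3 := (lb_not_chevHalf hn).and h2 (by norm_num) (not_cross_antitone _ _ _)
    (not_cross_antitone _ _ _)
  rw [show (1 / 4 * (1 / 4) : ℝ) = 1 / 16 by norm_num] at h3
  refine h3.mono ?_
  rintro A ⟨h4, h5⟩ ⟨u, hu, w, hw, h⟩
  rcases le_total 0 w.2 with hw' | hw'
  · exact h4 ⟨u, hu, w, ⟨hw, hw'⟩, h⟩
  · exact h5 ⟨u, hu, w, ⟨hw, hw'⟩, h⟩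

/-- A path stays below the row `b`, or above the row `a`, or crosses the strip between them. -/
theorem Conn.split_rows {X : Set Site} {u v : Site} (h : Conn X u v) {a b : ℤ} (hab : a ≤ b) :
    Conn (X ∩ {w | w.2 ≤ b}) u v ∨ Conn (X ∩ {w | a ≤ w.2}) u v ∨
      ∃ p q : Site, p.2 = a ∧ q.2 = b ∧ Conn (X ∩ {w | a ≤ w.2 ∧ w.2 ≤ b}) p q := by
  by_cases h1 : ∃ q, Conn X u q ∧ b < q.2
  · by_cases h2 : ∃ p, Conn X u p ∧ p.2 < a
    · obtain ⟨q, hq, hqb⟩ := h1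
      obtain ⟨p, hp, hpa⟩ := h2
      obtain ⟨p', q', h3, h4, h5, -⟩ := (hp.symm.trans hq).exists_level (φ := fun w => w.2)
        (fun u v huv => by rw [adj_iff] at huv; omega) (a := a) (b := b)
        hpa.le hab hqb.le
      exact Or.inr (Or.inr ⟨p', q', h3, h4, h5⟩)
    · push Not at h2
      exact Or.inr (Or.inl (h.self_cluster.mono fun z hz => ⟨hz.right_mem, h2 z hz⟩))
  · push Not at h1
    exact Or.inl (h.self_cluster.mono fun z hz => ⟨hz.right_mem, h1 z hz⟩)

/-- The central symmetry of the lattice around `t / 2`. -/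
def pointE (t : Site) : Site ≃ Site :=
  Function.Involutive.toPerm (fun v => (t.1 - v.1, t.2 - v.2)) (fun v => by simp)

@[simp] theorem pointE_fst (t v : Site) : (pointE t v).1 = t.1 - v.1 := rfl
@[simp] theorem pointE_snd (t v : Site) : (pointE t v).2 = t.2 - v.2 := rfl

theorem adj_point (t : Site) (a b : Site) (h : Adj a b) : Adj (pointE t a) (pointE t b) := by
  rw [adj_iff] at h ⊢
  simp only [pointE_fst, pointE_snd]
  omega

theorem lb_not_crossLR_three {N : ℤ} (hN : 2 ≤ N) :
    LB (fun A => ¬ CrossLR A 0 (2 * N) 0 (3 * N)) (1 / 512) := by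
  obtain ⟨n, rfl⟩ : ∃ n, N = n + 1 := ⟨N - 1, by ring⟩
  have hn : 1 ≤ n := by omega
  set lt : Site → ℤ := fun v => v.1 + max (min v.2 0) (-(n + 2)) with hlt
  have c1 := lb_not_cross_chev hn
  have c2 : LB (fun A => ¬ Cross A {v | 0 ≤ lt v ∧ lt v ≤ n ∧ -(2 * n + 3) ≤ v.2 ∧ v.2 ≤ -1}
      {v | lt v = n} {v | lt v = 0}) (1 / 16) := by
    refine LB.not_cross_image c1 (pointE (2 * n + 2, -(n + 2))) (adj_point _) ?_ ?_ ?_ <;> intro v <;>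
      simp only [chev, lam, hlt, Set.mem_ofPred_eq, pointE_fst, pointE_snd] <;> omega
  have c3 : LB (fun A => ¬ Cross A {v | 0 ≤ lt v ∧ lt v ≤ n ∧ -(n + 1) ≤ v.2 ∧ v.2 ≤ -1}
      {v | v.2 = -1} {v | v.2 = -(n + 1)}) (1 / 2) := by
    refine LB.not_cross_image (not_crossBT_square (x₀ := 0) (y₀ := 1) (w := n)) mirE adj_mir
      ?_ ?_ ?_ <;> intro v <;>
      simp only [rect, hlt, Set.mem_ofPred_eq, mirE_fst, mirE_snd] <;> omega
  have c4 := (c1.and c2 (by norm_num) (not_cross_antitone _ _ _) (not_cross_antitone _ _ _)).and c3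
    (by norm_num) (fun A B h h' => ⟨not_cross_antitone _ _ _ A B h h'.1,
      not_cross_antitone _ _ _ A B h h'.2⟩) (not_cross_antitone _ _ _)
  have c5 : LB (fun A => ¬ CrossLR A 0 (2 * n + 2) (-(2 * n + 3)) (n + 1)) (1 / 512) := by
    rw [show (1 / 16 * (1 / 16) * (1 / 2) : ℝ) = 1 / 512 by norm_num] at c4
    refine c4.mono ?_
    rintro A ⟨⟨h1, h2⟩, h3⟩ ⟨u, hu, v, hv, h⟩
    have hu' := h.left_mem.2
    have hv' := h.right_mem.2
    simp only [Set.mem_ofPred_eq, rect] at hu hv hu' hv'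
    obtain ⟨u', v', h4, h5, h6, -⟩ := h.exists_level (φ := lt)
      (fun u v huv => by rw [adj_iff] at huv; simp only [hlt]; omega) (a := 0) (b := n)
      (by simp only [hlt]; omega) (by omega) (by simp only [hlt]; omega)
    rcases h6.split_rows (a := -(n + 1)) (b := -1) (by omega) with h7 | h7 | ⟨p, q, hp, hq, h7⟩
    · refine h2 (Cross.symm ⟨u', h4, v', h5, h7.mono ?_⟩)
      rintro z ⟨⟨⟨hz1, hz2⟩, hz3⟩, hz4⟩
      exact ⟨hz1, hz3.1, hz3.2, hz2.2.2.1, hz4⟩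
    · refine h1 ⟨u', ?_, v', ?_, h7.mono ?_⟩
      · have := h7.left_mem.2
        simp only [Set.mem_ofPred_eq, lam, hlt] at this h4 ⊢
        omega
      · have := h7.right_mem.2
        simp only [Set.mem_ofPred_eq, lam, hlt] at this h5 ⊢
        omega
      · rintro z ⟨⟨⟨hz1, hz2⟩, hz3⟩, hz4⟩
        refine ⟨hz1, ?_⟩
        simp only [Set.mem_ofPred_eq, lam, chev, hlt, rect] at hz2 hz3 hz4 ⊢
        omega
    · refine h3 (Cross.symm ⟨p, hp, q, hq, h7.mono ?_⟩)
      rintro z ⟨⟨⟨hz1, hz2⟩, hz3⟩, hz4⟩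
      exact ⟨hz1, hz3.1, hz3.2, hz4⟩
  refine LB.not_cross_image c5 (shiftE (0, -(2 * n + 3))) (adj_shift _) ?_ ?_ ?_ <;> intro v <;>
    simp only [rect, Set.mem_ofPred_eq, shiftE, Equiv.coe_addRight, Prod.fst_add, Prod.snd_add] <;>
    omega

theorem lb_not_crossLR_tall {N : ℤ} (hN : 2 ≤ N) (k : ℕ) :
    LB (fun A => ¬ CrossLR A 0 (2 * N) 0 ((3 + k) * N)) (1 / 512 * (1 / 1024) ^ k) := by
  induction k with
  | zero => simpa using lb_not_crossLR_three hN
  | succ k ih =>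
    set H := (3 + (k : ℤ)) * N with hH
    have hH' : 2 * N ≤ H := by
      rw [hH]; gcongr; omega
    have e1 : (3 + ((k + 1 : ℕ) : ℤ)) * N = H + N := by rw [hH]; push_cast; ring
    rw [e1]
    have c1 : LB (fun A => ¬ CrossLR A 0 (2 * N) (H - 2 * N) (H + N)) (1 / 512) := by
      refine LB.not_cross_image (lb_not_crossLR_three hN) (shiftE (0, -(H - 2 * N))) (adj_shift _)
        ?_ ?_ ?_ <;> intro v <;>
        simp only [rect, Set.mem_ofPred_eq, shiftE, Equiv.coe_addRight, Prod.fst_add,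
          Prod.snd_add] <;> omega
    have c2 : LB (fun A => ¬ CrossBT A 0 (2 * N) (H - 2 * N) H) (1 / 2) := by
      have := not_crossBT_square (x₀ := 0) (y₀ := H - 2 * N) (w := 2 * N)
      rwa [zero_add, sub_add_cancel] at this
    have c3 := (ih.and c1 (by norm_num) (not_cross_antitone _ _ _) (not_cross_antitone _ _ _)).and c2
      (by norm_num) (fun A B h h' => ⟨not_cross_antitone _ _ _ A B h h'.1,
      not_cross_antitone _ _ _ A B h h'.2⟩) (not_cross_antitone _ _ _)
    have e2 : (1 / 512 * (1 / 1024) ^ (k + 1) : ℝ) = 1 / 512 * (1 / 1024) ^ k * (1 / 512) * (1 / 2) := by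
      rw [pow_succ]; ring
    rw [e2]
    refine c3.mono ?_
    rintro A ⟨⟨h1, h2⟩, h3⟩ ⟨u, hu, v, hv, h⟩
    rcases h.split_rows (a := H - 2 * N) (b := H) (by omega) with h7 | h7 | ⟨p, q, hp, hq, h7⟩
    · refine h1 ⟨u, hu, v, hv, h7.mono ?_⟩
      rintro z ⟨⟨hz1, hz2⟩, hz4⟩
      exact ⟨hz1, hz2.1, hz2.2.1, hz2.2.2.1, hz4⟩
    · refine h2 ⟨u, hu, v, hv, h7.mono ?_⟩
      rintro z ⟨⟨hz1, hz2⟩, hz4⟩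
      exact ⟨hz1, hz2.1, hz2.2.1, hz4, hz2.2.2.2⟩
    · refine h3 ⟨p, hp, q, hq, h7.mono ?_⟩
      rintro z ⟨⟨hz1, hz2⟩, hz4⟩
      exact ⟨hz1, hz2.1, hz2.2.1, hz4⟩

/-! ### Annuli -/

/-- The distance in the supremum norm. -/
def nrm (z w : Site) : ℤ := max (max (w.1 - z.1) (z.1 - w.1)) (max (w.2 - z.2) (z.2 - w.2))

theorem nrm_adj (z : Site) (u v : Site) (h : Adj u v) : nrm z v ≤ nrm z u + 1 := by
  rw [adj_iff] at h
  unfold nrm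
  omega

theorem nrm_triangle (x y z : Site) : nrm x z ≤ nrm x y + nrm y z := by
  unfold nrm; omega

theorem nrm_comm (x y : Site) : nrm x y = nrm y x := by
  unfold nrm; omega

theorem nrm_nonneg (x y : Site) : 0 ≤ nrm x y := by
  unfold nrm; omega

/-- The annulus with centre `z` and radii `a`, `b`. -/
def ann (z : Site) (a b : ℤ) : Set Site := {v | a ≤ nrm z v ∧ nrm z v ≤ b}

/-- Crossing of an annulus. -/
def Cr (A : Set Site) (z : Site) (a b : ℤ) : Prop :=
  Cross A (ann z a b) {v | nrm z v = a} {v | nrm z v = b}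

theorem Conn.cr {A X : Set Site} {u v z : Site} {a b : ℤ} (h : Conn X u v) (hX : X ⊆ A)
    (hab : a ≤ b) (hu : nrm z u ≤ a) (hv : b ≤ nrm z v) : Cr A z a b := by
  obtain ⟨p, q, h1, h2, h3, -⟩ := h.exists_level (φ := nrm z) (nrm_adj z) hu hab hv
  exact ⟨p, h1, q, h2, h3.mono fun w hw => ⟨hX hw.1, hw.2⟩⟩

theorem Cr.mono_radii {A : Set Site} {z : Site} {a b a' b' : ℤ} (h : Cr A z a b) (h1 : a ≤ a')
    (h2 : a' ≤ b') (h3 : b' ≤ b) : Cr A z a' b' := by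
  obtain ⟨u, hu, v, hv, h⟩ := h
  simp only [Set.mem_ofPred_eq] at hu hv
  exact h.cr Set.inter_subset_left h2 (by omega) (by omega)

theorem exists_lb_not_cr_six : ∃ c : ℝ, 0 < c ∧ c ≤ 1 ∧ ∀ (z : Site) (a : ℤ), 1 ≤ a →
    LB (fun A => ¬ Cr A z a (6 * a)) c := by
  set c₀ : ℝ := 1 / 512 * (1 / 1024) ^ 3 with hc₀
  refine ⟨c₀ * c₀ * (c₀ * c₀), by positivity, by norm_num [hc₀], fun z a ha => ?_⟩
  have c1 : LB (fun A => ¬ CrossLR A 0 (2 * (2 * a)) 0 (6 * (2 * a))) c₀ := by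
    have := lb_not_crossLR_tall (N := 2 * a) (by omega) 3
    norm_num at this ⊢
    exact this
  have right : LB (fun A => ¬ Cross A {v | nrm z v ≤ 6 * a ∧ z.1 + 2 * a ≤ v.1}
      {v | v.1 = z.1 + 2 * a} {v | v.1 = z.1 + 6 * a}) c₀ := by
    refine c1.not_cross_image (shiftE (-(z.1 + 2 * a), -(z.2 - 6 * a))) (adj_shift _) ?_ ?_ ?_ <;>
      intro v <;> simp only [rect, Set.mem_ofPred_eq, shiftE, Equiv.coe_addRight, Prod.fst_add,
        Prod.snd_add, nrm] <;> omega
  have left : LB (fun A => ¬ Cross A {v | nrm z v ≤ 6 * a ∧ v.1 ≤ z.1 - 2 * a}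
      {v | v.1 = z.1 - 6 * a} {v | v.1 = z.1 - 2 * a}) c₀ := by
    refine c1.not_cross_image (shiftE (-(z.1 - 6 * a), -(z.2 - 6 * a))) (adj_shift _) ?_ ?_ ?_ <;>
      intro v <;> simp only [rect, Set.mem_ofPred_eq, shiftE, Equiv.coe_addRight, Prod.fst_add,
        Prod.snd_add, nrm] <;> omega
  have top : LB (fun A => ¬ Cross A {v | nrm z v ≤ 6 * a ∧ z.2 + 2 * a ≤ v.2}
      {v | v.2 = z.2 + 2 * a} {v | v.2 = z.2 + 6 * a}) c₀ := by
    refine c1.not_cross_image (transposeE.trans (shiftE (-(z.2 + 2 * a), -(z.1 - 6 * a))))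
      (fun u v h => adj_shift _ _ _ (adj_transpose _ _ h)) ?_ ?_ ?_ <;>
      intro v <;> simp only [rect, Set.mem_ofPred_eq, shiftE, transposeE, Equiv.trans_apply,
        Equiv.prodComm_apply, Prod.fst_swap, Prod.snd_swap, Equiv.coe_addRight, Prod.fst_add,
        Prod.snd_add, nrm] <;> omega
  have bot : LB (fun A => ¬ Cross A {v | nrm z v ≤ 6 * a ∧ v.2 ≤ z.2 - 2 * a}
      {v | v.2 = z.2 - 6 * a} {v | v.2 = z.2 - 2 * a}) c₀ := by
    refine c1.not_cross_image (transposeE.trans (shiftE (-(z.2 - 6 * a), -(z.1 - 6 * a))))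
      (fun u v h => adj_shift _ _ _ (adj_transpose _ _ h)) ?_ ?_ ?_ <;>
      intro v <;> simp only [rect, Set.mem_ofPred_eq, shiftE, transposeE, Equiv.trans_apply,
        Equiv.prodComm_apply, Prod.fst_swap, Prod.snd_swap, Equiv.coe_addRight, Prod.fst_add,
        Prod.snd_add, nrm] <;> omega
  have hc : 0 ≤ c₀ := by positivity
  refine ((right.and left hc (not_cross_antitone _ _ _) (not_cross_antitone _ _ _)).and
    (top.and bot hc (not_cross_antitone _ _ _) (not_cross_antitone _ _ _)) (by positivity)
    (fun A B h h' => ⟨not_cross_antitone _ _ _ A B h h'.1, not_cross_antitone _ _ _ A B h h'.2⟩)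
    (fun A B h h' => ⟨not_cross_antitone _ _ _ A B h h'.1,
      not_cross_antitone _ _ _ A B h h'.2⟩)).mono ?_
  rintro A ⟨⟨h1, h2⟩, h3, h4⟩ ⟨u, hu, v, hv, h⟩
  have hv' : v.1 = z.1 + 6 * a ∨ v.1 = z.1 - 6 * a ∨ v.2 = z.2 + 6 * a ∨ v.2 = z.2 - 6 * a := by
    simp only [Set.mem_ofPred_eq, nrm] at hv
    omega
  simp only [Set.mem_ofPred_eq, nrm] at hu
  have l1 : ∀ u v : Site, Adj u v → v.1 ≤ u.1 + 1 := fun u v h => by rw [adj_iff] at h; omega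
  have l2 : ∀ u v : Site, Adj u v → v.2 ≤ u.2 + 1 := fun u v h => by rw [adj_iff] at h; omega
  rcases hv' with hv' | hv' | hv' | hv'
  · obtain ⟨p, q, h5, h6, h7, -⟩ := h.exists_level (φ := fun w => w.1) l1 (a := z.1 + 2 * a)
      (b := z.1 + 6 * a) (by omega) (by omega) (by omega)
    exact h1 ⟨p, h5, q, h6, h7.mono fun w hw => ⟨hw.1.1, hw.1.2.2, hw.2.1⟩⟩
  · obtain ⟨p, q, h5, h6, h7, -⟩ := h.symm.exists_level (φ := fun w => w.1) l1 (a := z.1 - 6 * a)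
      (b := z.1 - 2 * a) (by omega) (by omega) (by omega)
    exact h2 ⟨p, h5, q, h6, h7.mono fun w hw => ⟨hw.1.1, hw.1.2.2, hw.2.2⟩⟩
  · obtain ⟨p, q, h5, h6, h7, -⟩ := h.exists_level (φ := fun w => w.2) l2 (a := z.2 + 2 * a)
      (b := z.2 + 6 * a) (by omega) (by omega) (by omega)
    exact h3 ⟨p, h5, q, h6, h7.mono fun w hw => ⟨hw.1.1, hw.1.2.2, hw.2.1⟩⟩
  · obtain ⟨p, q, h5, h6, h7, -⟩ := h.symm.exists_level (φ := fun w => w.2) l2 (a := z.2 - 6 * a)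
      (b := z.2 - 2 * a) (by omega) (by omega) (by omega)
    exact h4 ⟨p, h5, q, h6, h7.mono fun w hw => ⟨hw.1.1, hw.1.2.2, hw.2.2⟩⟩

theorem dep_cr (z : Site) (a b : ℤ) : Dep (ann z a b) (fun A => Cr A z a b) := dep_cross _ _ _

theorem pr_cr_pow_le {c : ℝ} (hc' : c ≤ 1)
    (h : ∀ (z : Site) (a : ℤ), 1 ≤ a → LB (fun A => ¬ Cr A z a (6 * a)) c) (V : Finset Site)
    (z : Site) (k : ℕ) (a : ℤ) (ha : 1 ≤ a) : pr V (fun A => Cr A z a (7 ^ k * a)) ≤ (1 - c) ^ k := by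
  induction k generalizing a with
  | zero => simpa using pr_le_one V _
  | succ k ih =>
    have h1 : (1 : ℤ) ≤ 7 ^ k := one_le_pow₀ (by norm_num)
    have h2 : 7 * a ≤ 7 ^ (k + 1) * a := by
      rw [pow_succ]; nlinarith
    have e : (7 : ℤ) ^ k * (7 * a) = 7 ^ (k + 1) * a := by rw [pow_succ]; ring
    have h3 : pr V (fun A => Cr A z a (7 ^ (k + 1) * a)) ≤
        pr V (fun A => Cr A z a (6 * a) ∧ Cr A z (7 * a) (7 ^ k * (7 * a))) := by
      rw [e]
      exact pr_mono fun A hA => ⟨hA.mono_radii le_rfl (by omega) (by omega),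
        hA.mono_radii (by omega) h2 le_rfl⟩
    rw [pr_and_of_indep V (W₁ := ann z a (6 * a)) (W₂ := ann z (7 * a) (7 ^ k * (7 * a))) ?_
      (dep_cr _ _ _) (dep_cr _ _ _)] at h3
    · have h4 := h z a ha V
      rw [pr_not] at h4
      calc _ ≤ _ := h3
        _ ≤ (1 - c) * (1 - c) ^ k := by
          gcongr
          · exact pr_nonneg _ _
          · linarith
          · exact ih (7 * a) (by omega)
        _ = _ := by rw [pow_succ]; ring
    · rw [Set.disjoint_left]
      intro w hw hw'
      have := hw.2
      have := hw'.1
      omega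

theorem exists_pr_cr_le : ∃ κ : ℕ, 5 ≤ κ ∧ ∀ (V : Finset Site) (z : Site) (a : ℤ), 1 ≤ a →
    pr V (fun A => Cr A z a ((2 ^ κ - 3) * a)) ≤ 1 / 8 := by
  obtain ⟨c, hc, hc', h⟩ := exists_lb_not_cr_six
  obtain ⟨k, hk⟩ := exists_pow_lt_of_lt_one (show (0 : ℝ) < 1 / 8 by norm_num)
    (show 1 - c < 1 by linarith)
  refine ⟨3 * k + 5, by omega, fun V z a ha => ?_⟩
  have h1 : (7 : ℤ) ^ k ≤ 2 ^ (3 * k + 5) - 3 := by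
    have h2 : (7 : ℤ) ^ k ≤ 8 ^ k := pow_le_pow_left₀ (by norm_num) (by norm_num) k
    have h3 : (2 : ℤ) ^ (3 * k + 5) = 32 * 8 ^ k := by rw [pow_add, pow_mul]; ring
    have h4 : (1 : ℤ) ≤ 8 ^ k := one_le_pow₀ (by norm_num)
    omega
  have h4 : (1 : ℤ) ≤ 7 ^ k := one_le_pow₀ (by norm_num)
  refine (pr_mono fun A hA => ?_).trans ((pr_cr_pow_le hc' h V z k a ha).trans hk.le)
  exact Cr.mono_radii hA le_rfl (by nlinarith) (by nlinarith)

/-! ### Clusters -/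

/-- `S` is a connected component of `A ∩ D`. -/
def IsCl (D A S : Set Site) : Prop :=
  S ⊆ A ∩ D ∧ (∀ a ∈ S, ∀ b ∈ S, Conn S a b) ∧ ∀ a ∈ S, ∀ b ∈ D, Adj a b → b ∈ A → b ∈ S

/-- The sites of `D` one has to examine in order to discover the component `S`. -/
def clBar (D S : Set Site) : Set Site := S ∪ {b | b ∈ D ∧ ∃ a ∈ S, Adj a b}

theorem dep_isCl (D S : Set Site) : Dep (clBar D S) (fun A => IsCl D A S) := by
  refine Dep.of_imp fun A B hAB hA => ?_
  have hmem : ∀ z ∈ clBar D S, (z ∈ A ↔ z ∈ B) := by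
    intro z hz
    have : z ∈ A ∩ clBar D S ↔ z ∈ B ∩ clBar D S := by rw [hAB]
    simpa [hz] using this
  refine ⟨fun z hz => ⟨(hmem z (Or.inl hz)).1 (hA.1 hz).1, (hA.1 hz).2⟩, hA.2.1, ?_⟩
  exact fun a ha b hb hab hbB => hA.2.2 a ha b hb hab ((hmem b (Or.inr ⟨hb, a, ha, hab⟩)).2 hbB)

theorem IsCl.mem_of_conn {D A S : Set Site} (hS : IsCl D A S) {a b : Site} (ha : a ∈ S)
    (h : Conn (A ∩ D) a b) : b ∈ S :=
  h.induction ha fun u v _ huv hv hu => hS.2.2 u hu v hv.2 huv hv.1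

theorem isCl_cluster (D A : Set Site) (x : Site) : IsCl D A {w | Conn (A ∩ D) x w} :=
  ⟨fun _ hw => hw.right_mem, fun _ ha _ hb => ha.self_cluster.symm.trans hb.self_cluster,
    fun _ ha _ hb hab hbA => ha.tail hab ⟨hbA, hb⟩⟩

theorem IsCl.inter {D A S : Set Site} (h : IsCl D A S) : IsCl D (A ∩ D) S :=
  ⟨fun _ hz => ⟨h.1 hz, (h.1 hz).2⟩, h.2.1, fun a ha b hb hab hbA => h.2.2 a ha b hb hab hbA.1⟩

theorem IsCl.of_inter {D A S : Set Site} (h : IsCl D (A ∩ D) S) : IsCl D A S :=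
  ⟨fun _ hz => (h.1 hz).1, h.2.1, fun a ha b hb hab hbA => h.2.2 a ha b hb hab ⟨hbA, hb⟩⟩

theorem IsCl.sdiff_subset {D A S T : Set Site} (hS : IsCl D A S) (hT : T ⊆ A) :
    T \ S ⊆ A \ clBar D S := by
  rintro z ⟨hz, hzS⟩
  refine ⟨hT hz, ?_⟩
  rintro (h | ⟨h, a, ha, hab⟩)
  · exact hzS h
  · exact hzS (hS.2.2 a ha z h hab (hT hz))

/-- A connected set starting away from the component `S` produces a crossing disjoint of `S`. -/
theorem IsCl.cr_or_cr {D A S T : Set Site} {z w₀ w₁ : Site} {K r R : ℤ} (hS : IsCl D A S)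
    (hT : T ⊆ A) (h : Conn T w₀ w₁) (h₀S : w₀ ∉ S) (h₀ : K * r ≤ nrm z w₀) (h₀' : nrm z w₀ ≤ R)
    (h₁ : K * R ≤ nrm z w₁) (hr : r ≤ K * r) (hR : R ≤ K * R)
    (hadj : ∀ u ∈ T, ∀ a ∈ S, Adj a u → u ∉ D → nrm z u ≤ r ∨ K * R ≤ nrm z u) :
    Cr (A \ clBar D S) z r (K * r) ∨ Cr (A \ clBar D S) z R (K * R) := by
  by_cases hTS : ∃ w, Conn T w₀ w ∧ w ∈ S
  · obtain ⟨w, hw, hwS⟩ := hTS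
    obtain ⟨u, a, h2, h3, h4, -⟩ := hw.exists_first h₀S hwS
    have hu := h2.right_mem
    rcases hadj u hu.1 a h4 h3.symm
      fun huD => hu.2 (hS.2.2 a h4 u huD h3.symm (hT hu.1)) with h5 | h5
    · exact Or.inl (h2.symm.cr (hS.sdiff_subset hT) hr h5 h₀)
    · exact Or.inr (h2.cr (hS.sdiff_subset hT) hR h₀' h5)
  · push Not at hTS
    refine Or.inr (h.self_cluster.cr (fun v hv => hS.sdiff_subset hT ⟨hv.right_mem, hTS v hv⟩)
      hR h₀' h₁)

/-! ### Arms in half-planes and wedges -/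

/-- The part of the annulus with centre `z` and radii `r`, `R` lying in the upper half-plane, and
also to the left of `z` if `q` holds. -/
def dom (q : Prop) (z : Site) (r R : ℤ) : Set Site :=
  {w | z.2 ≤ w.2 ∧ (q → w.1 ≤ z.1) ∧ r < nrm z w ∧ nrm z w ≤ R}

/-- `S` is a crossing cluster of the region `dom q z r R` not touching the bottom row. -/
def TriAt (q : Prop) (z : Site) (r R : ℤ) (A S : Set Site) : Prop :=
  IsCl (dom q z r R) A S ∧ (∃ w ∈ S, nrm z w ≤ r + 1) ∧ (∃ w ∈ S, nrm z w = R) ∧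
    ∀ w ∈ S, z.2 < w.2

/-- There is a crossing cluster of the region `dom q z r R` not touching the bottom row. -/
def Tri (q : Prop) (z : Site) (r R : ℤ) (A : Set Site) : Prop := ∃ S, TriAt q z r R A S

/-- There is a crossing cluster not touching the bottom row, around which there are no further
crossings near the radii `r` and `R₁`. -/
def GoodTri (K : ℤ) (q : Prop) (z : Site) (r R₁ R : ℤ) (A : Set Site) : Prop :=
  ∃ S, TriAt q z r R A S ∧ ¬ Cr (A \ clBar (dom q z r R) S) z r (K * r) ∧
    ¬ Cr (A \ clBar (dom q z r R) S) z R₁ (K * R₁)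

theorem GoodTri.tri {K : ℤ} {q : Prop} {z : Site} {r R₁ R : ℤ} {A : Set Site}
    (h : GoodTri K q z r R₁ R A) : Tri q z r R A := by
  obtain ⟨S, hS, -⟩ := h
  exact ⟨S, hS⟩

theorem tri_of_conn {q : Prop} {z x y : Site} {r R : ℤ} {A : Set Site}
    (h : Conn (A ∩ dom q z r R) x y) (hx : nrm z x ≤ r + 1) (hy : nrm z y = R)
    (hb : ∀ w, Conn (A ∩ dom q z r R) x w → z.2 < w.2) : Tri q z r R A :=
  ⟨_, isCl_cluster _ _ x, ⟨x, .refl h.left_mem, hx⟩, ⟨y, h, hy⟩, hb⟩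

theorem dep_tri (q : Prop) (z : Site) (r R : ℤ) : Dep (dom q z r R) (fun A => Tri q z r R A) := by
  refine Dep.of_imp fun A B hAB hA => ?_
  obtain ⟨S, h1, h2⟩ := hA
  exact ⟨S, IsCl.of_inter (hAB ▸ h1.inter), h2⟩

theorem Tri.sub {q : Prop} {z : Site} {r R r' R' : ℤ} {A : Set Site} (h : Tri q z r R A)
    (hr : r ≤ r') (hR : R' ≤ R) (hr' : r' < R') : Tri q z r' R' A := by
  obtain ⟨S, hS, ⟨w₀, hw₀, h0⟩, ⟨w₁, hw₁, h1⟩, hb⟩ := h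
  obtain ⟨x, y, hx, hy, hxy, -⟩ := (hS.2.1 w₀ hw₀ w₁ hw₁).exists_level (φ := nrm z) (nrm_adj z)
    (a := r' + 1) (b := R') (by omega) (by omega) (by omega)
  refine tri_of_conn (x := x) (y := y) (hxy.mono ?_) hx.le hy fun w hw => hb w ?_
  · rintro w ⟨hw, h2, h3⟩
    have := hS.1 hw
    exact ⟨this.1, this.2.1, this.2.2.1, by omega, h3⟩
  · refine hS.mem_of_conn hxy.left_mem.1 (hw.mono fun v hv => ⟨hv.1, hv.2.1, hv.2.2.1, ?_, ?_⟩)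
    · exact hr.trans_lt hv.2.2.2.1
    · exact hv.2.2.2.2.trans hR

theorem pr_tri_le_two_mul_good {K : ℤ} (hK : 1 ≤ K) (hcr : ∀ (V : Finset Site) (z : Site) (a : ℤ),
      1 ≤ a → pr V (fun A => Cr A z a (K * a)) ≤ 1 / 8)
    (V : Finset Site) (q : Prop) (z : Site) {r R₁ R : ℤ} (hr : 1 ≤ r) (hrR : r < R₁)
    (hR : K * R₁ ≤ R) :
    pr V (fun A => Tri q z r R A) ≤ 2 * pr V (fun A => GoodTri K q z r R₁ R A) := by
  refine pr_le_two_mul_of_explore V V.powerset (X := fun S A => TriAt q z r R A S)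
    (G := fun S A => ¬ Cr (A \ clBar (dom q z r R) S) z r (K * r) ∧
      ¬ Cr (A \ clBar (dom q z r R) S) z R₁ (K * R₁))
    (W₁ := fun S => clBar (dom q z r R) S) (W₂ := fun S => (clBar (dom q z r R) S)ᶜ)
    (fun S _ => disjoint_compl_right) (fun S _ => ?_) (fun S _ => ?_) (fun S _ _ => ?_) ?_ ?_ ?_
  · exact (dep_isCl _ _).and fun _ _ _ => rfl
  · intro A B hAB
    simp only [Set.sdiff_eq, hAB]
  · have h1 := hcr V z r hr
    have h2 := hcr V z R₁ (by omega)
    have h3 : pr V (fun A => ¬ (¬ Cr (A \ clBar (dom q z r R) S) z r (K * r) ∧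
        ¬ Cr (A \ clBar (dom q z r R) S) z R₁ (K * R₁))) ≤
        pr V (fun A => Cr A z r (K * r)) + pr V (fun A => Cr A z R₁ (K * R₁)) := by
      refine (pr_mono fun A hA => ?_).trans (pr_or_le V _ _)
      by_contra! h
      exact hA ⟨fun h' => h.1 (h'.mono_left Set.sdiff_subset),
        fun h' => h.2 (h'.mono_left Set.sdiff_subset)⟩
    rw [pr_not] at h3
    linarith
  · rintro A hA ⟨S, hS⟩
    have hSV : S ⊆ V := fun v hv => hA (hS.1.1 hv).1
    refine ⟨(V.finite_toSet.subset hSV).toFinset, ?_, by simpa using hS⟩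
    rw [Finset.mem_powerset]
    intro v hv
    exact hSV (by simpa using hv)
  · exact fun A S _ h1 h2 => ⟨S, h1, h2⟩
  · rintro A S - S' - h1 h2 h3 -
    refine Finset.coe_injective ?_
    by_cases hSS : ∃ v ∈ S, v ∈ S'
    · obtain ⟨v, hv, hv'⟩ := hSS
      ext w
      exact ⟨fun hw => h3.1.mem_of_conn hv' ((h1.1.2.1 v hv w hw).mono h1.1.1),
        fun hw => h1.1.mem_of_conn hv ((h3.1.2.1 v hv' w hw).mono h3.1.1)⟩
    · push Not at hSS
      obtain ⟨hS, ⟨w₀, hw₀, h0⟩, ⟨w₁, hw₁, h1'⟩, hb⟩ := h3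
      refine absurd ((hS.2.1 w₀ hw₀ w₁ hw₁).cr (a := R₁) (b := K * R₁) (fun v hv => ?_) (by nlinarith)
        (by omega) (by omega)) h2.2
      exact h1.1.sdiff_subset (fun u hu => (hS.1 hu).1) ⟨hv, fun hvS => hSS v hvS hv⟩

theorem not_goodTri_and_tri {K : ℤ} (hK : 1 ≤ K) {q : Prop} {z z' : Site} {r R₁ R : ℤ}
    {A : Set Site} (hr : 1 ≤ r) (h2 : z'.2 + r + 1 < z.2) (h1 : q → z'.1 ≤ z.1)
    (hd : K * r + r + 1 ≤ nrm z z') (hd' : nrm z z' + r + 1 ≤ R₁) (hR : K * R₁ + nrm z z' ≤ R)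
    (h : GoodTri K q z r R₁ R A) (h' : Tri q z' r R A) : False := by
  obtain ⟨S, ⟨hS, -, -, hb⟩, hn1, hn2⟩ := h
  obtain ⟨T, hT, ⟨w₀, hw₀, h3⟩, ⟨w₁, hw₁, h4⟩, hb'⟩ := h'
  have t0 := nrm_triangle z w₀ z'
  have t0' := nrm_triangle z z' w₀
  have t1 := nrm_triangle z' z w₁
  have c0 := nrm_comm w₀ z'
  have c1 := nrm_comm z z'
  have b0 : w₀.2 ≤ z'.2 + (r + 1) := by unfold nrm at h3; omega
  have n0 := nrm_nonneg z z'
  have hR₁ : R₁ ≤ K * R₁ := by nlinarith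
  have hadj : ∀ u ∈ T, ∀ a ∈ S, Adj a u → u ∉ dom q z r R → nrm z u ≤ r ∨ K * R₁ ≤ nrm z u := by
    intro u hu a ha hau huD
    have h6 := hb a ha
    have h7 : z.2 ≤ u.2 := by rw [adj_iff] at hau; omega
    by_contra! hcon
    exact huD ⟨h7, fun hq => ((hT.1 hu).2.2.1 hq).trans (h1 hq), hcon.1, by omega⟩
  rcases hS.cr_or_cr (z := z) (K := K) (r := r) (R := R₁) (fun u hu => (hT.1 hu).1)
    (hT.2.1 w₀ hw₀ w₁ hw₁) (fun h => by have := hb w₀ h; omega) (by omega) (by omega) (by omega)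
    (by nlinarith) hR₁ hadj with h5 | h5
  · exact hn1 h5
  · exact hn2 h5

theorem tri_shift {q : Prop} {z : Site} {r R : ℤ} {A : Set Site} (t : Site) (h : Tri q z r R A) :
    Tri q (shiftE t z) r R (shiftE t '' A) := by
  obtain ⟨S, ⟨h1, h2, h3⟩, ⟨w₀, hw₀, h4⟩, ⟨w₁, hw₁, h5⟩, hb⟩ := h
  have hn : ∀ v, nrm (shiftE t z) (shiftE t v) = nrm z v := by
    intro v
    simp only [nrm, shiftE, Equiv.coe_addRight, Prod.fst_add, Prod.snd_add, add_sub_add_right_eq_sub]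
  have hdm : ∀ v, shiftE t v ∈ dom q (shiftE t z) r R ↔ v ∈ dom q z r R := by
    intro v
    simp only [dom, Set.mem_ofPred_eq, hn]
    simp only [shiftE, Equiv.coe_addRight, Prod.fst_add, Prod.snd_add, add_le_add_iff_right]
  refine ⟨shiftE t '' S, ⟨?_, ?_, ?_⟩, ⟨_, ⟨w₀, hw₀, rfl⟩, by rwa [hn]⟩,
    ⟨_, ⟨w₁, hw₁, rfl⟩, by rwa [hn]⟩, ?_⟩
  · rintro _ ⟨v, hv, rfl⟩
    exact ⟨⟨v, (h1 hv).1, rfl⟩, (hdm v).2 (h1 hv).2⟩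
  · rintro _ ⟨v, hv, rfl⟩ _ ⟨w, hw, rfl⟩
    exact (h2 v hv w hw).image _ (adj_shift t)
  · rintro _ ⟨v, hv, rfl⟩ b hb hab ⟨w, hw, rfl⟩
    refine ⟨w, h3 v hv w ((hdm w).1 hb) ?_ hw, rfl⟩
    rw [adj_iff] at hab ⊢
    simp only [shiftE, Equiv.coe_addRight, Prod.fst_add, Prod.snd_add] at hab
    omega
  · rintro _ ⟨v, hv, rfl⟩
    have := hb v hv
    simp only [shiftE, Equiv.coe_addRight, Prod.snd_add]
    omega

/-- A ball as a finite set. -/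
noncomputable def ballF (z : Site) (R : ℤ) : Finset Site :=
  rectF (z.1 - R) (z.1 + R) (z.2 - R) (z.2 + R)

theorem mem_ballF {z v : Site} {R : ℤ} : v ∈ ballF z R ↔ nrm z v ≤ R := by
  simp only [ballF, mem_rectF, rect, nrm, Set.mem_ofPred_eq]
  omega

theorem dom_subset_ballF (q : Prop) (z : Site) (r R : ℤ) : dom q z r R ⊆ ballF z R :=
  fun _ hv => mem_ballF.2 hv.2.2.2

/-- The probability of `Tri q z r R`, which does not depend on `z`. -/
noncomputable def pTri (q : Prop) (r R : ℤ) : ℝ := pr (ballF 0 R) (fun A => Tri q 0 r R A)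

theorem pr_tri {q : Prop} {z : Site} {r R : ℤ} {V : Finset Site} (hV : dom q z r R ⊆ V) :
    pr V (fun A => Tri q z r R A) = pTri q r R := by
  have e0 : shiftE (-z) z = 0 := by simp [shiftE]
  have e1 : shiftE (-z) '' dom q z r R ⊆ dom q 0 r R := by
    rintro _ ⟨v, ⟨h1, h2, h3, h4⟩, rfl⟩
    have hn : nrm 0 (shiftE (-z) v) = nrm z v := by
      simp only [nrm, shiftE, Equiv.coe_addRight, Prod.fst_add, Prod.snd_add, Prod.fst_neg,
        Prod.snd_neg, Prod.fst_zero, Prod.snd_zero]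
      omega
    refine ⟨by simp [shiftE]; omega, fun hq => by have := h2 hq; simp [shiftE]; omega, ?_, ?_⟩ <;>
      rw [hn] <;> assumption
  have e2 : shiftE (-z) '' dom q z r R = dom q 0 r R := by
    refine e1.antisymm fun v hv => ⟨v + z, ?_, by simp [shiftE]⟩
    obtain ⟨h1, h2, h3, h4⟩ := hv
    have hn : nrm z (v + z) = nrm 0 v := by
      simp only [nrm, Prod.fst_add, Prod.snd_add, Prod.fst_zero, Prod.snd_zero]
      omega
    simp only [Prod.fst_zero, Prod.snd_zero] at h1 h2
    refine ⟨by simp; omega, fun hq => by have := h2 hq; simp; omega, ?_, ?_⟩ <;>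
      rw [hn] <;> assumption
  refine pr_equiv (shiftE (-z)) (W := dom q z r R) hV (e1.trans (dom_subset_ballF q 0 r R))
    (e2.symm ▸ dep_tri q 0 r R) fun A => ⟨fun h => ?_, fun h => ?_⟩
  · have := tri_shift (-z) h
    rwa [e0] at this
  · have := tri_shift z h
    have e3 : shiftE z '' (shiftE (-z) '' A) = A := by
      rw [← Set.image_comp]
      convert Set.image_id A
      ext <;> simp [shiftE]
    rw [e3] at this
    simpa [shiftE] using this

theorem pTri_nonneg (q : Prop) (r R : ℤ) : 0 ≤ pTri q r R := pr_nonneg _ _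

theorem pTri_le_one (q : Prop) (r R : ℤ) : pTri q r R ≤ 1 := pr_le_one _ _

theorem pTri_mono {q : Prop} {r R r' R' : ℤ} (hr : r ≤ r') (hR : R' ≤ R) (hr' : r' < R') :
    pTri q r R ≤ pTri q r' R' := by
  rw [← pr_tri (z := 0) (V := ballF 0 R) (r := r') (R := R')]
  · exact pr_mono fun A h => h.sub hr hR hr'
  · intro v hv
    exact mem_ballF.2 (hv.2.2.2.trans hR)

/-! ### The three-arm event in the half-plane -/

theorem pr_add (V : Finset Site) (p q : Set Site → Prop) :
    pr V p + pr V q = pr V (fun A => p A ∨ q A) + pr V (fun A => p A ∧ q A) := by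
  unfold pr
  rw [← ex_add, ← ex_add]
  refine ex_congr fun A _ => ?_
  by_cases hp : p A <;> by_cases hq : q A <;> simp [ind, hp, hq]

/-- A Bonferroni inequality. -/
theorem sum_pr_le_bonferroni (V : Finset Site) (G : ℕ → Set Site → Prop) (N : ℕ) :
    ∑ i ∈ Finset.range N, pr V (G i) ≤ pr V (fun A => ∃ i ∈ Finset.range N, G i A) +
      ∑ j ∈ Finset.range N, ∑ i ∈ Finset.range j, pr V (fun A => G i A ∧ G j A) := by
  induction N with
  | zero => simpa using pr_nonneg V _
  | succ N ih =>
    rw [Finset.sum_range_succ, Finset.sum_range_succ]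
    have h1 := pr_add V (fun A => ∃ i ∈ Finset.range N, G i A) (G N)
    have h2 : pr V (fun A => (∃ i ∈ Finset.range N, G i A) ∧ G N A) ≤
        ∑ i ∈ Finset.range N, pr V (fun A => G i A ∧ G N A) := by
      refine (pr_mono fun A hA => ?_).trans (pr_exists_le V (Finset.range N) _)
      obtain ⟨⟨i, hi, h⟩, h'⟩ := hA
      exact ⟨i, hi, h, h'⟩
    have h3 : pr V (fun A => (∃ i ∈ Finset.range N, G i A) ∨ G N A) ≤
        pr V (fun A => ∃ i ∈ Finset.range (N + 1), G i A) := by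
      refine pr_mono fun A hA => ?_
      rcases hA with ⟨i, hi, h⟩ | h
      · exact ⟨i, by simp at hi ⊢; omega, h⟩
      · exact ⟨N, by simp, h⟩
    linarith

theorem sum_Ico_log_two (g : ℕ → ℝ) (M : ℕ) :
    ∑ t ∈ Finset.Ico 1 (2 ^ M), g (Nat.log 2 t) = ∑ l ∈ Finset.range M, 2 ^ l * g l := by
  induction M with
  | zero => simp
  | succ M ih =>
    have h1 : 1 ≤ 2 ^ M := Nat.one_le_two_pow
    have h2 : 2 ^ M ≤ 2 ^ (M + 1) := Nat.pow_le_pow_right (by norm_num) (by omega)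
    rw [← Finset.sum_Ico_consecutive _ h1 h2, ih, Finset.sum_range_succ]
    congr 1
    rw [Finset.sum_congr rfl (g := fun _ => g M)]
    · simp only [Finset.sum_const, Nat.card_Ico, nsmul_eq_mul]
      rw [show 2 ^ (M + 1) - 2 ^ M = 2 ^ M by rw [pow_succ]; omega]
      push_cast
      ring
    · intro t ht
      rw [Finset.mem_Ico] at ht
      rw [Nat.log_eq_of_pow_le_of_lt_pow ht.1 ht.2]

/-- Bonferroni's inequality for events whose pairwise intersections are controlled by the
dyadic scale of the distance between the indices. -/
theorem bonferroni_dyadic (V : Finset Site) (G : ℕ → Set Site → Prop) (M : ℕ) {F : ℝ} {g : ℕ → ℝ}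
    (hg : ∀ l, 0 ≤ g l) (hF : ∀ i < 2 ^ M, F ≤ pr V (G i))
    (hpair : ∀ i j, i < j → j < 2 ^ M → pr V (fun A => G i A ∧ G j A) ≤ g (Nat.log 2 (j - i))) :
    2 ^ M * F ≤ pr V (fun A => ∃ i ∈ Finset.range (2 ^ M), G i A) +
      2 ^ M * ∑ l ∈ Finset.range M, 2 ^ l * g l := by
  have h1 := sum_pr_le_bonferroni V G (2 ^ M)
  have h2 : 2 ^ M * F ≤ ∑ i ∈ Finset.range (2 ^ M), pr V (G i) := by
    have := Finset.card_nsmul_le_sum (Finset.range (2 ^ M)) (fun i => pr V (G i)) F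
      fun i hi => hF i (Finset.mem_range.1 hi)
    simpa using this
  have h3 : ∀ j ∈ Finset.range (2 ^ M), ∑ i ∈ Finset.range j, pr V (fun A => G i A ∧ G j A) ≤
      ∑ l ∈ Finset.range M, 2 ^ l * g l := by
    intro j hj
    rw [Finset.mem_range] at hj
    rw [← sum_Ico_log_two]
    calc _ ≤ ∑ i ∈ Finset.range j, g (Nat.log 2 (j - i)) :=
          Finset.sum_le_sum fun i hi => hpair i j (Finset.mem_range.1 hi) hj
      _ = ∑ t ∈ (Finset.range j).image (fun i => j - i), g (Nat.log 2 t) := by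
          rw [Finset.sum_image]
          intro a ha b hb hab
          simp only [Finset.coe_range, Set.mem_Iio] at ha hb hab
          omega
      _ ≤ _ := by
          refine Finset.sum_le_sum_of_subset_of_nonneg ?_ fun _ _ _ => hg _
          intro t ht
          simp only [Finset.mem_image, Finset.mem_range, Finset.mem_Ico] at ht ⊢
          obtain ⟨i, hi, rfl⟩ := ht
          omega
  have h4 := Finset.sum_le_card_nsmul _ _ _ h3
  rw [Finset.card_range, nsmul_eq_mul] at h4
  push_cast at h4
  linarith

theorem pr_tri_pair_le {q : Prop} {V : Finset Site} {z z' : Site} {r s ρ R R' : ℤ} (hrs : r < s)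
    (hρR : ρ < R') (hR : R' ≤ R) (hd : 2 * s < nrm z z') (hd' : nrm z z' + s ≤ ρ) (hr : 0 ≤ r)
    (hV : ballF z R' ⊆ V) :
    pr V (fun A => Tri q z r R A ∧ Tri q z' r R A) ≤ pTri q r s * pTri q r s * pTri q ρ R' := by
  have hn := nrm_nonneg z z'
  have h1 : pr V (fun A => Tri q z r R A ∧ Tri q z' r R A) ≤
      pr V (fun A => (Tri q z r s A ∧ Tri q z' r s A) ∧ Tri q z ρ R' A) :=
    pr_mono fun A h => ⟨⟨h.1.sub le_rfl (by omega) hrs, h.2.sub le_rfl (by omega) hrs⟩,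
      h.1.sub (by omega) hR hρR⟩
  have hb : ∀ v, nrm z' v ≤ s → nrm z v ≤ ρ := fun v hv => by
    have := nrm_triangle z z' v
    omega
  rw [pr_and_of_indep V (W₁ := dom q z r s ∪ dom q z' r s) (W₂ := dom q z ρ R') ?_
    (((dep_tri q z r s).mono Set.subset_union_left).and
      ((dep_tri q z' r s).mono Set.subset_union_right)) (dep_tri q z ρ R'),
    pr_and_of_indep V (W₁ := dom q z r s) (W₂ := dom q z' r s) ?_ (dep_tri q z r s)
      (dep_tri q z' r s), pr_tri, pr_tri, pr_tri] at h1
  · exact h1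
  · exact fun v hv => hV (mem_ballF.2 hv.2.2.2)
  · exact fun v hv => hV (mem_ballF.2 (by have := hb v hv.2.2.2; omega))
  · exact fun v hv => hV (mem_ballF.2 (by have := hv.2.2.2; omega))
  · refine Set.disjoint_left.2 fun v hv hv' => ?_
    have h2 := hv.2.2.2
    have h3 := hv'.2.2.2
    have h4 := nrm_triangle z v z'
    have h5 := nrm_comm v z'
    omega
  · refine Set.disjoint_left.2 ?_
    rintro v (hv | hv) hv'
    · have h2 := hv.2.2.2
      have h3 := hv'.2.2.1
      omega
    · have h2 := hb v hv.2.2.2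
      have h3 := hv'.2.2.1
      omega

theorem exists_row {K : ℤ} (hK : 1 ≤ K) {r h σ R₁ R : ℤ} {L N : ℕ} (hr : 1 ≤ r)
    (hh : K * r + r + 1 ≤ h) (hσ : 0 ≤ σ) (hN : N * σ + r + 1 ≤ R₁) (hL : L * h + r + 1 ≤ R₁)
    (hR : K * R₁ + R₁ ≤ R) (hL0 : 0 < L) (V : Finset Site) : ∃ a : ℕ, a < L ∧
      pr V (fun A => ∃ i ∈ Finset.range N, GoodTri K False (i * σ, a * h) r R₁ R A) ≤ 1 / L := by
  have hKr : r ≤ K * r := by nlinarith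
  have h1 := sum_pr_le V (Finset.range L)
    (fun (a : ℕ) A => ∃ i ∈ Finset.range N, GoodTri K False ((i : ℤ) * σ, (a : ℤ) * h) r R₁ R A)
    (fun _ => True) (fun _ _ _ _ => trivial) ?_
  · by_contra! hcon
    have h2 : ∑ a ∈ Finset.range L, (1 / L : ℝ) < ∑ a ∈ Finset.range L, pr V (fun A =>
        ∃ i ∈ Finset.range N, GoodTri K False ((i : ℤ) * σ, (a : ℤ) * h) r R₁ R A) :=
      Finset.sum_lt_sum_of_nonempty ⟨0, by simpa using hL0⟩
        fun a ha => hcon a (Finset.mem_range.1 ha)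
    have h3 : ∑ a ∈ Finset.range L, (1 / L : ℝ) = 1 := by
      rw [Finset.sum_const, Finset.card_range, nsmul_eq_mul]
      field_simp
    have := pr_le_one V (fun _ => True)
    linarith
  · -- good events in different rows are incompatible
    have key : ∀ A, ∀ a b i j : ℕ, a < b → b < L → i < N → j < N →
        GoodTri K False ((j : ℤ) * σ, (b : ℤ) * h) r R₁ R A →
        Tri False ((i : ℤ) * σ, (a : ℤ) * h) r R A → False := by
      intro A a b i j hab hb hi hj hG hT
      have e1 : ((b : ℤ) - a) * h = b * h - a * h := by ring
      have e2 : h ≤ ((b : ℤ) - a) * h := by nlinarith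
      have e3 : (b : ℤ) * h ≤ L * h := by gcongr; omega
      have e4 : 0 ≤ (a : ℤ) * h := mul_nonneg (by positivity) (by omega)
      have e5 : (i : ℤ) * σ ≤ N * σ := by gcongr
      have e6 : (j : ℤ) * σ ≤ N * σ := by gcongr
      have e7 : 0 ≤ (i : ℤ) * σ := mul_nonneg (by positivity) hσ
      have e8 : 0 ≤ (j : ℤ) * σ := mul_nonneg (by positivity) hσ
      refine not_goodTri_and_tri hK hr ?_ (fun h => h.elim) ?_ ?_ ?_ hG hT <;>
        simp only [nrm] <;> omega
    intro A a ha b hb ⟨i, hi, h2⟩ ⟨j, hj, h3⟩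
    rw [Finset.mem_range] at ha hb hi hj
    rcases lt_trichotomy a b with hab | hab | hab
    · exact (key A a b i j hab hb hi hj h3 h2.tri).elim
    · exact hab
    · exact (key A b a j i hab ha hj hi h2 h3.tri).elim

theorem pr_tri_dyadic_pair_le {q : Prop} {V : Finset Site} {r b R R' : ℤ} {k i j : ℕ} (hr : 1 ≤ r)
    (hk : 1 ≤ k) (hij : i < j) (hρ : 2 ^ (Nat.log 2 (j - i) + k + 4) * r < R') (hR : R' ≤ R)
    (hV : ballF ((i : ℤ) * (2 ^ (k + 2) * r), b) R' ⊆ V) :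
    pr V (fun A => Tri q ((i : ℤ) * (2 ^ (k + 2) * r), b) r R A ∧
      Tri q ((j : ℤ) * (2 ^ (k + 2) * r), b) r R A) ≤
      pTri q r (2 ^ (Nat.log 2 (j - i) + k) * r) ^ 2 *
        pTri q (2 ^ (Nat.log 2 (j - i) + k + 4) * r) R' := by
  have hl := Nat.pow_log_le_self 2 (x := j - i) (by omega)
  have hl' := Nat.lt_pow_succ_log_self (b := 2) (by norm_num) (j - i)
  generalize Nat.log 2 (j - i) = l at *
  have c1 : (2 : ℤ) ^ l ≤ (j : ℤ) - i := by zify [hij.le] at hl; exact hl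
  have c2 : (j : ℤ) - i < 2 * 2 ^ l := by zify [hij.le] at hl'; rw [pow_succ] at hl'; linarith
  have e1 : (2 : ℤ) ^ (k + 2) * r = 4 * (2 ^ k * r) := by rw [pow_add]; ring
  have e2 : (2 : ℤ) ^ (l + k) * r = 2 ^ l * (2 ^ k * r) := by rw [pow_add]; ring
  have e3 : (2 : ℤ) ^ (l + k + 4) * r = 16 * (2 ^ (l + k) * r) := by rw [pow_add]; ring
  have hx : 1 ≤ 2 ^ k * r := by
    have : (1 : ℤ) ≤ 2 ^ k := one_le_pow₀ (by norm_num)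
    nlinarith
  have c5 : 2 * r ≤ 2 ^ (l + k) * r := by
    have : (2 : ℤ) ^ 1 ≤ 2 ^ (l + k) := pow_le_pow_right₀ (by norm_num) (by omega)
    nlinarith
  have hn : nrm ((i : ℤ) * (2 ^ (k + 2) * r), b) ((j : ℤ) * (2 ^ (k + 2) * r), b) =
      ((j : ℤ) - i) * (2 ^ (k + 2) * r) := by
    have h0 : 0 ≤ ((j : ℤ) - i) * (2 ^ (k + 2) * r) := by
      rw [e1]
      exact mul_nonneg (by omega) (by omega)
    rw [sub_mul] at h0 ⊢
    simp only [nrm]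
    omega
  have c3 : 4 * (2 ^ (l + k) * r) ≤ ((j : ℤ) - i) * (2 ^ (k + 2) * r) := by
    rw [e1, e2]; nlinarith
  have c4 : ((j : ℤ) - i) * (2 ^ (k + 2) * r) ≤ 8 * (2 ^ (l + k) * r) := by
    rw [e1, e2]; nlinarith
  rw [sq]
  exact pr_tri_pair_le (by linarith) hρ hR (by linarith) (by linarith) (by linarith) hV

theorem pTri_bonferroni {k₀ : ℕ} (hk₀ : 5 ≤ k₀)
    (hcr : ∀ (V : Finset Site) (z : Site) (a : ℤ), 1 ≤ a →
      pr V (fun A => Cr A z a ((2 ^ k₀ - 3) * a)) ≤ 1 / 8)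
    {r : ℤ} (hr : 1 ≤ r) {k M p J : ℕ} (hk : 1 ≤ k) (hJ : J = k + 3 + M) (hp : J = k₀ + 1 + p) :
    pTri False r (2 ^ (J + k₀) * r) ≤ 2 * (2 ^ (4 + k₀ + k) * (1 / 4) ^ J +
      ∑ l ∈ Finset.range M, 2 ^ l * (pTri False r (2 ^ (l + k) * r) ^ 2 *
        pTri False (2 ^ (l + k + 4) * r) (2 ^ (M - l) * (2 ^ (l + k + 4) * r)))) := by
  have e32 : (32 : ℤ) ≤ 2 ^ k₀ := by
    calc (32 : ℤ) = 2 ^ 5 := by norm_num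
      _ ≤ 2 ^ k₀ := pow_le_pow_right₀ (by norm_num) hk₀
  set K : ℤ := 2 ^ k₀ - 3 with hKdef
  have hK : 1 ≤ K := by omega
  set R₁ : ℤ := 2 ^ J * r with hR₁
  have hR₁0 : 16 * r ≤ R₁ := by
    have : (2 : ℤ) ^ 4 ≤ 2 ^ J := pow_le_pow_right₀ (by norm_num) (by omega)
    nlinarith
  have hKR : K * R₁ + R₁ ≤ 2 ^ (J + k₀) * r := by
    have : (2 : ℤ) ^ (J + k₀) * r = (K + 3) * R₁ := by rw [hKdef, hR₁, pow_add]; ring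
    nlinarith
  have hKR' : 2 ^ (J + 1) * r ≤ K * R₁ + R₁ := by
    have : (2 : ℤ) ^ (J + 1) * r = 2 * R₁ := by rw [hR₁, pow_succ]; ring
    nlinarith
  set V : Finset Site := rectF (-(2 ^ (J + k₀ + 2) * r)) (2 ^ (J + k₀ + 2) * r)
    (-(2 ^ (J + k₀ + 2) * r)) (2 ^ (J + k₀ + 2) * r) with hV
  have hNσ : ((2 ^ M : ℕ) : ℤ) * (2 ^ (k + 2) * r) + r + 1 ≤ R₁ := by
    have : R₁ = 2 * (((2 ^ M : ℕ) : ℤ) * (2 ^ (k + 2) * r)) := by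
      rw [hR₁, hJ]; push_cast; ring
    omega
  have hLh : ((2 ^ p : ℕ) : ℤ) * (2 ^ k₀ * r) + r + 1 ≤ R₁ := by
    have : R₁ = 2 * (((2 ^ p : ℕ) : ℤ) * (2 ^ k₀ * r)) := by
      rw [hR₁, hp]; push_cast; ring
    omega
  obtain ⟨a, ha, h1⟩ := exists_row hK (R₁ := R₁) (R := K * R₁ + R₁) (L := 2 ^ p) (N := 2 ^ M) hr
    (h := 2 ^ k₀ * r) (by rw [hKdef]; nlinarith) (σ := 2 ^ (k + 2) * r) (by positivity) hNσ hLh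
    le_rfl (by positivity) V
  have hah : 0 ≤ (a : ℤ) * (2 ^ k₀ * r) ∧ (a : ℤ) * (2 ^ k₀ * r) ≤ R₁ := by
    have : (a : ℤ) * (2 ^ k₀ * r) ≤ ((2 ^ p : ℕ) : ℤ) * (2 ^ k₀ * r) := by gcongr
    refine ⟨by positivity, by omega⟩
  have hiσ : ∀ i : ℕ, i < 2 ^ M → 0 ≤ (i : ℤ) * (2 ^ (k + 2) * r) ∧
      (i : ℤ) * (2 ^ (k + 2) * r) ≤ R₁ := by
    intro i hi
    have : (i : ℤ) * (2 ^ (k + 2) * r) ≤ ((2 ^ M : ℕ) : ℤ) * (2 ^ (k + 2) * r) := by gcongr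
    refine ⟨by positivity, by omega⟩
  have hball : ∀ i : ℕ, i < 2 ^ M → ballF ((i : ℤ) * (2 ^ (k + 2) * r), (a : ℤ) * (2 ^ k₀ * r))
      (K * R₁ + R₁) ⊆ V := by
    intro i hi v hv
    have h2 := hiσ i hi
    rw [mem_ballF] at hv
    have h4 : (2 : ℤ) ^ (J + k₀ + 2) * r = 4 * (2 ^ (J + k₀) * r) := by rw [pow_add]; ring
    have h5 : R₁ ≤ K * R₁ + R₁ := by nlinarith
    simp only [nrm] at hv
    rw [hV, mem_rectF, h4]
    simp only [rect, Set.mem_ofPred_eq]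
    omega
  have h2 := bonferroni_dyadic V
    (fun i A => GoodTri K False ((i : ℤ) * (2 ^ (k + 2) * r), (a : ℤ) * (2 ^ k₀ * r)) r R₁
      (K * R₁ + R₁) A) M (F := pTri False r (2 ^ (J + k₀) * r) / 2)
    (g := fun l => pTri False r (2 ^ (l + k) * r) ^ 2 *
        pTri False (2 ^ (l + k + 4) * r) (2 ^ (M - l) * (2 ^ (l + k + 4) * r)))
    (fun l => mul_nonneg (sq_nonneg _) (pTri_nonneg _ _ _)) ?_ ?_
  · have h3 : (2 : ℝ) ^ M * (2 ^ (4 + k₀ + k) * (1 / 4) ^ J) = 1 / (2 ^ p : ℕ) := by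
      have h4 : (2 : ℝ) ^ M * 2 ^ (4 + k₀ + k) * 2 ^ p = 4 ^ J := by
        rw [show (4 : ℝ) = 2 ^ 2 by norm_num, ← pow_mul, ← pow_add, ← pow_add]
        congr 1
        omega
      push_cast
      rw [one_div, inv_pow, ← mul_assoc, eq_div_iff (by positivity), mul_assoc, mul_comm _ (2 ^ p),
        ← mul_assoc, h4, mul_inv_cancel₀ (by positivity)]
    have h5 := h2.trans (add_le_add_left h1 _)
    rw [← h3, ← mul_add] at h5
    have := le_of_mul_le_mul_left h5 (by positivity)
    linarith
  · intro i hi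
    have h3 := pr_tri_le_two_mul_good hK hcr V False
      ((i : ℤ) * (2 ^ (k + 2) * r), (a : ℤ) * (2 ^ k₀ * r)) hr (R₁ := R₁) (R := K * R₁ + R₁)
      (by omega) (by omega)
    rw [pr_tri fun v hv => hball i hi (dom_subset_ballF _ _ _ _ hv)] at h3
    have h4 := pTri_mono (q := False) (le_refl r) hKR (by nlinarith)
    linarith
  · intro i j hij hj
    have hlM : Nat.log 2 (j - i) < M := by
      have hl := Nat.pow_log_le_self 2 (x := j - i) (by omega)
      rw [← Nat.pow_lt_pow_iff_right (a := 2) (by norm_num)]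
      omega
    have c6 : (2 : ℤ) ^ (M - Nat.log 2 (j - i)) * (2 ^ (Nat.log 2 (j - i) + k + 4) * r) =
        2 ^ (J + 1) * r := by
      rw [← mul_assoc, ← pow_add]
      congr 2
      omega
    have c7 : 2 ^ (Nat.log 2 (j - i) + k + 4) * r < 2 ^ (J + 1) * r := by
      have : (2 : ℤ) ^ (Nat.log 2 (j - i) + k + 4) < 2 ^ (J + 1) :=
        pow_lt_pow_right₀ (by norm_num) (by omega)
      nlinarith
    refine (pr_mono fun A h => And.intro h.1.tri h.2.tri).trans ?_
    rw [c6]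
    exact pr_tri_dyadic_pair_le hr hk hij c7 hKR' fun v hv =>
      hball i (by omega) (mem_ballF.2 ((mem_ballF.1 hv).trans hKR'))

/-- The half-plane three-arm probability decays like `l ^ J` along `J` dyadic scales. -/
def HasDecay (l : ℝ) : Prop :=
  ∃ A : ℝ, 0 < A ∧ ∀ r : ℤ, 1 ≤ r → ∀ J : ℕ, pTri False r (2 ^ J * r) ≤ A * l ^ J

theorem one_le_mul_pow {l : ℝ} (hl : 0 < l) (hl1 : l ≤ 1) {J J₀ : ℕ} (h : J ≤ J₀) {B : ℝ}
    (hB : (l ^ J₀)⁻¹ ≤ B) : 1 ≤ B * l ^ J := by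
  have h1 : l ^ J₀ ≤ l ^ J := pow_le_pow_of_le_one hl.le hl1 h
  calc (1 : ℝ) = (l ^ J₀)⁻¹ * l ^ J₀ := (inv_mul_cancel₀ (by positivity)).symm
    _ ≤ B * l ^ J := mul_le_mul hB h1 (by positivity) (le_trans (by positivity) hB)

/-- It suffices to bound the probabilities at large scales. -/
theorem HasDecay.of_large {l : ℝ} (hl : 0 < l) (hl1 : l ≤ 1) (J₀ d : ℕ) {A : ℝ}
    (h : ∀ r : ℤ, 1 ≤ r → ∀ J, J₀ ≤ J → pTri False r (2 ^ (J + d) * r) ≤ A * l ^ J) :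
    HasDecay l := by
  have hA : 0 ≤ |A| := abs_nonneg A
  refine ⟨(l ^ (J₀ + d))⁻¹ + |A| * (l ^ d)⁻¹, by positivity, fun r hr J => ?_⟩
  rcases le_or_gt (J₀ + d) J with hJ | hJ
  · obtain ⟨J', rfl⟩ := Nat.exists_eq_add_of_le' (show d ≤ J by omega)
    refine (h r hr J' (by omega)).trans ?_
    calc A * l ^ J' ≤ |A| * l ^ J' := by gcongr; exact le_abs_self A
      _ = |A| * (l ^ d)⁻¹ * l ^ (J' + d) := by rw [pow_add]; field_simp
      _ ≤ _ := by gcongr; have : 0 ≤ (l ^ (J₀ + d))⁻¹ := by positivity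
                  linarith
  · refine (pTri_le_one _ _ _).trans (one_le_mul_pow hl hl1 hJ.le ?_)
    have : 0 ≤ |A| * (l ^ d)⁻¹ := by positivity
    linarith

theorem hasDecay_half : HasDecay (1 / 2) := by
  obtain ⟨k₀, hk₀, hcr⟩ := exists_pr_cr_le
  refine HasDecay.of_large (by norm_num) (by norm_num) (k₀ + 4) k₀ (A := 2 * 2 ^ (1 + k₀))
    fun r hr J hJ => ?_
  have h := pTri_bonferroni hk₀ hcr hr (k := J - 3) (M := 0) (p := J - k₀ - 1) (J := J) (by omega)
    (by omega) (by omega)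
  rw [Finset.range_zero, Finset.sum_empty, add_zero] at h
  refine h.trans_eq ?_
  rw [show 4 + k₀ + (J - 3) = 1 + k₀ + J by omega, pow_add _ (1 + k₀) J, mul_assoc, mul_assoc,
    ← mul_pow]
  norm_num

theorem hasDecay_two_fifths : HasDecay (2 / 5) := by
  obtain ⟨k₀, hk₀, hcr⟩ := exists_pr_cr_le
  obtain ⟨A, hA, hf⟩ := hasDecay_half
  refine HasDecay.of_large (by norm_num) (by norm_num) (k₀ + 8) k₀
    (A := 2 * (2 ^ (4 + k₀) + 80 * A ^ 3)) fun r hr J hJ => ?_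
  obtain ⟨k, b, hb, rfl⟩ : ∃ k b : ℕ, b ≤ 1 ∧ J = 2 * k + b := ⟨J / 2, J % 2, by omega, by omega⟩
  refine (pTri_bonferroni hk₀ hcr hr (k := k) (M := 2 * k + b - 3 - k) (p := 2 * k + b - k₀ - 1)
    (by omega) (by omega) (by omega)).trans ?_
  set M := 2 * k + b - 3 - k with hM
  have h1 : (2 : ℝ) ^ (4 + k₀ + k) * (1 / 4) ^ (2 * k + b) ≤
      2 ^ (4 + k₀) * (2 / 5) ^ (2 * k + b) := by
    have h2 : (2 : ℝ) ^ k ≤ (8 / 5) ^ (2 * k + b) := by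
      calc (2 : ℝ) ^ k ≤ ((8 / 5) ^ 2) ^ k := by gcongr; norm_num
        _ = (8 / 5) ^ (2 * k) := by rw [← pow_mul]
        _ ≤ _ := pow_le_pow_right₀ (by norm_num) (by omega)
    calc (2 : ℝ) ^ (4 + k₀ + k) * (1 / 4) ^ (2 * k + b) =
        2 ^ (4 + k₀) * (2 ^ k * (1 / 4) ^ (2 * k + b)) := by ring
      _ ≤ 2 ^ (4 + k₀) * ((8 / 5) ^ (2 * k + b) * (1 / 4) ^ (2 * k + b)) := by gcongr
      _ = _ := by rw [← mul_pow]; norm_num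
  have h2 : ∑ l ∈ Finset.range M, 2 ^ l * (pTri False r (2 ^ (l + k) * r) ^ 2 *
      pTri False (2 ^ (l + k + 4) * r) (2 ^ (M - l) * (2 ^ (l + k + 4) * r))) ≤
      ∑ l ∈ Finset.range M, A ^ 3 * (1 / 2) ^ (2 * k + M) := by
    refine Finset.sum_le_sum fun l hl => ?_
    rw [Finset.mem_range] at hl
    have h3 := hf r hr (l + k)
    have h4 := hf (2 ^ (l + k + 4) * r) (by
      have : (1 : ℤ) ≤ 2 ^ (l + k + 4) := one_le_pow₀ (by norm_num)
      nlinarith) (M - l)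
    have h5 := pTri_nonneg False r (2 ^ (l + k) * r)
    have h6 := pTri_nonneg False (2 ^ (l + k + 4) * r) (2 ^ (M - l) * (2 ^ (l + k + 4) * r))
    calc _ ≤ 2 ^ l * ((A * (1 / 2) ^ (l + k)) ^ 2 * (A * (1 / 2) ^ (M - l))) := by gcongr
      _ = A ^ 3 * (2 ^ l * (1 / 2) ^ l) * (1 / 2) ^ (2 * k + (l + (M - l))) := by ring
      _ = _ := by
        rw [← mul_pow, show l + (M - l) = M by omega]
        norm_num
  have h3 : (M : ℝ) * (1 / 2) ^ (2 * k + M) ≤ 80 * (2 / 5) ^ (2 * k + b) := by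
    have h4 : (1 / 2 : ℝ) ^ (2 * k + M) = 8 * ((1 / 2) ^ k * (1 / 2) ^ (2 * k + b)) := by
      have : (1 / 2 : ℝ) ^ (2 * k + M + 3) = (1 / 2) ^ k * (1 / 2) ^ (2 * k + b) := by
        rw [← pow_add]
        congr 1
        omega
      rw [← this, pow_add _ _ 3]
      norm_num
      ring
    have h5 : (M : ℝ) ≤ k := by norm_cast; omega
    have h6 : (k : ℝ) ≤ 8 * (32 / 25) ^ k := by
      have h7 := one_add_mul_le_pow (show (-2 : ℝ) ≤ 7 / 25 by norm_num) k
      have h8 : (0 : ℝ) ≤ k := by positivity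
      norm_num at h7
      linarith
    have h7 : (32 / 25 : ℝ) ^ k * (1 / 2) ^ k ≤ 5 / 4 * (4 / 5) ^ (2 * k + b) := by
      rw [← mul_pow, pow_add, pow_mul]
      have h8 : (4 / 5 : ℝ) ^ 1 ≤ (4 / 5) ^ b :=
        pow_le_pow_of_le_one (by norm_num) (by norm_num) hb
      have h9 : (0 : ℝ) ≤ (16 / 25) ^ k := by positivity
      norm_num at h8 ⊢
      nlinarith
    calc (M : ℝ) * (1 / 2) ^ (2 * k + M) ≤
        8 * (32 / 25) ^ k * (8 * ((1 / 2) ^ k * (1 / 2) ^ (2 * k + b))) := by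
          rw [h4]
          have := h5.trans h6
          gcongr
      _ = 64 * ((32 / 25 : ℝ) ^ k * (1 / 2) ^ k) * (1 / 2) ^ (2 * k + b) := by ring
      _ ≤ 64 * (5 / 4 * (4 / 5) ^ (2 * k + b)) * (1 / 2) ^ (2 * k + b) := by gcongr
      _ = 80 * ((4 / 5) ^ (2 * k + b) * (1 / 2) ^ (2 * k + b)) := by ring
      _ = _ := by rw [← mul_pow]; norm_num
  rw [Finset.sum_const, Finset.card_range, nsmul_eq_mul] at h2
  have h4 : (M : ℝ) * (A ^ 3 * (1 / 2) ^ (2 * k + M)) ≤ A ^ 3 * (80 * (2 / 5) ^ (2 * k + b)) := by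
    rw [mul_left_comm]
    gcongr
  linarith

theorem HasDecay.improve {l m : ℝ} (h : HasDecay l) (hl : 0 < l) (hlm : 2 * l ^ 2 < m)
    (hm : 1 / 4 ≤ m) (hm1 : m ≤ 1) : HasDecay m := by
  obtain ⟨k₀, hk₀, hcr⟩ := exists_pr_cr_le
  obtain ⟨A, hA, hf⟩ := h
  have hm0 : 0 < m := by linarith
  set q := 2 * l ^ 2 / m with hq
  have hq1 : q < 1 := by rw [hq, div_lt_one hm0]; exact hlm
  have hq0 : 0 ≤ q := by positivity
  have hx1 : l ^ 2 / m < 1 := by rw [div_lt_one hm0]; nlinarith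
  obtain ⟨k', hk'⟩ := exists_pow_lt_of_lt_one
    (show 0 < (1 - q) * m ^ (k₀ + 3) / (4 * A ^ 2) by
      have : 0 < 1 - q := by linarith
      positivity) hx1
  set k := k' + 1
  have hk : (l ^ 2 / m) ^ k ≤ (1 - q) * m ^ (k₀ + 3) / (4 * A ^ 2) :=
    (pow_le_pow_of_le_one (by positivity) hx1.le (by omega)).trans hk'.le
  set B := (m ^ (2 * k₀ + k + 4))⁻¹ + 4 * 2 ^ (4 + k₀ + k) * (m ^ k₀)⁻¹ with hB
  have hB0 : 0 < B := by positivity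
  refine ⟨B, hB0, fun r hr J => ?_⟩
  induction J using Nat.strong_induction_on generalizing r with
  | _ J ih =>
  rcases le_or_gt J (2 * k₀ + k + 4) with hJ | hJ
  · refine (pTri_le_one _ _ _).trans (one_le_mul_pow hm0 hm1 hJ ?_)
    have : 0 ≤ 4 * 2 ^ (4 + k₀ + k) * (m ^ k₀)⁻¹ := by positivity
    linarith
  obtain ⟨J', rfl⟩ := Nat.exists_eq_add_of_le' (show k₀ ≤ J by omega)
  obtain ⟨M, rfl⟩ := Nat.exists_eq_add_of_le (show k + 3 ≤ J' by omega)
  refine (pTri_bonferroni hk₀ hcr hr (k := k) (M := M) (p := k + 3 + M - k₀ - 1) (by omega) rfl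
    (by omega)).trans ?_
  have h1 : ∑ i ∈ Finset.range M, 2 ^ i * (pTri False r (2 ^ (i + k) * r) ^ 2 *
        pTri False (2 ^ (i + k + 4) * r) (2 ^ (M - i) * (2 ^ (i + k + 4) * r))) ≤
      ∑ i ∈ Finset.range M, (A ^ 2 * B * (l ^ 2) ^ k * m ^ M) * q ^ i := by
    refine Finset.sum_le_sum fun i hi => ?_
    rw [Finset.mem_range] at hi
    have h2 := hf r hr (i + k)
    have h3 := ih (M - i) (by omega) (2 ^ (i + k + 4) * r) (by
      have : (1 : ℤ) ≤ 2 ^ (i + k + 4) := one_le_pow₀ (by norm_num)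
      nlinarith)
    have h4 := pTri_nonneg False r (2 ^ (i + k) * r)
    have h5 := pTri_nonneg False (2 ^ (i + k + 4) * r) (2 ^ (M - i) * (2 ^ (i + k + 4) * r))
    calc _ ≤ 2 ^ i * ((A * l ^ (i + k)) ^ 2 * (B * m ^ (M - i))) := by gcongr
      _ = _ := by
        rw [hq, div_pow, mul_pow, show m ^ M = m ^ (M - i) * m ^ i by
          rw [← pow_add]; congr 1; omega]
        field_simp
        ring
  have h2 : ∑ i ∈ Finset.range M, q ^ i ≤ (1 - q)⁻¹ := by
    rw [← tsum_geometric_of_lt_one hq0 hq1]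
    exact (summable_geometric_of_lt_one hq0 hq1).sum_le_tsum _ fun _ _ => by positivity
  rw [← Finset.mul_sum] at h1
  have h3 : A ^ 2 * B * (l ^ 2) ^ k * m ^ M * (1 - q)⁻¹ ≤ B / 4 * m ^ (k + 3 + M + k₀) := by
    rw [div_pow, div_le_iff₀ (by positivity)] at hk
    have h4 : 0 < 1 - q := by linarith
    calc A ^ 2 * B * (l ^ 2) ^ k * m ^ M * (1 - q)⁻¹ ≤
        A ^ 2 * B * ((1 - q) * m ^ (k₀ + 3) / (4 * A ^ 2) * m ^ k) * m ^ M * (1 - q)⁻¹ := by gcongr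
      _ = B / 4 * m ^ (k + 3 + M + k₀) := by
        simp only [pow_add]
        field_simp
  have h5 : 2 ^ (4 + k₀ + k) * (1 / 4) ^ (k + 3 + M) ≤ B / 4 * m ^ (k + 3 + M + k₀) := by
    calc (2 : ℝ) ^ (4 + k₀ + k) * (1 / 4) ^ (k + 3 + M) ≤ 2 ^ (4 + k₀ + k) * m ^ (k + 3 + M) := by
          gcongr
      _ = (4 * 2 ^ (4 + k₀ + k) * (m ^ k₀)⁻¹) / 4 * m ^ (k + 3 + M + k₀) := by
        rw [pow_add m (k + 3 + M)]
        field_simp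
      _ ≤ _ := by
        gcongr
        rw [hB]
        have : 0 ≤ (m ^ (2 * k₀ + k + 4))⁻¹ := by positivity
        linarith
  have h6 : A ^ 2 * B * (l ^ 2) ^ k * m ^ M * ∑ i ∈ Finset.range M, q ^ i ≤
      A ^ 2 * B * (l ^ 2) ^ k * m ^ M * (1 - q)⁻¹ := by gcongr
  linarith

theorem hasDecay_quarter : HasDecay (1 / 4) :=
  (hasDecay_two_fifths.improve (m := 7 / 20) (by norm_num) (by norm_num) (by norm_num)
    (by norm_num)).improve (by norm_num) (by norm_num) (by norm_num) (by norm_num)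

/-! ### The two-arm event in the wedge -/

theorem Conn.vertical {X : Set Site} {x y : ℤ} (n : ℕ)
    (h : ∀ t, y ≤ t → t ≤ y + n → (x, t) ∈ X) : Conn X (x, y) (x, y + n) := by
  induction n with
  | zero => simpa using Conn.refl (h y le_rfl (by simp))
  | succ n ih =>
    refine (ih fun t h1 h2 => h t h1 (by push_cast; omega)).tail ?_ (h _ (by omega) (by simp))
    rw [adj_iff]
    push_cast
    omega

/-- Moving the corner of the wedge to the lower right and the radii inwards preserves the existence
of a crossing cluster separated from the bottom row. -/
theorem Tri.move {c c' : Site} {s ρ ρ' R R' : ℤ} {A : Set Site} (h1 : c'.1 ≤ c.1)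
    (h2 : c.2 ≤ c'.2) (hn : nrm c c' ≤ s) (hs : 1 ≤ s) (hρ' : 0 ≤ ρ') (hρ : ρ' + s + 1 ≤ ρ)
    (hR : R + s ≤ R') (hρR : ρ < R) (h : Tri True c' ρ' R' A) : Tri True c ρ R A := by
  obtain ⟨S, hS, ⟨w₀, hw₀, h3⟩, ⟨w₁, hw₁, h4⟩, hb⟩ := h
  have htri := fun v => nrm_triangle c c' v
  have htri' := fun v => nrm_triangle c' c v
  have hcomm := nrm_comm c c'
  have hconn := hS.2.1 w₀ hw₀ w₁ hw₁
  have hw₀' := htri w₀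
  obtain ⟨x, y, hx, hy, hxy, -⟩ := hconn.exists_level (φ := nrm c) (nrm_adj c) (a := ρ + 1)
    (b := R) (by omega) (by omega) (by have := htri' w₁; omega)
  have hSD : ∀ v ∈ S, c'.2 < v.2 ∧ v.1 ≤ c'.1 := fun v hv => ⟨hb v hv, (hS.1 hv).2.2.1 trivial⟩
  refine tri_of_conn (x := x) (y := y) (hxy.mono ?_) hx.le hy fun w hw => ?_
  · rintro v ⟨hv, h5, h6⟩
    have := hSD v hv
    exact ⟨(hS.1 hv).1, by omega, fun _ => by omega, by omega, by omega⟩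
  by_contra! hwb
  have hwS : w ∉ S := fun hwS => by have := hSD w hwS; omega
  obtain ⟨u, a, hwu, hua, haS, -⟩ := hw.symm.exists_first hwS hxy.left_mem.1
  have hu := hwu.right_mem
  have hwD := hwu.left_mem.1.2
  have hu1 : u.1 = c'.1 + 1 := by
    by_contra hne
    have h5 := hSD a haS
    refine hu.2 (hS.2.2 a haS u ⟨?_, fun _ => ?_, ?_, ?_⟩ hua.symm hu.1.1)
    · rw [adj_iff] at hua; omega
    · rw [adj_iff] at hua; omega
    · have := hu.1.2.2.2.1
      have := htri u
      omega
    · have := hu.1.2.2.2.2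
      have := htri' u
      omega
  have hwn := hwD.2.2.1
  have hun := hu.1.2.2.2.1
  have hu2 := hu.1.2.1
  have hu3 := hu.1.2.2.1 trivial
  have hwn1 := hwD.2.1 trivial
  have hwn2 := hwD.1
  have hw₁' := hSD w₁ hw₁
  have hw₀'' := hSD w₀ hw₀
  have hS₁ := h4
  have hw₀n : nrm c w₀ ≤ ρ := by omega
  simp only [nrm] at hwn hun hn hS₁ hw₀n
  set Y : Set Site := S ∪ ({v | nrm c v ≤ ρ} ∪ {v | v.2 = c.2 - 1 ∧ c.1 - ρ ≤ v.1}) ∪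
    {v | R < nrm c v ∧ v.1 ≤ c'.1 ∧ c.2 < v.2} with hY
  refine not_conn_of_curve (Y := Y) (a := w₁) (b := (w₀.1, c.2 - 1)) (v := w) (w := u) ?_ ?_ hwu
    ?_ ?_ ?_ ?_
  · refine Set.disjoint_right.2 ?_
    rintro v ⟨⟨-, hv1, -, hv2, hv3⟩, hvS⟩ ((hv | hv | hv) | hv)
    · exact hvS hv
    · simp only [Set.mem_ofPred_eq] at hv; omega
    · have := hv.1; omega
    · have := hv.1; omega
  · refine (hconn.symm.mono fun v hv => Or.inl (Or.inl hv)).trans (Conn.symm ?_)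
    have h5 := Conn.vertical (X := Y) (x := w₀.1) (y := c.2 - 1) (w₀.2 - (c.2 - 1)).toNat
      fun t ht ht' => Or.inl (Or.inr (Or.inl ?_))
    · rwa [Int.toNat_of_nonneg (by omega), add_sub_cancel] at h5
    · rw [Int.toNat_of_nonneg (by omega)] at ht'
      simp only [Set.mem_ofPred_eq, nrm]
      omega
  · intro x hx
    refine Or.inr ⟨?_, ?_, ?_⟩ <;> simp only [nrm] <;> omega
  · exact fun x hx => Or.inl (Or.inr (Or.inr ⟨rfl, by simp only at hx ⊢; omega⟩))
  · rintro v ((hv | hv | hv) | hv) hvw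
    · have := hSD v hv; omega
    · simp only [Set.mem_ofPred_eq, nrm] at hv; omega
    · have := hv.2; omega
    · have := hv.2.2; omega
  · rintro v ((hv | hv | hv) | hv) hvw
    · have := hSD v hv; omega
    · simp only [Set.mem_ofPred_eq, nrm] at hv; omega
    · have := hv.1; omega
    · have := hv.2.1; omega

/-- If events with indices at distance at least `d` exclude each other, then the sum of their
probabilities is at most `d` times the probability of their union. -/
theorem sum_pr_le_of_separated (V : Finset Site) (G : ℕ → Set Site → Prop) {n d : ℕ} (hd : 0 < d)
    (q : Set Site → Prop) (h : ∀ A, ∀ i < n, G i A → q A)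
    (hex : ∀ A i j, i + d ≤ j → j < n → G i A → G j A → False) :
    ∑ i ∈ Finset.range n, pr V (G i) ≤ d * pr V q := by
  rw [← Finset.sum_fiberwise_of_maps_to (s := Finset.range n) (t := Finset.range d)
    (g := fun i => i % d) fun i _ => Finset.mem_range.2 (Nat.mod_lt i hd)]
  have key : ∀ t ∈ Finset.range d,
      ∑ i ∈ (Finset.range n).filter (fun i => i % d = t), pr V (G i) ≤ pr V q := by
    intro t _
    refine sum_pr_le V _ _ q (fun A i hi hG => h A i ?_ hG) fun A i hi j hj hi' hj' => ?_
    · simpa using (Finset.mem_filter.1 hi).1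
    · simp only [Finset.mem_filter, Finset.mem_range] at hi hj
      have hsep : ∀ a b : ℕ, a < b → a % d = b % d → a + d ≤ b := by
        intro a b hab hmod
        have := (Nat.modEq_iff_dvd' hab.le).1 hmod
        have := Nat.le_of_dvd (by omega) this
        omega
      rcases lt_trichotomy i j with hij | hij | hij
      · exact (hex A i j (hsep i j hij (by omega)) hj.1 hi' hj').elim
      · exact hij
      · exact (hex A j i (hsep j i hij (by omega)) hi.1 hj' hi').elim
  simpa using Finset.sum_le_card_nsmul _ _ _ key

theorem pow_card_le_pr_forall (V : Finset Site) (B : ℕ → Set Site → Prop)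
    (hB : ∀ i, ∀ A A' : Set Site, A ⊆ A' → B i A' → B i A) {c : ℝ} (hc : 0 ≤ c)
    (h : ∀ i, c ≤ pr V (B i)) (I : Finset ℕ) : c ^ I.card ≤ pr V (fun A => ∀ i ∈ I, B i A) := by
  induction I using Finset.induction_on with
  | empty => simp [pr, ind, ex_const]
  | insert a I ha ih =>
    rw [Finset.card_insert_of_notMem ha, pow_succ']
    have h1 := pr_mul_le_of_antitone V (hB a)
      (q := fun A => ∀ i ∈ I, B i A) fun A A' hA h i hi => hB i A A' hA (h i hi)
    refine (mul_le_mul (h a) ih (by positivity) (pr_nonneg _ _)).trans (h1.trans ?_)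
    exact pr_mono fun A hA => by simpa using hA

/-- If every occurring event `T i` survives only when the independent decreasing event `B i` fails,
and few of the `T i` occur on average given that one does, then some survive with a probability
smaller by a constant factor. -/
theorem pr_le_of_thinning (V : Finset Site) (T B : ℕ → Set Site → Prop) (n m : ℕ) (hm : 0 < m)
    {W₁ W₂ : Set Site} (hW : Disjoint W₁ W₂) (hT : ∀ i < n, Dep W₁ (T i))
    (hBd : ∀ i < n, Dep W₂ (B i)) (hB : ∀ i, ∀ A A' : Set Site, A ⊆ A' → B i A' → B i A)
    (hp : ∀ i, 7 / 8 ≤ pr V (B i))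
    (hsum : ∑ i ∈ Finset.range n, pr V (T i) ≤ m * pr V (fun A => ∃ i ∈ Finset.range n, T i A))
    {F : Set Site → Prop} (hF : ∀ A, F A → ∃ i ∈ Finset.range n, T i A ∧ ¬ B i A) :
    pr V F ≤ (1 - (7 / 8) ^ (2 * m) / 2) * pr V (fun A => ∃ i ∈ Finset.range n, T i A) := by
  classical
  set e := pr V (fun A => ∃ i ∈ Finset.range n, T i A)
  set S : Set Site → Finset ℕ := fun A => (Finset.range n).filter fun i => T i A with hS
  have h1 : pr V (fun A => 2 * m < (S A).card) ≤ e / 2 := by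
    have h2 : 2 * m * pr V (fun A => 2 * m < (S A).card) ≤ ∑ i ∈ Finset.range n, pr V (T i) := by
      simp only [pr]
      rw [← ex_sum, ← ex_const_mul]
      refine ex_mono fun A _ => ?_
      have h3 : ∑ i ∈ Finset.range n, ind (T i A) = ((S A).card : ℝ) := by
        simp only [hS, ind, Finset.sum_ite, Finset.card_filter]
        simp
      rw [h3]
      by_cases h4 : 2 * m < (S A).card
      · rw [ind_of h4, mul_one]
        exact_mod_cast h4.le
      · rw [ind_of_not h4, mul_zero]
        positivity
    have h5 : (0 : ℝ) < m := by exact_mod_cast hm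
    have h6 := h2.trans hsum
    nlinarith
  set 𝓘 := (Finset.range n).powerset.filter fun I => I.Nonempty ∧ I.card ≤ 2 * m
  have hdep : ∀ I, Dep W₁ (fun A => S A = I) := by
    intro I
    refine Dep.of_imp fun A A' hA h => ?_
    rw [← h, hS]
    refine Finset.filter_congr fun i hi => ?_
    rw [hT i (Finset.mem_range.1 hi) A A' hA]
  have h2 : e - e / 2 ≤ ∑ I ∈ 𝓘, pr V (fun A => S A = I) := by
    have h3 : e ≤ pr V (fun A => ∃ I ∈ 𝓘, S A = I) + pr V (fun A => 2 * m < (S A).card) := by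
      refine (pr_mono fun A hA => ?_).trans (pr_or_le V _ _)
      obtain ⟨i, hi, hiT⟩ := hA
      by_cases h4 : 2 * m < (S A).card
      · exact Or.inr h4
      · refine Or.inl ⟨S A, ?_, rfl⟩
        simp only [𝓘, Finset.mem_filter, Finset.mem_powerset]
        exact ⟨Finset.filter_subset _ _, ⟨i, Finset.mem_filter.2 ⟨hi, hiT⟩⟩, by omega⟩
    have h4 := pr_exists_le V 𝓘 fun I A => S A = I
    linarith
  have h3 : (7 / 8) ^ (2 * m) * ∑ I ∈ 𝓘, pr V (fun A => S A = I) ≤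
      ∑ I ∈ 𝓘, pr V (fun A => S A = I ∧ ∀ i ∈ I, B i A) := by
    rw [Finset.mul_sum]
    refine Finset.sum_le_sum fun I hI => ?_
    simp only [𝓘, Finset.mem_filter, Finset.mem_powerset] at hI
    rw [pr_and_of_indep V hW (hdep I) (Dep.of_imp fun A A' hA h i hi => by
      rw [← hBd i (Finset.mem_range.1 (hI.1 hi)) A A' hA]; exact h i hi), mul_comm]
    have h4 := pow_card_le_pr_forall V B hB (by norm_num) hp I
    have h5 : (7 / 8 : ℝ) ^ (2 * m) ≤ (7 / 8) ^ I.card :=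
      pow_le_pow_of_le_one (by norm_num) (by norm_num) hI.2.2
    exact mul_le_mul_of_nonneg_left (h5.trans h4) (pr_nonneg _ _)
  have h4 : ∑ I ∈ 𝓘, pr V (fun A => S A = I ∧ ∀ i ∈ I, B i A) ≤
      pr V (fun A => (∃ i ∈ Finset.range n, T i A) ∧ ¬ F A) := by
    refine sum_pr_le V 𝓘 _ _ ?_ fun A I _ J _ hI hJ => hI.1.symm.trans hJ.1
    rintro A I hI ⟨rfl, h5⟩
    simp only [𝓘, Finset.mem_filter, Finset.mem_powerset] at hI
    obtain ⟨i, hi⟩ := hI.2.1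
    refine ⟨⟨i, (Finset.mem_filter.1 hi).1, (Finset.mem_filter.1 hi).2⟩, fun hFA => ?_⟩
    obtain ⟨j, hj, hjT, hjB⟩ := hF A hFA
    exact hjB (h5 j (Finset.mem_filter.2 ⟨hj, hjT⟩))
  have h5 : pr V F + pr V (fun A => (∃ i ∈ Finset.range n, T i A) ∧ ¬ F A) ≤ e := by
    rw [pr_add]
    have h6 : pr V (fun A => F A ∧ (∃ i ∈ Finset.range n, T i A) ∧ ¬ F A) = 0 := by
      rw [pr_congr (q := fun _ => False) fun A => iff_of_false (fun h => h.2.2 h.1) id]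
      simp [pr, ind, ex_const]
    rw [h6, add_zero]
    refine pr_mono fun A hA => hA.elim (fun hFA => ?_) And.left
    obtain ⟨j, hj, hjT, -⟩ := hF A hFA
    exact ⟨j, hj, hjT⟩
  have h6 : (0 : ℝ) ≤ (7 / 8) ^ (2 * m) := by positivity
  nlinarith

/-- The lower right corner of the `i`-th diagonal block of side `s`. -/
def stair (s : ℤ) (i : ℕ) : Site := ((i + 1) * s, i * s)

theorem nrm_stair {s : ℤ} (hs : 0 ≤ s) {i j : ℕ} (hij : i ≤ j) :
    nrm (stair s j) (stair s i) = ((j : ℤ) - i) * s := by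
  have h0 : 0 ≤ ((j : ℤ) - i) * s := mul_nonneg (by omega) hs
  have h1 : ((j : ℤ) - i) * s = j * s - i * s := by ring
  have h2 : ∀ k : ℕ, ((k : ℤ) + 1) * s = k * s + s := fun k => by ring
  simp only [nrm, stair, h2]
  omega

theorem sum_pr_stair_le {K : ℕ} (hK : 1 ≤ K) (hcr : ∀ (V : Finset Site) (z : Site) (a : ℤ),
      1 ≤ a → pr V (fun A => Cr A z a (K * a)) ≤ 1 / 8)
    (V : Finset Site) {s R : ℤ} (hs : 1 ≤ s) (n : ℕ) (hR : K * ((4 * K + 2) * (n * s)) + n * s ≤ R) :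
    ∑ i ∈ Finset.range n, pr V (fun A => Tri True (stair s i) (4 * K * s) R A) ≤
      (2 * (4 * K * (K + 1) + 2) : ℕ) *
        pr V (fun A => ∃ i ∈ Finset.range n, Tri True (stair s i) (4 * K * s) R A) := by
  have hK' : (1 : ℤ) ≤ K := by exact_mod_cast hK
  set S : ℤ := n * s with hS
  rcases Nat.eq_zero_or_pos n with rfl | hn
  · simpa using mul_nonneg (by positivity) (pr_nonneg _ _)
  have hsS : s ≤ S := by
    have : (1 : ℤ) ≤ n := by exact_mod_cast hn
    nlinarith
  have hKs : s ≤ K * s := by nlinarith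
  have hKS : K * s ≤ K * S := by gcongr
  have e1 : (4 * K + 2) * S = 4 * (K * S) + 2 * S := by ring
  have e2 : 4 * K * s = 4 * (K * s) := by ring
  have h1 : ∀ i ∈ Finset.range n, pr V (fun A => Tri True (stair s i) (4 * K * s) R A) ≤
      2 * pr V (fun A => GoodTri K True (stair s i) (4 * K * s) ((4 * K + 2) * S) R A) :=
    fun i _ => pr_tri_le_two_mul_good hK' hcr V True _ (by omega) (by omega) (by omega)
  have h2 := sum_pr_le_of_separated V
    (fun i A => GoodTri K True (stair s i) (4 * K * s) ((4 * K + 2) * S) R A) (n := n)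
    (d := 4 * K * (K + 1) + 2) (by omega)
    (fun A => ∃ i ∈ Finset.range n, Tri True (stair s i) (4 * K * s) R A)
    (fun A i hi h => ⟨i, Finset.mem_range.2 hi, h.tri⟩) fun A i j hij hj hi' hj' => ?_
  · refine (Finset.sum_le_sum h1).trans ?_
    rw [← Finset.mul_sum]
    push_cast at h2 ⊢
    linarith
  · have hd : (4 * K * (K + 1) + 2 : ℤ) ≤ (j : ℤ) - i := by zify at hij; linarith
    have hδ := nrm_stair (s := s) (by omega) (i := i) (j := j) (by omega)
    have h3 : (4 * K * (K + 1) + 2) * s ≤ ((j : ℤ) - i) * s := by gcongr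
    have h4 : ((j : ℤ) - i) * s ≤ S := by
      rw [hS]
      gcongr
      omega
    have h5 : (4 * K * (K + 1) + 2) * s = K * (4 * K * s) + 4 * (K * s) + 2 * s := by ring
    have h6 : ((j : ℤ) - i) * s = j * s - i * s := by ring
    have h7 : 0 ≤ K * (4 * K * s) := by positivity
    refine not_goodTri_and_tri hK' (by omega) ?_ (fun _ => ?_) ?_ ?_ ?_ hj' hi'.tri
    · simp only [stair]
      omega
    · simp only [stair]
      gcongr
      omega
    · omega
    · omega
    · omega

/-- Refining the scale by the factor `8 * K` decreases the probability that some crossing cluster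
starts from the diagonal. -/
theorem pr_stair_step {K : ℕ} (hK : 1 ≤ K) (hcr : ∀ (V : Finset Site) (z : Site) (a : ℤ),
      1 ≤ a → pr V (fun A => Cr A z a (K * a)) ≤ 1 / 8)
    (V : Finset Site) {s R R' : ℤ} (hs : 1 ≤ s) {n : ℕ} (hn : 1 ≤ n)
    (hR : K * ((4 * K + 2) * (n * (8 * K * s))) + n * (8 * K * s) ≤ R) (hR' : R + 8 * K * s ≤ R') :
    pr V (fun A => ∃ i ∈ Finset.range (8 * K * n), Tri True (stair s i) (4 * K * s) R' A) ≤
      (1 - (7 / 8) ^ (2 * (2 * (4 * K * (K + 1) + 2))) / 2) *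
        pr V (fun A => ∃ i ∈ Finset.range n,
          Tri True (stair (8 * K * s) i) (4 * K * (8 * K * s)) R A) := by
  have hK' : (1 : ℤ) ≤ K := by exact_mod_cast hK
  set σ : ℤ := 8 * K * s with hσ
  have hKs : s ≤ K * s := by nlinarith
  have e0 : σ = 8 * (K * s) := by rw [hσ]; ring
  have hσ1 : 8 ≤ σ := by omega
  have hKσ : σ ≤ K * σ := by nlinarith
  have hnσ : σ ≤ n * σ := by
    have : (1 : ℤ) ≤ n := by exact_mod_cast hn
    nlinarith
  have e3 : K * ((4 * K + 2) * (n * σ)) = (4 * K + 2) * (K * (n * σ)) := by ring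
  have hKn : K * σ ≤ K * (n * σ) := by gcongr
  have hR2 : 6 * (K * σ) + σ ≤ R := by nlinarith
  have e4 : 4 * K * σ = 4 * (K * σ) := by ring
  have e5 : 4 * K * s = 4 * (K * s) := by ring
  have hdisj : ∀ i j : ℕ, ∀ v ∈ dom True (stair σ i) (4 * K * σ) R,
      2 * (K * σ) < nrm (stair σ j) v := by
    rintro i j v ⟨h1, h2, h3, -⟩
    have h2 := h2 trivial
    have h4 : ∀ k : ℕ, ((k : ℤ) + 1) * σ = k * σ + σ := fun k => by ring
    simp only [stair, nrm, h4] at h1 h2 h3 ⊢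
    omega
  refine pr_le_of_thinning V (fun i A => Tri True (stair σ i) (4 * K * σ) R A)
    (fun i A => ¬ Cr A (stair σ i) (2 * σ) (K * (2 * σ))) n (2 * (4 * K * (K + 1) + 2)) (by omega)
    (W₁ := ⋃ i, dom True (stair σ i) (4 * K * σ) R)
    (W₂ := (⋃ i, dom True (stair σ i) (4 * K * σ) R)ᶜ) disjoint_compl_right
    (fun i _ => (dep_tri _ _ _ _).mono (Set.subset_iUnion_of_subset i subset_rfl))
    (fun i _ => ((dep_cr _ _ _).not).mono ?_) (fun i A A' hA h h' => h (h'.mono_left hA)) (fun i => ?_)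
    (sum_pr_stair_le hK hcr V (by omega) n hR) ?_
  · rw [Set.subset_compl_iff_disjoint_right, Set.disjoint_iUnion_right]
    intro j
    refine Set.disjoint_left.2 fun v hv hv' => ?_
    have h1 := hdisj j i v hv'
    have h2 := hv.2
    have e6 : K * (2 * σ) = 2 * (K * σ) := by ring
    omega
  · rw [pr_not]
    have := hcr V (stair σ i) (2 * σ) (by omega)
    linarith
  · rintro A ⟨i', hi', h⟩
    rw [Finset.mem_range] at hi'
    set i := i' / (8 * K) with hi
    have hin : i < n := Nat.div_lt_of_lt_mul hi'
    have h1 : 8 * K * i ≤ i' := Nat.mul_div_le _ _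
    have h2 : i' + 1 ≤ 8 * K * (i + 1) := by
      exact Nat.lt_mul_div_succ i' (show 0 < 8 * K by omega)
    have h3 : (i : ℤ) * σ ≤ i' * s := by
      have : (8 * K * i : ℤ) ≤ i' := by exact_mod_cast h1
      calc (i : ℤ) * σ = (8 * K * i) * s := by rw [hσ]; ring
        _ ≤ i' * s := by gcongr
    have h4 : ((i' : ℤ) + 1) * s ≤ (i + 1) * σ := by
      have : (i' + 1 : ℤ) ≤ 8 * K * (i + 1) := by exact_mod_cast h2
      calc ((i' : ℤ) + 1) * s ≤ (8 * K * (i + 1)) * s := by gcongr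
        _ = (i + 1) * σ := by rw [hσ]; ring
    have h5 : ∀ k : ℕ, ∀ t : ℤ, ((k : ℤ) + 1) * t = k * t + t := fun k t => by ring
    have hn : nrm (stair σ i) (stair s i') ≤ σ := by
      simp only [nrm, stair, h5] at h3 h4 ⊢
      omega
    refine ⟨i, Finset.mem_range.2 hin, h.move ?_ ?_ hn (by omega) (by omega) (by omega) (by omega)
      (by omega), not_not.2 ?_⟩
    · simpa only [stair] using h4
    · simpa only [stair] using h3
    · obtain ⟨S, hS, ⟨w₀, hw₀, h6⟩, ⟨w₁, hw₁, h7⟩, -⟩ := h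
      have h8 := nrm_triangle (stair σ i) (stair s i') w₀
      have h9 := nrm_triangle (stair s i') (stair σ i) w₁
      have h10 := nrm_comm (stair s i') (stair σ i)
      have e6 : K * (2 * σ) = 2 * (K * σ) := by ring
      exact (hS.2.1 w₀ hw₀ w₁ hw₁).cr (fun v hv => (hS.1 hv).1) (by omega) (by omega) (by omega)

theorem pr_stair_iterate {K : ℕ} (hK : 1 ≤ K) (hcr : ∀ (V : Finset Site) (z : Site) (a : ℤ),
      1 ≤ a → pr V (fun A => Cr A z a (K * a)) ≤ 1 / 8) (V : Finset Site) (k : ℕ) {s R : ℤ}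
    (hs : 1 ≤ s) (hR : K * ((4 * K + 2) * ((8 * K) ^ k * s)) + 3 * ((8 * K) ^ k * s) - 2 * s ≤ R) :
    pr V (fun A => ∃ i ∈ Finset.range ((8 * K) ^ k), Tri True (stair s i) (4 * K * s) R A) ≤
      (1 - (7 / 8) ^ (2 * (2 * (4 * K * (K + 1) + 2))) / 2) ^ k := by
  induction k generalizing s R with
  | zero => simpa using pr_le_one V _
  | succ k ih =>
    have hK' : (1 : ℤ) ≤ K := by exact_mod_cast hK
    have hKs : s ≤ K * s := by nlinarith
    have e1 : (8 * K : ℤ) ^ (k + 1) * s = (8 * K) ^ k * (8 * K * s) := by ring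
    have e2 : 8 * K * s = 8 * (K * s) := by ring
    rw [e1] at hR
    have h0 : 8 * K * s ≤ (8 * K : ℤ) ^ k * (8 * K * s) := by
      have : (1 : ℤ) ≤ (8 * K) ^ k := one_le_pow₀ (by omega)
      nlinarith
    have h1 := pr_stair_step hK hcr V hs (n := (8 * K) ^ k) (R := R - 8 * K * s) (R' := R)
      (Nat.one_le_pow _ _ (by omega)) (by push_cast; omega) (by omega)
    have h2 := ih (s := 8 * K * s) (R := R - 8 * K * s) (by omega) (by omega)
    rw [pow_succ', pow_succ']
    refine h1.trans (mul_le_mul_of_nonneg_left h2 ?_)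
    have : (7 / 8 : ℝ) ^ (2 * (2 * (4 * K * (K + 1) + 2))) ≤ 1 :=
      pow_le_one₀ (by norm_num) (by norm_num)
    linarith

theorem pow_mul_pTri_le {K : ℕ} (hK : 1 ≤ K) (hcr : ∀ (V : Finset Site) (z : Site) (a : ℤ),
      1 ≤ a → pr V (fun A => Cr A z a (K * a)) ≤ 1 / 8) (k : ℕ) {s R : ℤ}
    (hs : 1 ≤ s) (hR : K * ((4 * K + 2) * ((8 * K) ^ k * s)) + 3 * ((8 * K) ^ k * s) ≤ R) :
    (8 * K) ^ k * pTri True (4 * K * s) R ≤ (2 * (4 * K * (K + 1) + 2) : ℕ) *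
      (1 - (7 / 8) ^ (2 * (2 * (4 * K * (K + 1) + 2))) / 2) ^ k := by
  set V : Finset Site := (Finset.range ((8 * K) ^ k)).biUnion fun i => ballF (stair s i) R
  have hS : (0 : ℤ) ≤ (8 * K) ^ k * s := by positivity
  have h1 := sum_pr_stair_le hK hcr V hs ((8 * K) ^ k) (R := R) (by push_cast; linarith)
  have h2 := pr_stair_iterate hK hcr V k hs (R := R) (by linarith)
  rw [Finset.sum_congr rfl fun i hi => pr_tri ?_] at h1
  · rw [Finset.sum_const, Finset.card_range, nsmul_eq_mul] at h1
    refine le_trans ?_ (h1.trans (mul_le_mul_of_nonneg_left h2 (by positivity)))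
    push_cast
    exact le_rfl
  · refine (dom_subset_ballF _ _ _ _).trans ?_
    exact_mod_cast Finset.subset_biUnion_of_mem (fun i => ballF (stair s i) R) hi

/-- In the quarter-plane the crossing cluster is rarer than in the half-plane bound used trivially:
its probability decays strictly faster than the inverse ratio of the radii. -/
theorem exists_pTri_wedge_le : ∃ b : ℝ, 0 < b ∧ b < 1 / 2 ∧ ∃ A : ℝ, 0 < A ∧
    ∀ r : ℤ, 1 ≤ r → ∀ J : ℕ, pTri True r (2 ^ J * r) ≤ A * b ^ J := by
  obtain ⟨k₀, hk₀, hcr⟩ := exists_pr_cr_le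
  set K : ℕ := 2 ^ k₀ with hK
  have hK1 : 1 ≤ K := Nat.one_le_two_pow
  have hKe : (K : ℤ) = 2 ^ k₀ := by rw [hK]; push_cast; rfl
  have hcr' : ∀ (V : Finset Site) (z : Site) (a : ℤ), 1 ≤ a →
      pr V (fun A => Cr A z a (K * a)) ≤ 1 / 8 := by
    intro V z a ha
    have h32 : (2 : ℤ) ^ 5 ≤ 2 ^ k₀ := pow_le_pow_right₀ (by norm_num) hk₀
    refine (pr_mono fun A h => h.mono_radii le_rfl ?_ ?_).trans (hcr V z a ha) <;>
      · rw [hKe] at *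
        nlinarith
  set q : ℝ := 1 - (7 / 8) ^ (2 * (2 * (4 * K * (K + 1) + 2))) / 2 with hq
  set d : ℝ := ((2 * (4 * K * (K + 1) + 2) : ℕ) : ℝ)
  have hd : 0 < d := by positivity
  have hx : (0 : ℝ) < (7 / 8) ^ (2 * (2 * (4 * K * (K + 1) + 2))) := by positivity
  have hx1 : (7 / 8 : ℝ) ^ (2 * (2 * (4 * K * (K + 1) + 2))) ≤ 1 :=
    pow_le_one₀ (by norm_num) (by norm_num)
  have hq0 : 0 < q := by linarith
  have hq1 : q < 1 := by linarith
  set h := k₀ + 3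
  have h8K : ((8 * K : ℕ) : ℝ) = 2 ^ h := by rw [hK]; push_cast; ring
  set b : ℝ := (q / 2 ^ h) ^ ((h : ℝ)⁻¹) with hb
  have hbh : b ^ h = q / 2 ^ h := Real.rpow_inv_natCast_pow (by positivity) (by omega)
  have hb0 : 0 < b := by positivity
  have hb2 : b < 1 / 2 := by
    refine lt_of_pow_lt_pow_left₀ h (by norm_num) ?_
    rw [hbh, one_div_pow]
    gcongr
  refine ⟨b, hb0, hb2, (b ^ (2 * k₀ + 4 + h))⁻¹ * (1 + d), by positivity, fun r hr J => ?_⟩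
  rcases lt_or_ge J (2 * k₀ + 4) with hJ | hJ
  · refine (pTri_le_one _ _ _).trans (one_le_mul_pow hb0 (by linarith)
      (J₀ := 2 * k₀ + 4 + h) (by omega) ?_)
    have : 0 < (b ^ (2 * k₀ + 4 + h))⁻¹ := by positivity
    nlinarith
  · obtain ⟨k, t, ht, rfl⟩ : ∃ k t : ℕ, t < h ∧ J = 2 * k₀ + 4 + h * k + t :=
      ⟨(J - (2 * k₀ + 4)) / h, (J - (2 * k₀ + 4)) % h, Nat.mod_lt _ (by omega), by
        have := Nat.div_add_mod (J - (2 * k₀ + 4)) h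
        omega⟩
    have e1 : (2 : ℤ) ^ (2 * k₀ + 4 + h * k) * r = 16 * (K * K) * ((8 * K) ^ k * r) := by
      rw [hKe, show (8 * 2 ^ k₀ : ℤ) = 2 ^ h by rw [pow_add]; ring, ← pow_mul]
      ring
    have hK1' : (1 : ℤ) ≤ K := by exact_mod_cast hK1
    have hY : r ≤ (8 * K : ℤ) ^ k * r := by
      have : (1 : ℤ) ≤ (8 * K) ^ k := one_le_pow₀ (by omega)
      nlinarith
    have h1 := pow_mul_pTri_le hK1 hcr' k hr (R := 2 ^ (2 * k₀ + 4 + h * k) * r) (by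
      rw [e1]
      have h2 : K * (4 * K + 2) + 3 ≤ (16 * (K * K) : ℤ) := by nlinarith
      calc K * ((4 * K + 2) * ((8 * K) ^ k * r)) + 3 * ((8 * K) ^ k * r) =
          (K * (4 * K + 2) + 3) * ((8 * K) ^ k * r) := by ring
        _ ≤ _ := by gcongr)
    have h2 : pTri True r (2 ^ (2 * k₀ + 4 + h * k + t) * r) ≤
        pTri True (4 * K * r) (2 ^ (2 * k₀ + 4 + h * k) * r) := by
      refine pTri_mono (by nlinarith) ?_ ?_
      · have : (2 : ℤ) ^ (2 * k₀ + 4 + h * k) ≤ 2 ^ (2 * k₀ + 4 + h * k + t) :=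
          pow_le_pow_right₀ (by norm_num) (by omega)
        gcongr
      · rw [e1]
        calc 4 * K * r < 16 * (K * K) * r := by
              have : (4 * K : ℤ) < 16 * (K * K) := by nlinarith
              gcongr
          _ ≤ _ := by gcongr
    push_cast at h8K
    rw [h8K] at h1
    have h3 : pTri True (4 * K * r) (2 ^ (2 * k₀ + 4 + h * k) * r) ≤ d * b ^ (h * k) := by
      rw [pow_mul, hbh, div_pow, ← mul_div_assoc, le_div_iff₀ (by positivity), mul_comm]
      exact h1
    refine h2.trans (h3.trans ?_)
    have h4 : 1 ≤ (b ^ (2 * k₀ + 4 + h))⁻¹ * b ^ (2 * k₀ + 4 + t) :=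
      one_le_mul_pow hb0 (by linarith) (by omega) le_rfl
    calc d * b ^ (h * k) ≤ (1 + d) * b ^ (h * k) * 1 := by
          rw [mul_one]
          gcongr
          linarith
      _ ≤ (1 + d) * b ^ (h * k) * ((b ^ (2 * k₀ + 4 + h))⁻¹ * b ^ (2 * k₀ + 4 + t)) := by gcongr
      _ = _ := by rw [pow_add b (2 * k₀ + 4 + h * k), pow_add b (2 * k₀ + 4) (h * k),
                    pow_add b (2 * k₀ + 4) t]; ring

/-! ### The pivotal sites near the bottom side -/

theorem tri_of_conn_top {q : Prop} {n r R : ℤ} {z x t : Site} {A : Set Site}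
    (hLR : CrossLR Aᶜ (-n) n (-n) n) (hxt : Conn (A ∩ rect (-n) n (-n) n) x t) (ht : t.2 = n)
    (hz : z.2 = -n) (hq : q → z.1 = n) (hx : nrm z x ≤ r + 1) (hr : r < R) (hR : R ≤ nrm z t)
    (hdom : dom q z r R ⊆ rect (-n) n (-n) n) : Tri q z r R A := by
  obtain ⟨x', y', hx', hy', h1, h2⟩ := hxt.exists_level (nrm_adj z) hx (by omega) hR
  have hsub : A ∩ rect (-n) n (-n) n ∩ {u | r + 1 ≤ nrm z u ∧ nrm z u ≤ R} ⊆ A ∩ dom q z r R := by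
    rintro w ⟨⟨hw, h3, h4, h5, h6⟩, h7, h8⟩
    exact ⟨hw, by omega, fun h => by have := hq h; omega, by omega, h8⟩
  refine tri_of_conn (h1.mono hsub) hx'.le hy' fun w hw => ?_
  have hw' : Conn (A ∩ rect (-n) n (-n) n) x' w :=
    hw.mono fun v hv => ⟨hv.1, hdom hv.2⟩
  have h3 := hw'.right_mem.2.2.2.1
  refine lt_of_le_of_ne (by omega) fun h4 => not_crossLR_and_crossBT hLR ?_
  rw [compl_compl]
  exact ⟨w, show w.2 = -n by omega, t, ht, hw'.symm.trans (h2.symm.trans hxt)⟩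

theorem Pivotal.exists_conn {n : ℤ} {ω : Config} {v : Site} (h : Pivotal n ω v) :
    CrossLR {v | ω v = false}ᶜ (-n) n (-n) n ∧ ∃ x t, Adj v x ∧ t.2 = n ∧
      Conn ({v | ω v = false} ∩ rect (-n) n (-n) n) x t := by
  obtain ⟨⟨p, ⟨⟨⟨_, _, hp⟩, hp1⟩, hp2, ⟨a, ha, ha'⟩, b, hb, hb'⟩, _⟩, q₁, -, ⟨⟨_, _, hq⟩, hq1⟩, hq2,
    ⟨x, hx, hx'⟩, ⟨t, ht, ht'⟩, -⟩ := h
  have hp3 : ∀ v ∈ p, v ∈ {v | ω v = false}ᶜ ∩ rect (-n) n (-n) n :=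
    fun v hv => ⟨by simp [hp2 v hv], hp1 v hv⟩
  have hq3 : ∀ v ∈ q₁, v ∈ {v | ω v = false} ∩ rect (-n) n (-n) n :=
    fun v hv => ⟨hq2 v hv, hq1 v hv⟩
  exact ⟨⟨a, ha.2, b, hb.2, conn_of_isChain hp hp3 ha' (List.mem_of_getLast? hb')⟩, x, t, hx, ht.2,
    conn_of_isChain hq hq3 hx' (List.mem_of_getLast? ht')⟩

section Block

variable {n m d e : ℤ} {k : ℕ}

theorem Pivotal.tri_block {x : ℤ} {ω : Config} {v : Site} (h : Pivotal n ω v)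
    (hkx : x = -n + (k : ℤ) * m) (hv : v ∈ Hblock n m k) (hx : n - d + m ≤ x)
    (hd : d ≤ n) (he : 2 * e ≤ d) (hxe : x + e ≤ n) (hme : m < e) :
    Tri False (x, -n) m e {v | ω v = false} := by
  obtain ⟨hLR, y, t, hvy, ht, hyt⟩ := h.exists_conn
  obtain ⟨h1, h2, h3, h4⟩ := hv
  rw [← hkx] at h2
  have h1' : x - m < v.1 := by rw [hkx]; linarith
  rw [adj_iff] at hvy
  obtain ⟨g1, g2, g3, g4⟩ := hyt.left_mem.2
  refine tri_of_conn_top hLR hyt ht rfl False.elim ?_ hme ?_ ?_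
  · simp only [nrm]; omega
  · simp only [nrm]; omega
  · rintro w ⟨hw, _, _, hw'⟩
    simp only [nrm] at hw hw'
    refine ⟨?_, ?_, ?_, ?_⟩ <;> omega

theorem Pivotal.tri_corner {x : ℤ} {ω : Config} {v : Site} (h : Pivotal n ω v)
    (hkx : x = -n + (k : ℤ) * m) (hv : v ∈ Hblock n m k) (hm : 1 ≤ m) (hx : n - d + m ≤ x)
    (hxn : x ≤ n) (hdn : 2 * d < n) : Tri True (n, -n) (2 * d) n {v | ω v = false} := by
  obtain ⟨hLR, y, t, hvy, ht, hyt⟩ := h.exists_conn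
  obtain ⟨h1, h2, h3, h4⟩ := hv
  rw [← hkx] at h2
  have h1' : x - m < v.1 := by rw [hkx]; linarith
  rw [adj_iff] at hvy
  obtain ⟨g1, g2, g3, g4⟩ := hyt.left_mem.2
  refine tri_of_conn_top hLR hyt ht rfl (fun _ => rfl) ?_ hdn ?_ ?_
  · simp only [nrm]; omega
  · simp only [nrm]; omega
  · rintro w ⟨hw, hw1, _, hw'⟩
    have := hw1 trivial
    simp only [nrm] at hw hw' this
    refine ⟨?_, ?_, ?_, ?_⟩ <;> omega

theorem Dep.imp_const {W : Set Site} {p : Set Site → Prop} (h : Dep W p) (c : Prop) :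
    Dep W (fun A => c → p A) := by
  intro A B hAB
  simp only [h A B hAB]

theorem pr_imp_tri_le {q c : Prop} {z : Site} {r R : ℤ} {V : Finset Site} {B : ℝ}
    (hV : dom q z r R ⊆ V) (h1 : c → pTri q r R ≤ B) (h2 : ¬ c → 1 ≤ B) :
    pr V (fun A => c → Tri q z r R A) ≤ B := by
  by_cases hc : c
  · simp only [hc, true_imp_iff]
    rw [pr_tri hV]
    exact h1 hc
  · exact (pr_le_one _ _).trans (h2 hc)

theorem IsBernoulliHalf.measure_pivotal_le {μ : Measure Config} (hμ : IsBernoulliHalf μ)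
    {x : ℤ} {B₁ B₂ : ℝ} (hkx : x = -n + (k : ℤ) * m) (hm : 1 ≤ m) (hx : n - d + m ≤ x)
    (hxn : x ≤ n) (hd : d ≤ n) (hed : e ≤ d) (he : m < e → 2 * e ≤ d ∧ x + e ≤ n)
    (h1 : m < e → pTri False m e ≤ B₁) (h1' : ¬ m < e → 1 ≤ B₁)
    (h2 : 2 * d < n → pTri True (2 * d) n ≤ B₂) (h2' : ¬ 2 * d < n → 1 ≤ B₂) :
    μ {ω | (Qset n ω ∩ Hblock n m k).Nonempty} ≤ ENNReal.ofReal (B₁ * B₂) := by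
  classical
  have hsub : {ω | (Qset n ω ∩ Hblock n m k).Nonempty} ⊆
      {ω | (fun A : Set Site => (m < e → Tri False (x, -n) m e A) ∧
        (2 * d < n → Tri True (n, -n) (2 * d) n A)) {v | ω v = false}} := by
    rintro ω ⟨v, hv, hvH⟩
    exact And.intro (fun hme => Pivotal.tri_block hv hkx hvH hx hd (he hme).1 (he hme).2 hme)
      fun hdn => Pivotal.tri_corner hv hkx hvH hm hx hxn hdn
  set V : Finset Site := ballF (x, -n) e ∪ ballF (n, -n) n
  have hV1 : dom False (x, -n) m e ⊆ V := (dom_subset_ballF _ _ _ _).trans (by simp [V])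
  have hV2 : dom True (n, -n) (2 * d) n ⊆ V := (dom_subset_ballF _ _ _ _).trans (by simp [V])
  have dep1 := (dep_tri False (x, -n) m e).imp_const (m < e)
  have dep2 := (dep_tri True (n, -n) (2 * d) n).imp_const (2 * d < n)
  have hdisj : Disjoint (dom False (x, -n) m e) (dom True (n, -n) (2 * d) n) := by
    rw [Set.disjoint_left]
    rintro w ⟨_, _, _, g1⟩ ⟨_, _, g2, _⟩
    simp only [nrm] at g1 g2
    omega
  refine (measure_mono hsub).trans ((hμ.measure_le ((dep1.mono hV1).and (dep2.mono hV2))).trans ?_)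
  refine ENNReal.ofReal_le_ofReal ?_
  rw [pr_and_of_indep V hdisj dep1 dep2]
  have b1 := pr_imp_tri_le hV1 h1 h1'
  exact mul_le_mul b1 (pr_imp_tri_le hV2 h2 h2') (pr_nonneg _ _) ((pr_nonneg _ _).trans b1)

end Block

theorem ofReal_rate_eq {b K : ℝ} (hb : 0 < b) (hK : 0 ≤ K) {i₀ j₀ j : ℕ} (hi : i₀ ≤ j₀) (hj : j ≤ i₀) :
    ENNReal.ofReal (K * (1 / 4) ^ (i₀ - j) * b ^ j) =
      ENNReal.ofReal K * (2 : ℝ≥0∞) ^ ((1 - (1 - Real.logb 2 (4 * b))) * (j : ℝ)) *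
        ((2 ^ (j₀ - i₀) : ℕ) : ℝ≥0∞) ^ 2 / ((2 ^ j₀ : ℕ) : ℝ≥0∞) ^ 2 := by
  have e1 : (2 : ℝ≥0∞) ^ ((1 - (1 - Real.logb 2 (4 * b))) * (j : ℝ)) =
      ENNReal.ofReal ((4 * b) ^ j) := by
    rw [sub_sub_cancel, show (2 : ℝ≥0∞) = ENNReal.ofReal 2 by simp,
      ENNReal.ofReal_rpow_of_pos two_pos, Real.rpow_mul two_pos.le,
      Real.rpow_logb two_pos (by norm_num) (by positivity), Real.rpow_natCast]
  have e2 : ∀ a : ℕ, ((2 ^ a : ℕ) : ℝ≥0∞) ^ 2 = ENNReal.ofReal (4 ^ a) := by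
    intro a
    rw [ENNReal.ofReal_pow (by norm_num), Nat.cast_pow, ← pow_mul, pow_mul']
    norm_num
  rw [e1, e2, e2, ← ENNReal.ofReal_mul hK, ← ENNReal.ofReal_mul (by positivity),
    ← ENNReal.ofReal_div_of_pos (by positivity)]
  congr 1
  obtain ⟨u, rfl⟩ := Nat.exists_eq_add_of_le hj
  obtain ⟨s, rfl⟩ := Nat.exists_eq_add_of_le hi
  rw [Nat.add_sub_cancel_left, Nat.add_sub_cancel_left, mul_pow, one_div, inv_pow]
  field_simp
  ring

/-- There exist constants `α > 0` and `C < ∞` such that for all `n = 2^{j₀}`,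
`m = 2^{-i₀}n`, and all `k` with `n/m ≤ k ≤ 2n/m`, if `j` is the index with
the `x`-coordinates of `H_k` contained in `I_j`, then
`P(Q_n ∩ H_k ≠ ∅) ≤ C·2^{(1-α)j}·m²·n^{-2}`. -/
theorem statement6 :
    ∃ α : ℝ, 0 < α ∧ ∃ C : ℝ≥0∞, C < ⊤ ∧
      ∀ μ : Measure Config, IsBernoulliHalf μ →
        ∀ j₀ i₀ : ℕ, i₀ ≤ j₀ →
          ∀ n m : ℕ, n = 2 ^ j₀ → m = 2 ^ (j₀ - i₀) →
            ∀ k j : ℕ, j ≤ i₀ → 2 ^ i₀ ≤ k → k ≤ 2 ^ (i₀ + 1) →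
              Set.Ioc (-(n : ℤ) + ((k : ℤ) - 1) * (m : ℤ))
                  (-(n : ℤ) + (k : ℤ) * (m : ℤ)) ⊆ Iset j₀ i₀ j →
              μ {ω | (Qset (n : ℤ) ω ∩ Hblock (n : ℤ) (m : ℤ) k).Nonempty} ≤
                C * (2 : ℝ≥0∞) ^ ((1 - α) * (j : ℝ)) *
                  (m : ℝ≥0∞) ^ 2 / (n : ℝ≥0∞) ^ 2 := by
  obtain ⟨a, ha, hquarter⟩ := hasDecay_quarter
  obtain ⟨b, hb, hb2, a', ha', hwedge⟩ := exists_pTri_wedge_le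
  refine ⟨1 - Real.logb 2 (4 * b), ?_, ENNReal.ofReal (4 * (a + 1) * ((a' + 1) / b)),
    ENNReal.ofReal_lt_top, ?_⟩
  · rw [sub_pos, Real.logb_lt_iff_lt_rpow (by norm_num) (by positivity)]
    norm_num
    linarith
  intro μ hμ j₀ i₀ hi n m hn hm k j hj _ _ hsub
  subst hn hm
  rw [← ofReal_rate_eq hb (by positivity) hi hj]
  have hm1 : (1 : ℤ) ≤ ((2 ^ (j₀ - i₀) : ℕ) : ℤ) := by exact_mod_cast Nat.one_le_two_pow
  set x : ℤ := -((2 ^ j₀ : ℕ) : ℤ) + (k : ℤ) * ((2 ^ (j₀ - i₀) : ℕ) : ℤ) with hkx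
  have hlow : -((2 ^ j₀ : ℕ) : ℤ) + ((k : ℤ) - 1) * ((2 ^ (j₀ - i₀) : ℕ) : ℤ) =
      x - ((2 ^ (j₀ - i₀) : ℕ) : ℤ) := by rw [hkx]; ring
  rw [hlow] at hsub
  have hr := hsub (Set.right_mem_Ioc.2 (by omega))
  have hl := hsub (a := x - ((2 ^ (j₀ - i₀) : ℕ) : ℤ) + 1) ⟨by omega, by omega⟩
  clear hsub hlow
  push_cast at hr hl hm1 hkx
  have hmd : (2 : ℤ) ^ (j₀ - i₀) ≤ 2 ^ (j₀ - j) := pow_le_pow_right₀ (by norm_num) (by omega)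
  have hdn : (2 : ℤ) ^ (j₀ - j) ≤ 2 ^ j₀ := pow_le_pow_right₀ (by norm_num) (by omega)
  have hed : (2 : ℤ) ^ (j₀ - j - 1) ≤ 2 ^ (j₀ - j) := pow_le_pow_right₀ (by norm_num) (by omega)
  have hme : (2 : ℤ) ^ (j₀ - i₀) < 2 ^ (j₀ - j - 1) → j + 1 < i₀ := by
    intro h
    by_contra h'
    exact h.not_ge (pow_le_pow_right₀ (by norm_num) (by omega))
  have hIset : 2 ^ j₀ - 2 ^ (j₀ - j) + 2 ^ (j₀ - i₀) ≤ x ∧ x ≤ 2 ^ j₀ ∧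
      (j < i₀ → x + 2 ^ (j₀ - j - 1) ≤ 2 ^ j₀) := by
    unfold Iset at hr hl
    split_ifs at hr hl with hji
    · subst hji
      exact ⟨by have := hl.1; omega, hr.2, fun h => absurd h (lt_irrefl _)⟩
    · have h1 := hl.1
      have h2 := hr.2
      have : (0 : ℤ) < 2 ^ (j₀ - j - 1) := by positivity
      exact ⟨by omega, by omega, fun _ => by omega⟩
  have key := hμ.measure_pivotal_le (n := 2 ^ j₀) (m := 2 ^ (j₀ - i₀)) (d := 2 ^ (j₀ - j))
    (e := 2 ^ (j₀ - j - 1)) (k := k) (B₁ := 4 * (a + 1) * (1 / 4) ^ (i₀ - j))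
    (B₂ := (a' + 1) / b * b ^ j) hkx hm1 hIset.1 hIset.2.1 hdn hed ?_ ?_ ?_ ?_ ?_
  · push_cast
    refine key.trans (le_of_eq ?_)
    congr 1
    ring
  · intro h
    have h' := hme h
    refine ⟨?_, hIset.2.2 (by omega)⟩
    rw [← pow_succ', show j₀ - j - 1 + 1 = j₀ - j by omega]
  · intro h
    have h' := hme h
    have h1 := hquarter _ hm1 (i₀ - j - 1)
    rw [← pow_add, show i₀ - j - 1 + (j₀ - i₀) = j₀ - j - 1 by omega] at h1
    refine h1.trans ?_
    rw [show i₀ - j = i₀ - j - 1 + 1 by omega, Nat.add_sub_cancel, pow_succ]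
    have : (0 : ℝ) < (1 / 4) ^ (i₀ - j - 1) := by positivity
    nlinarith
  · intro h
    have h' : i₀ - j ≤ 1 := by
      by_contra h'
      exact h (pow_lt_pow_right₀ (by norm_num) (by omega))
    exact one_le_mul_pow (by norm_num) (by norm_num) h' (by norm_num; linarith)
  · intro h
    have h' : 1 < j := by
      by_contra h'
      refine h.not_ge ?_
      rw [← pow_succ']
      exact pow_le_pow_right₀ (by norm_num) (by omega)
    have h1 := hwedge (2 * 2 ^ (j₀ - j)) (by omega) (j - 1)
    rw [← pow_succ', ← pow_add, show j - 1 + (j₀ - j + 1) = j₀ by omega, pow_succ'] at h1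
    refine h1.trans ?_
    rw [show b ^ j = b ^ (j - 1) * b by rw [← pow_succ, Nat.sub_add_cancel (by omega)]]
    rw [div_mul_eq_mul_div, mul_div_assoc, mul_div_cancel_right₀ _ hb.ne']
    gcongr
    linarith
  · intro h
    have h' : j ≤ 1 := by
      by_contra h'
      refine h ?_
      rw [← pow_succ']
      exact pow_lt_pow_right₀ (by norm_num) (by omega)
    refine one_le_mul_pow hb (by linarith) h' ?_
    rw [pow_one, inv_eq_one_div]
    gcongr
    linarith
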